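/- For all integers d, k ≥ 1 there exists ε > 0 such that the following holds: for every field K and every k-tuple (a_1, …, a_k) of elements of GL_d(K) generating a subgroup which is not virtually solvable, and for every integer n ≥ 1, the number of elements w of the free group F_k on k generators with reduced word length at most n satisfying w(a_1, …, a_k) = 1 in GL_d(K) is at most exp(−εn) times the total number of elements of F_k of reduced word length at most n. -/

import Mathlib

open scoped MatrixGroups

namespace CG

/-- displacement energy of a word -/
noncomputable def En {k : ℕ} {X : Type} (ρ : FreeGroup (Fin k) →* Equiv.Perm X) (w : FreeGroup (Fin k))
    (f : X → ℝ) : ℝ := ∑' x, (f (ρ w x) - f x) ^ 2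

noncomputable def Gap {k : ℕ} {X : Type} (ε : ℝ) (ρ : FreeGroup (Fin k) →* Equiv.Perm X) : Prop :=
  ∀ f : X → ℝ, f.support.Finite → ε * ∑' x, f x ^ 2 ≤ ∑ i, En ρ (FreeGroup.of i) f

section
variable {k : ℕ} {X : Type} (ρ : FreeGroup (Fin k) →* Equiv.Perm X)

lemma fin_comp {f : X → ℝ} (hf : f.support.Finite) (e : Equiv.Perm X) :
    (fun x => f (e x)).support.Finite := by
  have : (fun x => f (e x)).support = e ⁻¹' f.support := rfl
  rw [this]
  exact hf.preimage e.injective.injOn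

lemma fin_diff {f : X → ℝ} (hf : f.support.Finite) (e : Equiv.Perm X) :
    (fun x => f (e x) - f x).support.Finite :=
  ((fin_comp hf e).union hf).subset (Function.support_sub _ _)

lemma sum_sq {g : X → ℝ} (hg : g.support.Finite) : Summable (fun x => g x ^ 2) := by
  apply summable_of_hasFiniteSupport
  refine hg.subset ?_
  intro x hx
  simp only [Function.mem_support] at hx ⊢
  intro h; exact hx (by simp [h])

lemma En_nonneg (w) (f : X → ℝ) : 0 ≤ En ρ w f := tsum_nonneg fun _ => sq_nonneg _

lemma En_mul (w w' : FreeGroup (Fin k)) {f : X → ℝ} (hf : f.support.Finite) :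
    En ρ (w * w') f ≤ 2 * En ρ w f + 2 * En ρ w' f := by
  have h1 : En ρ w f = ∑' x, (f (ρ w (ρ w' x)) - f (ρ w' x)) ^ 2 := by
    unfold En
    rw [← (ρ w').tsum_eq (fun x => (f (ρ w x) - f x) ^ 2)]
  rw [h1]
  unfold En
  rw [← tsum_mul_left, ← tsum_mul_left]
  have s1 : Summable fun x => (f (ρ w (ρ w' x)) - f (ρ w' x)) ^ 2 :=
    sum_sq (fin_comp (fin_diff hf (ρ w)) (ρ w'))
  have s2 : Summable fun x => (f (ρ w' x) - f x) ^ 2 := sum_sq (fin_diff hf _)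
  rw [← (s1.mul_left 2).tsum_add (s2.mul_left 2)]
  refine Summable.tsum_le_tsum ?_ (sum_sq (fin_diff hf _)) ((s1.mul_left 2).add (s2.mul_left 2))
  intro x
  simp only [map_mul, Equiv.Perm.mul_apply]
  nlinarith [sq_nonneg ((f (ρ w (ρ w' x)) - f (ρ w' x)) - (f (ρ w' x) - f x))]

lemma En_inv (w : FreeGroup (Fin k)) (f : X → ℝ) : En ρ w⁻¹ f = En ρ w f := by
  unfold En
  rw [← (ρ w).tsum_eq (fun x => (f (ρ w⁻¹ x) - f x) ^ 2)]
  congr 1; ext x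
  have : ρ w⁻¹ (ρ w x) = x := by simp
  rw [this]; ring

end

lemma En_bound {k : ℕ} (w : FreeGroup (Fin k)) : ∃ C : ℝ, 0 ≤ C ∧ ∀ (X : Type)
    (ρ : FreeGroup (Fin k) →* Equiv.Perm X) (f : X → ℝ), f.support.Finite →
    En ρ w f ≤ C * ∑ i, En ρ (FreeGroup.of i) f := by
  induction w using FreeGroup.induction_on with
  | C1 => exact ⟨0, le_rfl, fun X ρ f _ => by simp [En]⟩
  | of i =>
    refine ⟨1, zero_le_one, fun X ρ f _ => ?_⟩
    rw [one_mul]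
    exact Finset.single_le_sum (f := fun i => En ρ (FreeGroup.of i) f)
      (fun j _ => En_nonneg ρ _ f) (Finset.mem_univ i)
  | inv_of i h =>
    obtain ⟨C, h0, hC⟩ := h
    exact ⟨C, h0, fun X ρ f hf => by rw [En_inv]; exact hC X ρ f hf⟩
  | mul x y hx hy =>
    obtain ⟨C, h0, hC⟩ := hx
    obtain ⟨C', h0', hC'⟩ := hy
    refine ⟨2 * C + 2 * C', by positivity, fun X ρ f hf => ?_⟩
    have := En_mul ρ x y hf
    have := hC X ρ f hf
    have := hC' X ρ f hf
    linarith

lemma En_bound_fin {k : ℕ} (S : Set (FreeGroup (Fin k))) (hS : S.Finite) : ∃ C : ℝ, 0 ≤ C ∧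
    ∀ w ∈ S, ∀ (X : Type)
    (ρ : FreeGroup (Fin k) →* Equiv.Perm X) (f : X → ℝ), f.support.Finite →
    En ρ w f ≤ C * ∑ i, En ρ (FreeGroup.of i) f := by
  choose C h0 hC using En_bound (k := k)
  refine ⟨∑ w ∈ hS.toFinset, C w, Finset.sum_nonneg fun w _ => h0 w, fun w hw X ρ f hf => ?_⟩
  refine (hC w X ρ f hf).trans ?_
  refine mul_le_mul_of_nonneg_right ?_ (Finset.sum_nonneg fun i _ => En_nonneg ρ _ f)
  exact Finset.single_le_sum (f := C) (fun j _ => h0 j) (hS.mem_toFinset.2 hw)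

/-- transfer of the gap from a finite tuple of words to the generators -/
lemma gap_transfer {k k' : ℕ} (θ : FreeGroup (Fin k') →* FreeGroup (Fin k)) (ε : ℝ) (hε : 0 < ε) :
    ∃ ε' : ℝ, 0 < ε' ∧ ∀ (X : Type) (ρ : FreeGroup (Fin k) →* Equiv.Perm X),
      Gap ε (ρ.comp θ) → Gap ε' ρ := by
  obtain ⟨C, h0, hC⟩ := En_bound_fin (Set.range fun i => θ (FreeGroup.of i)) (Set.finite_range _)
  refine ⟨ε / (k' * C + 1), by positivity, fun X ρ h f hf => ?_⟩
  have h1 := h f hf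
  have h2 : ∑ i, En (ρ.comp θ) (FreeGroup.of i) f ≤ k' * C * ∑ i, En ρ (FreeGroup.of i) f := by
    calc _ ≤ ∑ i : Fin k', C * ∑ i, En ρ (FreeGroup.of i) f := by
          refine Finset.sum_le_sum fun i _ => ?_
          exact hC _ ⟨i, rfl⟩ X ρ f hf
      _ = _ := by simp; ring
  have h3 : 0 ≤ ∑ i, En ρ (FreeGroup.of i) f := Finset.sum_nonneg fun i _ => En_nonneg ρ _ f
  rw [div_mul_eq_mul_div, div_le_iff₀ (by positivity)]
  nlinarith

set_option maxHeartbeats 1000000 in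
open Classical in
/-- paradox lemma -/
lemma gap_of_paradox {k : ℕ} (Q H : Set (FreeGroup (Fin k))) (hQ : Q.Finite) (hH : H.Finite) :
    ∃ ε : ℝ, 0 < ε ∧ ∀ (X : Type) (ρ : FreeGroup (Fin k) →* Equiv.Perm X) (A : Set X),
      ∀ q ∈ Q, (∀ x ∈ A, ∀ i : ℕ, 1 ≤ i → ρ (q ^ i) x ∉ A) → (∀ x, ∃ h ∈ H, ρ h x ∈ A) →
      Gap ε ρ := by
  set m := hH.toFinset.card with hm
  set I := 8 * m with hI
  obtain ⟨C1, h01, hC1⟩ := En_bound_fin H hH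
  obtain ⟨C2, h02, hC2⟩ := En_bound_fin (⋃ i ∈ Finset.range I, (fun q => q ^ (i + 1)) '' Q)
    (Set.Finite.biUnion (Finset.finite_toSet _) fun i _ => hQ.image _)
  refine ⟨1 / (4 * m * C1 + 8 * m * C2 + 1), by positivity, fun X ρ A q hq hqA hHA f hf => ?_⟩
  set η := ∑ i, En ρ (FreeGroup.of i) f with hη
  have hη0 : 0 ≤ η := Finset.sum_nonneg fun i _ => En_nonneg ρ _ f
  set S := ∑' x, f x ^ 2 with hS
  have sS : Summable fun x => f x ^ 2 := sum_sq hf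
  set a := ∑' x, A.indicator (fun x => f x ^ 2) x with ha
  have sA : Summable (A.indicator (fun x => f x ^ 2)) := sS.indicator A
  have ha0 : 0 ≤ a := tsum_nonneg fun x => Set.indicator_nonneg (fun _ _ => sq_nonneg _) _
  -- each h
  have hstep : ∀ w, (∑' x, (if ρ w x ∈ A then f x ^ 2 else 0)) ≤ 2 * a + 2 * En ρ w f := by
    intro w
    have e1 : a = ∑' x, A.indicator (fun x => f x ^ 2) (ρ w x) := ((ρ w).tsum_eq _).symm
    have s1 : Summable fun x => A.indicator (fun x => f x ^ 2) (ρ w x) := (ρ w).summable_iff.2 sA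
    have s2 : Summable fun x => (f (ρ w x) - f x) ^ 2 := sum_sq (fin_diff hf _)
    rw [e1]; unfold En
    rw [← tsum_mul_left, ← tsum_mul_left, ← (s1.mul_left 2).tsum_add (s2.mul_left 2)]
    refine Summable.tsum_le_tsum ?_ ?_ ((s1.mul_left 2).add (s2.mul_left 2))
    · intro x
      by_cases hx : ρ w x ∈ A
      · simp only [hx, if_true, Set.indicator_of_mem]
        nlinarith [sq_nonneg (f (ρ w x) + (f (ρ w x) - f x))]
      · simp only [hx, if_false, not_false_eq_true, Set.indicator_of_notMem]
        positivity
    · exact sS.indicator {x | ρ w x ∈ A}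
  have hcov : S ≤ ∑ h ∈ hH.toFinset, (2 * a + 2 * En ρ h f) := by
    have : S ≤ ∑ h ∈ hH.toFinset, ∑' x, (if ρ h x ∈ A then f x ^ 2 else 0) := by
      have hs : ∀ h ∈ hH.toFinset, Summable fun x => (if ρ h x ∈ A then f x ^ 2 else 0) :=
        fun h _ => sS.indicator {x | ρ h x ∈ A}
      rw [← Summable.tsum_finsetSum hs]
      refine Summable.tsum_le_tsum ?_ sS (summable_sum hs)
      intro x
      obtain ⟨h, hh, hx⟩ := hHA x
      refine le_trans ?_ (Finset.single_le_sum (f := fun h => if ρ h x ∈ A then f x ^ 2 else 0)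
        (fun j _ => by split_ifs <;> positivity) (hH.mem_toFinset.2 hh))
      simp [hx]
    exact this.trans (Finset.sum_le_sum fun h _ => hstep h)
  have hcov2 : S ≤ m * (2 * a + 2 * (C1 * η)) := by
    refine hcov.trans ?_
    calc _ ≤ ∑ h ∈ hH.toFinset, (2 * a + 2 * (C1 * η)) := by
          refine Finset.sum_le_sum fun h hh => ?_
          have := hC1 h (hH.mem_toFinset.1 hh) X ρ f hf
          linarith
      _ = _ := by rw [Finset.sum_const, nsmul_eq_mul]
  -- disjoint translates
  have hdis : ∀ w, a ≤ 2 * (∑' x, (if x ∈ A then f (ρ w x) ^ 2 else 0)) + 2 * En ρ w f := by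
    intro w
    have s1 : Summable fun x => (if x ∈ A then f (ρ w x) ^ 2 else 0) :=
      (sum_sq (fin_comp hf (ρ w))).indicator A
    have s2 : Summable fun x => (f (ρ w x) - f x) ^ 2 := sum_sq (fin_diff hf _)
    unfold En
    rw [← tsum_mul_left, ← tsum_mul_left, ← (s1.mul_left 2).tsum_add (s2.mul_left 2)]
    refine Summable.tsum_le_tsum ?_ sA ((s1.mul_left 2).add (s2.mul_left 2))
    intro x
    by_cases hx : x ∈ A
    · simp only [hx, if_true, Set.indicator_of_mem]
      nlinarith [sq_nonneg (f (ρ w x) + (f (ρ w x) - f x))]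
    · simp only [hx, if_false, not_false_eq_true, Set.indicator_of_notMem]
      positivity
  have htot : ∑ i ∈ Finset.range I, (∑' x, (if x ∈ A then f (ρ (q ^ (i + 1)) x) ^ 2 else 0)) ≤ S := by
    have e : ∀ i, (∑' x, (if x ∈ A then f (ρ (q ^ (i + 1)) x) ^ 2 else 0)) =
        ∑' x, (if (ρ (q ^ (i + 1)))⁻¹ x ∈ A then f x ^ 2 else 0) := by
      intro i
      rw [← (ρ (q ^ (i + 1))).tsum_eq (fun x => (if (ρ (q ^ (i + 1)))⁻¹ x ∈ A then f x ^ 2 else 0))]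
      simp
    simp_rw [e]
    have hs : ∀ i ∈ Finset.range I, Summable fun x => (if (ρ (q ^ (i + 1)))⁻¹ x ∈ A then f x ^ 2 else 0) :=
      fun i _ => sS.indicator {x | (ρ (q ^ (i + 1)))⁻¹ x ∈ A}
    rw [← Summable.tsum_finsetSum hs]
    refine Summable.tsum_le_tsum ?_ (summable_sum hs) sS
    intro x
    by_cases hx : ∃ i ∈ Finset.range I, (ρ (q ^ (i + 1)))⁻¹ x ∈ A
    · obtain ⟨i, hi, hxi⟩ := hx
      rw [Finset.sum_eq_single_of_mem i hi]
      · split_ifs <;> nlinarith [sq_nonneg (f x)]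
      · intro j _ hji
        rw [if_neg]
        intro hxj
        have key : ∀ p r : ℕ, p < r → (ρ (q ^ (p + 1)))⁻¹ x ∈ A → (ρ (q ^ (r + 1)))⁻¹ x ∈ A → False := by
          intro p r hpr hp hr
          refine hqA _ hr (r - p) (by omega) ?_
          convert hp using 1
          have : r + 1 = (p + 1) + (r - p) := by omega
          rw [this, pow_add]
          simp only [map_mul, mul_inv_rev, Equiv.Perm.mul_apply]
          have hc : ρ (q ^ (r-p)) ((ρ (q ^ (r - p)))⁻¹ ((ρ (q ^ (p + 1)))⁻¹ x)) = (ρ (q ^ (p + 1)))⁻¹ x := by simp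
          exact hc
        rcases lt_or_gt_of_ne hji with h | h
        · exact key j i h hxj hxi
        · exact key i j h hxi hxj
    · push Not at hx
      rw [Finset.sum_eq_zero fun i hi => if_neg (hx i hi)]
      positivity
  have h8 : (I : ℝ) * a ≤ 2 * S + I * (2 * (C2 * η)) := by
    have : ∑ i ∈ Finset.range I, a ≤ ∑ i ∈ Finset.range I,
        (2 * (∑' x, (if x ∈ A then f (ρ (q ^ (i + 1)) x) ^ 2 else 0)) + 2 * (C2 * η)) := by
      refine Finset.sum_le_sum fun i hi => ?_
      refine (hdis (q ^ (i + 1))).trans ?_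
      have := hC2 (q ^ (i + 1)) (Set.mem_biUnion hi ⟨q, hq, rfl⟩) X ρ f hf
      linarith
    rw [Finset.sum_add_distrib, ← Finset.mul_sum] at this
    simp only [Finset.sum_const, Finset.card_range, nsmul_eq_mul] at this
    linarith
  rw [div_mul_eq_mul_div, div_le_iff₀ (by positivity), one_mul]
  have hIm : (I : ℝ) = 8 * m := by simp [hI]
  rw [hIm] at h8
  have e1 : (4 * m * C1 + 8 * m * C2 + 1) * η = 2 * (m * (2 * (C1 * η))) + 8 * m * (C2 * η) + η := by
    ring
  rw [mul_comm η, e1]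
  linarith
end CG

namespace CG

lemma finite_ball (k n : ℕ) : {w : FreeGroup (Fin k) | w.toWord.length ≤ n}.Finite := by
  have := (List.finite_length_le (Fin k × Bool) n).preimage
    (FreeGroup.toWord_injective (α := Fin k)).injOn
  exact this

lemma ball_lower (k n : ℕ) (hk : 1 ≤ k) :
    (2 * k - 1) ^ n ≤ {w : FreeGroup (Fin k) | w.toWord.length ≤ n}.ncard := by
  classical
  have he : ∀ t : Fin k × Bool, ∃ e : Fin (2 * k - 1) → Fin k × Bool, Function.Injective e ∧
      ∀ j, e j ≠ (t.1, !t.2) := by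
    intro t
    have hc : Fintype.card (Fin (2 * k - 1)) ≤ Fintype.card {s : Fin k × Bool // s ≠ (t.1, !t.2)} := by
      rw [Fintype.card_subtype_compl]
      simp
      omega
    obtain ⟨e⟩ := Function.Embedding.nonempty_of_card_le hc
    exact ⟨fun j => (e j).1, fun a b h => e.injective (Subtype.ext h), fun j => (e j).2⟩
  choose e hinj hne using he
  let t0 : Fin k × Bool := (⟨0, by omega⟩, true)
  let R : ℕ → Set (List (Fin k × Bool)) := fun n => {L | FreeGroup.IsReduced L ∧ L.length = n}
  have hfin : ∀ n, (R n).Finite := fun n =>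
    (List.finite_length_le (Fin k × Bool) n).subset fun L hL => hL.2.le
  have hR : ∀ n, (2 * k - 1) ^ n ≤ (R n).ncard := by
    intro n
    induction n with
    | zero =>
      have : (R 0).Nonempty := ⟨[], FreeGroup.IsReduced.nil, rfl⟩
      rw [pow_zero]; exact (Set.ncard_pos (hfin 0)).2 this
    | succ n ih =>
      let f : List (Fin k × Bool) × Fin (2 * k - 1) → List (Fin k × Bool) :=
        fun p => e (p.1.head?.getD t0) p.2 :: p.1
      have hf : Function.Injective f := by
        rintro ⟨L, i⟩ ⟨L', i'⟩ h
        simp only [f, List.cons.injEq] at h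
        obtain ⟨h1, rfl⟩ := h
        rw [hinj _ h1]
      have hsub : f '' ((R n) ×ˢ Set.univ) ⊆ R (n + 1) := by
        rintro _ ⟨⟨L, i⟩, ⟨hL, -⟩, rfl⟩
        refine ⟨?_, by simp [f, hL.2]⟩
        rcases L with _ | ⟨t, L⟩
        · exact FreeGroup.IsReduced.singleton
        · simp only [f, List.head?_cons, Option.getD_some]
          rw [FreeGroup.isReduced_cons_cons]
          refine ⟨fun h1 => ?_, hL.1⟩
          by_contra h2
          apply hne t i
          ext
          · exact congrArg Fin.val h1
          · simp; revert h2; cases (e t i).2 <;> cases t.2 <;> simp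
      calc (2 * k - 1) ^ (n + 1) = (2 * k - 1) ^ n * (2 * k - 1) := pow_succ _ _
        _ ≤ (R n).ncard * (2 * k - 1) := Nat.mul_le_mul_right _ ih
        _ = (f '' ((R n) ×ˢ Set.univ)).ncard := by
            rw [Set.ncard_image_of_injective _ hf, Set.ncard_prod]
            simp [Set.ncard_univ]
        _ ≤ _ := Set.ncard_le_ncard hsub (hfin _)
  refine (hR n).trans ?_
  refine Set.ncard_le_ncard_of_injOn (fun L => FreeGroup.mk L) ?_ ?_ (finite_ball k n)
  · intro L hL
    simp only [Set.mem_ofPred_eq, FreeGroup.toWord_mk]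
    rw [hL.1.reduce_eq]; exact hL.2.le
  · intro L hL L' hL' h
    have := congrArg FreeGroup.toWord h
    simpa [FreeGroup.toWord_mk, hL.1.reduce_eq, hL'.1.reduce_eq] using this

/-- some letter shortens -/
lemma exists_shorten {k : ℕ} (w : FreeGroup (Fin k)) (hw : w ≠ 1) :
    ∃ s : Fin k × Bool, (FreeGroup.mk [s] * w).norm + 1 ≤ w.norm := by
  have h0 : w.toWord ≠ [] := by simpa [FreeGroup.toWord_eq_nil_iff] using hw
  obtain ⟨t, L, hL⟩ := List.exists_cons_of_ne_nil h0
  refine ⟨(t.1, !t.2), ?_⟩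
  have h1 : w = FreeGroup.mk [t] * FreeGroup.mk L := by
    rw [FreeGroup.mul_mk, ← FreeGroup.mk_toWord (x := w), hL]; rfl
  have h2 : FreeGroup.mk [(t.1, !t.2)] = (FreeGroup.mk [t])⁻¹ := by
    simp [FreeGroup.inv_mk, FreeGroup.invRev]
  rw [h2]
  nth_rewrite 1 [h1]
  rw [inv_mul_cancel_left]
  have := FreeGroup.norm_mk_le (L₁ := L)
  have h3 : w.norm = L.length + 1 := by simp [FreeGroup.norm, hL]
  omega

lemma letter_norm {k : ℕ} (s : Fin k × Bool) (w : FreeGroup (Fin k)) :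
    (FreeGroup.mk [s] * w).norm ≤ w.norm + 1 := by
  have h1 := FreeGroup.norm_mul_le (FreeGroup.mk [s]) w
  have h2 := FreeGroup.norm_mk_le (L₁ := [s])
  simp at h2; omega

section
variable {k : ℕ} {Γ : Type} [Group Γ] (π : FreeGroup (Fin k) →* Γ)

noncomputable def regRep : FreeGroup (Fin k) →* Equiv.Perm Γ := (MulAction.toPermHom Γ Γ).comp π

lemma regRep_apply (w) (γ : Γ) : regRep π w γ = π w * γ := rfl

set_option maxHeartbeats 1000000 in
open Classical in
lemma kernel_count (hk : 1 ≤ k) (ε lam : ℝ) (hlam : 2 * k - ε < lam) (hl0 : 0 < lam) (a : ℕ → ℝ) (N : ℕ)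
    (ha : ∀ n, 0 ≤ a n) (hmono : Antitone a) (hN : ∀ n, N < n → a n = 0) (ha1 : a 0 ≤ 1)
    (hrec : ∀ n, lam * a (n + 1) ≤ a n + (2 * k - 1) * a (n + 2))
    (hg : Gap ε (regRep π)) (n : ℕ) :
    a n * ({w : FreeGroup (Fin k) | w.toWord.length ≤ n ∧ π w = 1}.ncard : ℝ)
      ≤ lam / (lam - (2 * k - ε)) := by
  let b : FreeGroup (Fin k) → ℝ := fun w => a w.norm
  have hb0 : ∀ w, 0 ≤ b w := fun w => ha _
  have hbs : b.support.Finite := by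
    refine (finite_ball k N).subset fun w hw => ?_
    by_contra h
    exact hw (hN _ (by simpa [FreeGroup.norm] using h))
  have hsum : ∀ (p : FreeGroup (Fin k) → Prop) (v : FreeGroup (Fin k)),
      Summable fun w => if p w then b (v * w) else 0 := by
    intro p v
    apply summable_of_hasFiniteSupport
    refine (hbs.preimage (mul_right_injective v).injOn).subset fun w hw => ?_
    simp only [Function.mem_support] at hw
    by_contra h
    simp only [Set.mem_preimage, Function.mem_support, not_not] at h
    simp [h] at hw
  let u : Γ → ℝ := fun γ => ∑' w, if π w = γ then b w else 0
  have hu0 : ∀ γ, 0 ≤ u γ := fun γ => tsum_nonneg fun w => by split_ifs <;> simp [hb0]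
  have husupp : u.support.Finite := by
    refine (hbs.image π).subset fun γ hγ => ?_
    by_contra h
    apply hγ
    have : (fun w => if π w = γ then b w else 0) = fun _ => 0 := by
      funext w
      split_ifs with hw
      · by_contra h2
        exact h ⟨w, h2, hw⟩
      · rfl
    simp only [u, this, tsum_zero]
  have hshift : ∀ v γ, u (π v * γ) = ∑' w, if π w = γ then b (v * w) else 0 := by
    intro v γ
    simp only [u]
    rw [← (Equiv.mulLeft v).tsum_eq]
    simp
  have hpt : ∀ w, lam * b w ≤ (∑ s : Fin k × Bool, b (FreeGroup.mk [s] * w)) + if w = 1 then lam else 0 := by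
    intro w
    by_cases hw : w = 1
    · subst hw
      have h1 : 0 ≤ ∑ s : Fin k × Bool, b (FreeGroup.mk [s] * 1) := Finset.sum_nonneg fun s _ => hb0 _
      have h2 : b 1 ≤ 1 := by simpa [b] using ha1
      simp only [if_true]
      nlinarith
    · simp only [hw, if_false, add_zero]
      obtain ⟨s, hs⟩ := exists_shorten w hw
      obtain ⟨m, hm⟩ : ∃ m, w.norm = m + 1 := ⟨w.norm - 1, by omega⟩
      rw [← Finset.add_sum_erase _ _ (Finset.mem_univ s)]
      have h1 : a m ≤ b (FreeGroup.mk [s] * w) := hmono (by omega)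
      have h2 : (2 * k - 1 : ℝ) * a (m + 2) ≤
          ∑ s ∈ Finset.univ.erase s, b (FreeGroup.mk [s] * w) := by
        have hc : ((Finset.univ.erase s).card : ℝ) = 2 * k - 1 := by
          rw [Finset.card_erase_of_mem (Finset.mem_univ s)]
          have : 1 ≤ k * 2 := by omega
          simp [Nat.cast_sub this]; ring
        rw [← hc, ← nsmul_eq_mul, ← Finset.sum_const]
        refine Finset.sum_le_sum fun s' _ => hmono ?_
        have := letter_norm s' w; omega
      have h3 := hrec m
      have h4 : b w = a (m + 1) := by simp [b, hm]
      rw [h4]; linarith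
  have hM : ∀ γ, lam * u γ ≤ (∑ s : Fin k × Bool, u (π (FreeGroup.mk [s]) * γ)) + if γ = 1 then lam else 0 := by
    intro γ
    simp_rw [hshift]
    rw [← Summable.tsum_finsetSum (fun s _ => hsum (fun w => π w = γ) _)]
    have e1 : (if γ = 1 then lam else 0) = ∑' w, (if w = (1 : FreeGroup (Fin k)) then (if γ = 1 then lam else 0) else 0) := by
      rw [tsum_ite_eq]
    have s1 : Summable fun w => (if w = (1 : FreeGroup (Fin k)) then (if γ = 1 then lam else 0) else 0) := by
      apply summable_of_hasFiniteSupport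
      refine (Set.finite_singleton (1 : FreeGroup (Fin k))).subset fun w hw => ?_
      by_contra h
      simp only [Function.mem_support] at hw
      simp only [Set.mem_singleton_iff] at h
      simp [h] at hw
    have s2 := summable_sum (s := Finset.univ)
      (fun (s : Fin k × Bool) _ => hsum (fun w => π w = γ) (FreeGroup.mk [s]))
    rw [e1, ← s2.tsum_add s1]
    simp only [u]
    rw [← tsum_mul_left]
    have s3 := (hsum (fun w => π w = γ) 1).mul_left lam
    simp only [one_mul] at s3
    refine Summable.tsum_le_tsum ?_ s3 (s2.add s1)
    intro w
    by_cases hw : π w = γ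
    · simp only [hw, if_true]
      refine (hpt w).trans ?_
      by_cases h1 : w = 1
      · subst h1
        have : γ = 1 := by simpa using hw.symm
        simp [this]
      · simp [h1]
    · simp only [hw, if_false, mul_zero, Finset.sum_const_zero, zero_add]
      split_ifs <;> linarith
  -- quadratic form
  have sU : Summable fun γ => u γ ^ 2 := sum_sq husupp
  set S := ∑' γ, u γ ^ 2 with hS
  have sp : ∀ v, Summable fun γ => u γ * u (π v * γ) := by
    intro v
    apply summable_of_hasFiniteSupport
    refine husupp.subset fun γ h => ?_
    simp only [Function.mem_support] at h ⊢
    exact left_ne_zero_of_mul h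
  set ip : FreeGroup (Fin k) → ℝ := fun v => ∑' γ, u γ * u (π v * γ) with hip
  have ipinv : ∀ v, ip v⁻¹ = ip v := by
    intro v
    simp only [hip]
    rw [← (Equiv.mulLeft (π v)).tsum_eq]
    congr 1; ext γ
    simp [mul_comm]
  have hE : ∀ v, En (regRep π) v u = 2 * S - 2 * ip v := by
    intro v
    unfold En
    simp only [regRep_apply]
    have s1 : Summable fun γ => u (π v * γ) ^ 2 := (Equiv.mulLeft (π v)).summable_iff.2 sU
    have e1 : ∑' γ, u (π v * γ) ^ 2 = S := (Equiv.mulLeft (π v)).tsum_eq (fun γ => u γ ^ 2)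
    have : ∀ γ, (u (π v * γ) - u γ) ^ 2 = (u (π v * γ) ^ 2 + u γ ^ 2) - 2 * (u γ * u (π v * γ)) := by
      intro γ; ring
    simp_rw [this]
    rw [(s1.add sU).tsum_sub ((sp v).mul_left 2), s1.tsum_add sU, e1, tsum_mul_left]
    ring
  have hgap := hg u husupp
  simp_rw [hE] at hgap
  have hMs : lam * S ≤ (∑ s : Fin k × Bool, ip (FreeGroup.mk [s])) + lam * u 1 := by
    simp only [hip]
    rw [← Summable.tsum_finsetSum (fun s _ => sp _)]
    have e1 : lam * u 1 = ∑' γ, if γ = (1 : Γ) then lam * u 1 else 0 := by rw [tsum_ite_eq]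
    have s1 : Summable fun γ => if γ = (1 : Γ) then lam * u 1 else 0 := by
      apply summable_of_hasFiniteSupport
      refine (Set.finite_singleton (1 : Γ)).subset fun w hw => ?_
      by_contra h
      simp only [Function.mem_support] at hw
      simp only [Set.mem_singleton_iff] at h
      simp [h] at hw
    have s2 := summable_sum (s := Finset.univ) (fun (s : Fin k × Bool) _ => sp (FreeGroup.mk [s]))
    rw [e1, ← s2.tsum_add s1, hS, ← tsum_mul_left]
    refine Summable.tsum_le_tsum ?_ (sU.mul_left _) (s2.add s1)
    intro γ
    rw [← Finset.mul_sum]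
    have := mul_le_mul_of_nonneg_left (hM γ) (hu0 γ)
    by_cases h : γ = 1
    · subst h; simp only [if_true] at this ⊢; linarith
    · simp only [h, if_false, add_zero] at this ⊢; linarith
  have hletters : ∑ s : Fin k × Bool, ip (FreeGroup.mk [s]) = 2 * ∑ i, ip (FreeGroup.of i) := by
    rw [Fintype.sum_prod_type, Finset.mul_sum]
    refine Finset.sum_congr rfl fun i _ => ?_
    rw [Fintype.sum_bool]
    have h1 : FreeGroup.mk [(i, false)] = (FreeGroup.of i)⁻¹ := by
      simp [FreeGroup.of, FreeGroup.inv_mk, FreeGroup.invRev]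
    rw [h1, ipinv]
    have h2 : FreeGroup.mk [(i, true)] = FreeGroup.of i := rfl
    rw [h2]; ring
  rw [Finset.sum_sub_distrib, ← Finset.mul_sum, ← Finset.mul_sum, ← hS] at hgap
  simp only [Finset.sum_const, Finset.card_univ, Fintype.card_fin, nsmul_eq_mul] at hgap
  have hfin : (lam - (2 * k - ε)) * S ≤ lam * u 1 := by
    rw [hletters] at hMs
    have e : (lam - (2 * k - ε)) * S = lam * S - 2 * (k * S) + ε * S := by ring
    rw [e]; linarith
  have hS1 : u 1 ^ 2 ≤ S := sU.le_tsum 1 (fun γ _ => sq_nonneg _)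
  have hpos : 0 < lam - (2 * k - ε) := by linarith
  have hu1 : u 1 ≤ lam / (lam - (2 * k - ε)) := by
    rw [le_div_iff₀ hpos]
    rcases (hu0 1).eq_or_lt with h | h
    · rw [← h, zero_mul]; exact hl0.le
    · have h3 : (lam - (2 * k - ε)) * u 1 ^ 2 ≤ lam * u 1 :=
        (mul_le_mul_of_nonneg_left hS1 hpos.le).trans hfin
      have h4 : (u 1 * (lam - (2 * k - ε))) * u 1 ≤ lam * u 1 := by
        have e : (u 1 * (lam - (2 * k - ε))) * u 1 = (lam - (2 * k - ε)) * u 1 ^ 2 := by ring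
        rw [e]; exact h3
      exact le_of_mul_le_mul_right h4 h
  refine le_trans ?_ hu1
  -- lower bound
  set T := {w : FreeGroup (Fin k) | w.toWord.length ≤ n ∧ π w = 1} with hT
  have hTf : T.Finite := (finite_ball k n).subset fun w hw => hw.1
  have s0 : Summable fun w => if π w = 1 then b w else 0 := by simpa using hsum (fun w => π w = 1) 1
  have h5 := s0.sum_le_tsum hTf.toFinset (fun w _ => by split_ifs <;> simp [hb0])
  refine le_trans ?_ h5
  rw [Set.ncard_eq_toFinset_card T hTf, mul_comm, ← nsmul_eq_mul, ← Finset.sum_const]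
  refine Finset.sum_le_sum fun w hw => ?_
  have hw' := hTf.mem_toFinset.1 hw
  rw [if_pos hw'.2]
  exact hmono hw'.1

end
end CG

namespace CG

set_option maxHeartbeats 1000000 in
lemma count_exp (k : ℕ) (hk : 2 ≤ k) (ε : ℝ) (hε : 0 < ε) : ∃ C s : ℝ, 0 < C ∧ 0 < s ∧ s < 1 ∧
    ∀ (Γ : Type) [Group Γ] (π : FreeGroup (Fin k) →* Γ), Gap ε (regRep π) → ∀ n : ℕ,
    ({w : FreeGroup (Fin k) | w.toWord.length ≤ n ∧ π w = 1}.ncard : ℝ) ≤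
      C * s ^ n * ({w : FreeGroup (Fin k) | w.toWord.length ≤ n}.ncard : ℝ) := by
  set q : ℝ := 2 * k - 1 with hq
  have hq3 : 3 ≤ q := by
    have : (2 : ℝ) ≤ k := by exact_mod_cast hk
    rw [hq]; linarith
  set δ : ℝ := min ε 1 / (2 * q) with hδ
  have hm0 : 0 < min ε 1 := lt_min hε one_pos
  have hδ0 : 0 < δ := by positivity
  have hδq : δ * (2 * q) = min ε 1 := by rw [hδ]; field_simp
  have hm1 : min ε 1 ≤ 1 := min_le_right _ _
  have hme : min ε 1 ≤ ε := min_le_left _ _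
  have hδ1 : δ ≤ 1 / 6 := by nlinarith
  set θ := (1 + δ) / q with hθ
  set θ2 := 1 / (1 + δ) with hθ2
  set lam := (1 + δ) + q / (1 + δ) with hlam
  have hθ0 : 0 < θ := by positivity
  have hθ20 : 0 < θ2 := by positivity
  have hθ1 : θ ≤ 1 := by rw [hθ, div_le_one (by positivity)]; linarith
  have hlt : θ < θ2 := by
    rw [hθ, hθ2, div_lt_div_iff₀ (by positivity) (by positivity)]; nlinarith
  have hl : 2 * k - ε < lam := by
    have h1 : q * (1 - δ) ≤ q / (1 + δ) := by
      rw [le_div_iff₀ (by positivity)]; nlinarith [mul_pos hδ0 hδ0]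
    have : (2 * k : ℝ) = q + 1 := by rw [hq]; ring
    rw [this, hlam]; nlinarith
  have hl0 : 0 < lam := by positivity
  have r1 : 1 + q * θ ^ 2 = lam * θ := by rw [hlam, hθ]; field_simp; ring
  have r2 : 1 + q * θ2 ^ 2 = lam * θ2 := by rw [hlam, hθ2]; field_simp
  set r := θ / θ2 with hr
  have hr0 : 0 < r := by positivity
  have hr1 : r < 1 := by rw [hr, div_lt_one hθ20]; exact hlt
  have hθr : θ = r * θ2 := by rw [hr]; field_simp
  set Λ := lam / (lam - (2 * k - ε)) with hΛ
  have hpos : 0 < lam - (2 * k - ε) := by linarith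
  refine ⟨Λ / (1 - r), 1 / (1 + δ), by have : 0 < 1 - r := by linarith
                                       positivity, by positivity, ?_, ?_⟩
  · rw [div_lt_one (by positivity)]; linarith
  intro Γ _ π hg n
  set c : ℕ → ℝ := fun m => θ ^ m - r ^ (n + 1) * θ2 ^ m with hc
  set a : ℕ → ℝ := fun m => max 0 (c m) with ha
  have hcf : ∀ m, c m = θ ^ m * (1 - r ^ (n + 1) * (1 / r) ^ m) := by
    intro m
    have e : θ2 = θ * (1 / r) := by rw [hr]; field_simp
    simp only [hc]
    have e2 : θ2 ^ m = θ ^ m * (1 / r) ^ m := by rw [← mul_pow, ← e]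
    rw [e2]; ring
  have haf : ∀ m, a m = θ ^ m * max 0 (1 - r ^ (n + 1) * (1 / r) ^ m) := by
    intro m
    simp only [ha]
    rw [hcf, mul_max_of_nonneg _ _ (by positivity), mul_zero]
  have hrinv : 1 ≤ 1 / r := by rw [le_div_iff₀ hr0]; linarith
  have hrec : ∀ m, lam * c (m + 1) = c m + q * c (m + 2) := by
    intro m
    simp only [hc]
    have e1 : lam * (θ ^ (m + 1) - r ^ (n + 1) * θ2 ^ (m + 1)) =
      θ ^ m * (lam * θ) - r ^ (n + 1) * θ2 ^ m * (lam * θ2) := by ring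
    rw [e1, ← r1, ← r2]; ring
  have key := kernel_count π (by omega) ε lam hl hl0 a (n + 1) (fun m => le_max_left _ _) ?_ ?_ ?_ ?_ hg n
  · have han : θ ^ n * (1 - r) ≤ a n := by
      rw [haf]
      refine mul_le_mul_of_nonneg_left ?_ (by positivity)
      refine le_trans (le_of_eq ?_) (le_max_right _ _)
      rw [pow_succ, one_div, inv_pow]
      field_simp
    set Nn := ({w : FreeGroup (Fin k) | w.toWord.length ≤ n ∧ π w = 1}.ncard : ℝ) with hNn
    have h1 : θ ^ n * (1 - r) * Nn ≤ Λ := (mul_le_mul_of_nonneg_right han (by positivity)).trans key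
    have hB := ball_lower k n (by omega)
    have hB' : q ^ n ≤ ({w : FreeGroup (Fin k) | w.toWord.length ≤ n}.ncard : ℝ) := by
      have : ((2 * k - 1 : ℕ) : ℝ) = q := by rw [Nat.cast_sub (by omega)]; simp [hq]
      rw [← this]; exact_mod_cast hB
    have h1r : 0 < 1 - r := by linarith
    have h2 : Nn ≤ Λ / (1 - r) * (1 / θ) ^ n := by
      rw [div_mul_eq_mul_div, le_div_iff₀ h1r, one_div, inv_pow, ← div_eq_mul_inv, le_div_iff₀ (by positivity)]
      linarith
    refine h2.trans ?_
    rw [mul_assoc]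
    refine mul_le_mul_of_nonneg_left ?_ (by positivity)
    have e : 1 / θ = 1 / (1 + δ) * q := by rw [hθ]; field_simp
    rw [e, mul_pow]
    exact mul_le_mul_of_nonneg_left hB' (by positivity)
  · intro m m' hmm
    rw [haf, haf]
    refine mul_le_mul (pow_le_pow_of_le_one hθ0.le hθ1 hmm) ?_ (le_max_left _ _) (by positivity)
    refine max_le_max le_rfl ?_
    have := pow_le_pow_right₀ hrinv hmm
    have h0 : 0 < r ^ (n + 1) := by positivity
    nlinarith
  · intro m hm
    rw [haf]
    have : 1 - r ^ (n + 1) * (1 / r) ^ m ≤ 0 := by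
      have h1 := pow_le_pow_right₀ hrinv hm.le
      have h2 : r ^ (n + 1) * (1 / r) ^ (n + 1) = 1 := by rw [← mul_pow]; field_simp; simp
      have h0 : 0 < r ^ (n + 1) := by positivity
      nlinarith
    rw [max_eq_left this, mul_zero]
  · simp only [ha, hc]
    refine max_le zero_le_one ?_
    have h0 : 0 < r ^ (n + 1) := by positivity
    simp; linarith
  · intro m
    have e0 : ∀ m, c m ≤ a m := fun m => le_max_right _ _
    have e1 : ∀ m, 0 ≤ a m := fun m => le_max_left _ _
    have e2 := hrec m
    rw [← hq]
    have h3 : lam * a (m + 1) = max 0 (lam * c (m + 1)) := by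
      simp only [ha]; rw [mul_max_of_nonneg _ _ hl0.le, mul_zero]
    rw [h3]
    have hq0 : 0 ≤ q := by linarith
    refine max_le (add_nonneg (e1 m) (mul_nonneg hq0 (e1 _))) ?_
    rw [e2]; exact add_le_add (e0 m) (mul_le_mul_of_nonneg_left (e0 _) hq0)

lemma count_of_gap (k : ℕ) (hk : 2 ≤ k) (ε : ℝ) (hε : 0 < ε) : ∃ ε' : ℝ, 0 < ε' ∧
    ∀ (Γ : Type) [Group Γ] (π : FreeGroup (Fin k) →* Γ), (∃ i, π (FreeGroup.of i) ≠ 1) →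
    Gap ε (regRep π) → ∀ n : ℕ, 1 ≤ n →
    ({w : FreeGroup (Fin k) | w.toWord.length ≤ n ∧ π w = 1}.ncard : ℝ) ≤
      Real.exp (-ε' * n) * ({w : FreeGroup (Fin k) | w.toWord.length ≤ n}.ncard : ℝ) := by
  obtain ⟨C, s, hC, hs0, hs1, h⟩ := count_exp k hk ε hε
  set e1 := -Real.log s / 2 with he1
  have he10 : 0 < e1 := by have := Real.log_neg hs0 hs1; rw [he1]; linarith
  have hse : ∀ n : ℕ, s ^ n = Real.exp (-(2 * e1) * n) := by
    intro n
    rw [← Real.exp_log hs0, ← Real.exp_nat_mul]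
    congr 1; rw [he1]; ring
  obtain ⟨n0, hn0⟩ := exists_nat_gt (C / e1)
  set b0 := ({w : FreeGroup (Fin k) | w.toWord.length ≤ n0}.ncard : ℝ) with hb0
  have hb1 : 1 ≤ b0 := by
    have : 0 < {w : FreeGroup (Fin k) | w.toWord.length ≤ n0}.ncard :=
      (Set.ncard_pos (finite_ball k n0)).2 ⟨1, by simp⟩
    rw [hb0]; exact_mod_cast this
  set e2 := 1 / (b0 * (n0 + 1)) with he2
  have he20 : 0 < e2 := by positivity
  refine ⟨min e1 e2, lt_min he10 he20, fun Γ _ π ⟨i, hi⟩ hg n hn => ?_⟩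
  set Bn := ({w : FreeGroup (Fin k) | w.toWord.length ≤ n}.ncard : ℝ) with hBn
  have hBn0 : 0 ≤ Bn := by positivity
  rcases le_or_gt n0 n with hle | hlt
  · refine (h Γ π hg n).trans (mul_le_mul_of_nonneg_right ?_ hBn0)
    rw [hse]
    have h1 : C ≤ Real.exp (e1 * n) := by
      have : (n0 : ℝ) ≤ n := by exact_mod_cast hle
      have h2 : C ≤ e1 * n := by
        rw [div_lt_iff₀ he10] at hn0; nlinarith
      have := Real.add_one_le_exp (e1 * n); linarith
    calc C * Real.exp (-(2 * e1) * n) ≤ Real.exp (e1 * n) * Real.exp (-(2 * e1) * n) :=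
          mul_le_mul_of_nonneg_right h1 (Real.exp_pos _).le
      _ = Real.exp (-e1 * n) := by rw [← Real.exp_add]; congr 1; ring
      _ ≤ _ := by
          apply Real.exp_le_exp.2
          have : min e1 e2 ≤ e1 := min_le_left _ _
          have : (0 : ℝ) ≤ n := by positivity
          nlinarith
  · have hss : {w : FreeGroup (Fin k) | w.toWord.length ≤ n ∧ π w = 1} ⊂
        {w : FreeGroup (Fin k) | w.toWord.length ≤ n} := by
      refine ⟨fun w hw => hw.1, fun hsub => hi (hsub (?_ : FreeGroup.of i ∈ _)).2⟩
      simp [hn]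
    have h1 := Set.ncard_lt_ncard hss (finite_ball k n)
    have h2 : ({w : FreeGroup (Fin k) | w.toWord.length ≤ n ∧ π w = 1}.ncard : ℝ) + 1 ≤ Bn := by
      rw [hBn]; exact_mod_cast h1
    have h3 : Bn ≤ b0 := by
      rw [hBn, hb0]
      exact_mod_cast Set.ncard_le_ncard (fun w (hw : _ ≤ _) => show _ ≤ _ from hw.trans hlt.le) (finite_ball k n0)
    have h4 : 1 - 1 / b0 ≤ Real.exp (-min e1 e2 * n) := by
      have h5 := Real.add_one_le_exp (-min e1 e2 * n)
      have h6 : min e1 e2 * n ≤ 1 / b0 := by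
        have a1 : min e1 e2 ≤ e2 := min_le_right _ _
        have a2 : (n : ℝ) ≤ n0 + 1 := by
          have : (n : ℝ) < n0 := by exact_mod_cast hlt
          linarith
        calc min e1 e2 * n ≤ e2 * (n0 + 1) := mul_le_mul a1 a2 (by positivity) he20.le
          _ = 1 / b0 := by rw [he2]; field_simp
      linarith
    refine le_trans ?_ (mul_le_mul_of_nonneg_right h4 hBn0)
    have h7 : 1 / b0 * Bn ≤ 1 := by
      rw [div_mul_eq_mul_div, one_mul, div_le_one (by linarith)]; exact h3
    linarith
end CG

namespace CG

section
variable {G : Type} [Group G] {d : ℕ} {L : Type} [Field L]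
  (Φ : G →* Matrix (Fin d) (Fin d) L)

def SI : Prop := ∀ Δ : Subgroup G, Δ.FiniteIndex → Submodule.span L (Φ '' (Δ : Set G)) = ⊤

def coords : Set (G → L) := Set.range (fun p : Fin d × Fin d => fun w => Φ w p.1 p.2) ∪
  Set.range (fun p : Fin d × Fin d => fun w => Φ w⁻¹ p.1 p.2)

noncomputable def Reg : Subalgebra L (G → L) := Algebra.adjoin L (coords Φ)

def MReg (M : G → Matrix (Fin d) (Fin d) L) : Prop := ∀ i j, (fun w => M w i j) ∈ Reg Φ

variable {Φ}
lemma mreg_const (A : Matrix (Fin d) (Fin d) L) : MReg Φ (fun _ => A) := by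
  intro i j
  exact (Reg Φ).algebraMap_mem (A i j)

lemma mreg_self : MReg Φ (fun w => Φ w) := fun i j =>
  Algebra.subset_adjoin (Or.inl ⟨(i, j), rfl⟩)

lemma mreg_inv : MReg Φ (fun w => Φ w⁻¹) := fun i j =>
  Algebra.subset_adjoin (Or.inr ⟨(i, j), rfl⟩)

lemma MReg.mul {M N : G → Matrix (Fin d) (Fin d) L} (hM : MReg Φ M) (hN : MReg Φ N) :
    MReg Φ (fun w => M w * N w) := by
  intro i j
  have : (fun w => (M w * N w) i j) = ∑ l, (fun w => M w i l) * (fun w => N w l j) := by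
    funext w; simp [Matrix.mul_apply]
  rw [this]
  exact Subalgebra.sum_mem _ fun l _ => Subalgebra.mul_mem _ (hM i l) (hN l j)

lemma MReg.sub {M N : G → Matrix (Fin d) (Fin d) L} (hM : MReg Φ M) (hN : MReg Φ N) :
    MReg Φ (fun w => M w - N w) := by
  intro i j
  exact Subalgebra.sub_mem _ (hM i j) (hN i j)

variable (Φ)
lemma reg_shift (h : G) (f : G → L) (hf : f ∈ Reg Φ) : (fun w => f (h * w)) ∈ Reg Φ := by
  refine Algebra.adjoin_induction (p := fun f _ => (fun w => f (h * w)) ∈ Reg Φ) ?_ ?_ ?_ ?_ hf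
  · rintro _ (⟨p, rfl⟩ | ⟨p, rfl⟩)
    · have := (mreg_const (Φ := Φ) (Φ h)).mul mreg_self p.1 p.2
      simpa using this
    · have := (mreg_inv (Φ := Φ)).mul (mreg_const (Φ h⁻¹)) p.1 p.2
      simpa using this
  · intro r; exact (Reg Φ).algebraMap_mem r
  · intro f g _ _ hf hg; exact Subalgebra.add_mem _ hf hg
  · intro f g _ _ hf hg; exact Subalgebra.mul_mem _ hf hg

lemma finiteIndex_of_map {α : Type*} [Finite α] (H : Subgroup G) (c : G → α)
    (h : ∀ z z', c z = c z' → z⁻¹ * z' ∈ H) : H.FiniteIndex := by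
  have : Finite (G ⧸ H) := by
    refine Finite.of_injective (fun x : G ⧸ H => c x.out) ?_
    intro x y hxy
    have := h _ _ hxy
    rw [← QuotientGroup.eq] at this
    simpa using this
  exact Subgroup.finiteIndex_of_finite_quotient

lemma lemmaT : ∃ Δ : Subgroup G, Δ.FiniteIndex ∧ ∀ {ι : Type} [Finite ι]
    (M : ι → G → Matrix (Fin d) (Fin d) L), (∀ i, MReg Φ (M i)) → (∀ w, ∃ i, M i w = 0) →
    ∃ i, ∀ w ∈ Δ, M i w = 0 := by
  classical
  haveI : IsNoetherianRing (Reg Φ) := by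
    have hfin : (coords Φ).Finite := (Set.finite_range _).union (Set.finite_range _)
    haveI : Algebra.FiniteType L (Reg Φ) :=
      (Subalgebra.fg_iff_finiteType _).1 ⟨hfin.toFinset, by simp [Reg]⟩
    exact Algebra.FiniteType.isNoetherianRing L _
  let ev : G → (Reg Φ →+* L) := fun w => (Pi.evalRingHom (fun _ : G => L) w).comp (Reg Φ).val.toRingHom
  let pt : G → PrimeSpectrum (Reg Φ) := fun w => ⟨RingHom.ker (ev w), RingHom.ker_isPrime _⟩
  letI : TopologicalSpace G := TopologicalSpace.induced pt inferInstance
  have hind : Topology.IsInducing pt := ⟨rfl⟩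
  haveI : TopologicalSpace.NoetherianSpace G := hind.noetherianSpace
  let τ : G → (Reg Φ →+* Reg Φ) := fun h =>
    { toFun := fun f => ⟨fun w => f.1 (h * w), reg_shift Φ h f.1 f.2⟩
      map_one' := rfl
      map_mul' := fun _ _ => rfl
      map_zero' := rfl
      map_add' := fun _ _ => rfl }
  have hcont : ∀ h : G, Continuous (fun w => h * w) := by
    intro h
    rw [hind.continuous_iff]
    have : pt ∘ (fun w => h * w) = (PrimeSpectrum.comap (τ h)) ∘ pt := by
      funext w
      ext f
      rfl
    rw [this]
    exact (PrimeSpectrum.continuous_comap _).comp hind.continuous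
  have hclosed : ∀ M : G → Matrix (Fin d) (Fin d) L, MReg Φ M → IsClosed {w | M w = 0} := by
    intro M hM
    have : {w | M w = 0} = ⋂ p : Fin d × Fin d, {w | M w p.1 p.2 = 0} := by
      ext w
      simp only [Set.mem_ofPred_eq, Set.mem_iInter, Prod.forall]
      exact ⟨fun h i j => by rw [h]; rfl, fun h => by ext i j; exact h i j⟩
    rw [this]
    refine isClosed_iInter fun p => ?_
    rw [hind.isClosed_iff]
    refine ⟨PrimeSpectrum.zeroLocus {(⟨_, hM p.1 p.2⟩ : Reg Φ)}, PrimeSpectrum.isClosed_zeroLocus _, ?_⟩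
    ext w
    simp only [Set.mem_preimage, PrimeSpectrum.mem_zeroLocus, Set.singleton_subset_iff]
    rfl
  -- component
  let Z0 : Set G := irreducibleComponent (1 : G)
  have hZ0 : Z0 ∈ irreducibleComponents G := irreducibleComponent_mem_irreducibleComponents 1
  have hfinc : (irreducibleComponents G).Finite := TopologicalSpace.NoetherianSpace.finite_irreducibleComponents
  have hmove : ∀ h : G, (fun w => h * w) '' Z0 ∈ irreducibleComponents G := by
    intro h
    refine ⟨hZ0.1.image _ (hcont h).continuousOn, ?_⟩
    intro t ht hle
    have h1 : Z0 ≤ (fun w => h⁻¹ * w) '' t := by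
      intro w hw
      exact ⟨h * w, hle ⟨w, hw, rfl⟩, by simp⟩
    have h2 := hZ0.2 (ht.image _ (hcont h⁻¹).continuousOn) h1
    intro w hw
    exact ⟨h⁻¹ * w, h2 ⟨w, hw, rfl⟩, by simp⟩
  let Δ : Subgroup G :=
    { carrier := {h | (fun w => h * w) '' Z0 = Z0}
      one_mem' := by simp
      mul_mem' := by
        intro a b ha hb
        simp only [Set.mem_ofPred_eq] at ha hb ⊢
        have : (fun w => a * b * w) '' Z0 = (fun w => a * w) '' ((fun w => b * w) '' Z0) := by
          rw [Set.image_image]; simp [mul_assoc]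
        rw [this, hb, ha]
      inv_mem' := by
        intro a ha
        simp only [Set.mem_ofPred_eq] at ha ⊢
        nth_rewrite 1 [← ha]
        rw [Set.image_image]; simp }
  have hΔ : Δ.FiniteIndex := by
    haveI := hfinc.to_subtype
    refine finiteIndex_of_map Δ (fun h => (⟨_, hmove h⟩ : irreducibleComponents G)) ?_
    intro z z' hz
    have hz' : (fun w => z * w) '' Z0 = (fun w => z' * w) '' Z0 := congrArg Subtype.val hz
    change (fun w => z⁻¹ * z' * w) '' Z0 = Z0
    have : (fun w => z⁻¹ * z' * w) '' Z0 = (fun w => z⁻¹ * w) '' ((fun w => z' * w) '' Z0) := by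
      rw [Set.image_image]; simp [mul_assoc]
    rw [this, ← hz', Set.image_image]; simp
  have hΔZ : (Δ : Set G) ⊆ Z0 := by
    intro h hh
    have hh' : (fun w => h * w) '' Z0 = Z0 := hh
    rw [← hh']
    exact ⟨1, mem_irreducibleComponent, by simp⟩
  refine ⟨Δ, hΔ, ?_⟩
  intro ι _ M hM hcov
  have := (isIrreducible_iff_sUnion_isClosed.1 hZ0.1) (Set.finite_range fun i => {w | M i w = 0}).toFinset ?_ ?_
  · obtain ⟨z, hz, hZz⟩ := this
    simp only [Set.Finite.mem_toFinset, Set.mem_range] at hz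
    obtain ⟨i, rfl⟩ := hz
    exact ⟨i, fun w hw => hZz (hΔZ hw)⟩
  · intro z hz
    simp only [Set.Finite.mem_toFinset, Set.mem_range] at hz
    obtain ⟨i, rfl⟩ := hz
    exact hclosed _ (hM i)
  · intro w _
    obtain ⟨i, hi⟩ := hcov w
    simp only [Set.Finite.coe_toFinset, Set.sUnion_range, Set.mem_iUnion]
    exact ⟨i, hi⟩
end
end CG

namespace CG

/-- scalar elements of an algebra -/
def Scal (K : Type*) {R : Type*} [CommSemiring K] [Semiring R] [Algebra K R] (x : R) : Prop :=
  ∃ c : K, x = c • 1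

section
variable {G : Type} [Group G] {d : ℕ} {L : Type} [Field L]
  {Φ : G →* Matrix (Fin d) (Fin d) L}

lemma phi_mul_inv (g : G) : Φ g * Φ g⁻¹ = 1 := by rw [← map_mul]; simp
lemma phi_inv_mul (g : G) : Φ g⁻¹ * Φ g = 1 := by rw [← map_mul]; simp

lemma scal_commute {x : Matrix (Fin d) (Fin d) L} (h : Scal L x) (y) : x * y = y * x := by
  obtain ⟨c, rfl⟩ := h; simp

lemma si_comm (hSI : SI Φ) {Δ : Subgroup G} (hΔ : Δ.FiniteIndex) {x : Matrix (Fin d) (Fin d) L}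
    (h : ∀ z ∈ Δ, x * Φ z = Φ z * x) : Scal L x := by
  have h1 : ∀ y : Matrix (Fin d) (Fin d) L, x * y = y * x := by
    intro y
    have hy : y ∈ Submodule.span L (Φ '' (Δ : Set G)) := by rw [hSI Δ hΔ]; trivial
    refine Submodule.span_induction (p := fun y _ => x * y = y * x) ?_ ?_ ?_ ?_ hy
    · rintro _ ⟨z, hz, rfl⟩; exact h z hz
    · simp
    · intro a b _ _ ha hb; rw [mul_add, add_mul, ha, hb]
    · intro c a _ ha; simp [ha]
  have := Matrix.mem_range_scalar_iff_commute_single'.2 (fun i j => (h1 (Matrix.single i j 1)).symm)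
  obtain ⟨c, hc⟩ := this
  exact ⟨c, by rw [← hc]; ext i j; simp [Matrix.scalar_apply, Matrix.diagonal, Matrix.one_apply]⟩

lemma si_zero (hSI : SI Φ) {Δ : Subgroup G} (hΔ : Δ.FiniteIndex) {X Y : Matrix (Fin d) (Fin d) L}
    (h : ∀ z ∈ Δ, Y * Φ z * X = 0) : X = 0 ∨ Y = 0 := by
  have h1 : ∀ y : Matrix (Fin d) (Fin d) L, Y * y * X = 0 := by
    intro y
    have hy : y ∈ Submodule.span L (Φ '' (Δ : Set G)) := by rw [hSI Δ hΔ]; trivial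
    refine Submodule.span_induction (p := fun y _ => Y * y * X = 0) ?_ ?_ ?_ ?_ hy
    · rintro _ ⟨z, hz, rfl⟩; exact h z hz
    · simp
    · intro a b _ _ ha hb; rw [mul_add, add_mul, ha, hb, add_zero]
    · intro c a _ ha; simp [ha]
  by_contra hne
  push Not at hne
  obtain ⟨hX, hY⟩ := hne
  obtain ⟨i, j, hij⟩ : ∃ i j, X i j ≠ 0 := by
    by_contra hc; push Not at hc; exact hX (by ext i j; exact hc i j)
  obtain ⟨p, q, hpq⟩ : ∃ i j, Y i j ≠ 0 := by
    by_contra hc; push Not at hc; exact hY (by ext i j; exact hc i j)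
  have := congrFun (congrFun (h1 (Matrix.single q i 1)) p) j
  rw [Matrix.mul_apply, Finset.sum_eq_single i] at this
  · simp [hpq, hij] at this
  · intro b _ hb
    rw [Matrix.mul_single_apply_of_ne]; simp; exact hb
  · simp

lemma G2 (hSI : SI Φ) {X Y Y' : Matrix (Fin d) (Fin d) L}
    (h : ∀ z, Y * Φ z * X = 0 ∨ Y' * Φ z * X = 0) : X = 0 ∨ Y = 0 ∨ Y' = 0 := by
  obtain ⟨Δ, hΔ, hT⟩ := lemmaT Φ
  obtain ⟨i, hi⟩ := hT (ι := Bool) (fun b z => (if b then Y else Y') * Φ z * X)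
    (fun i => ((mreg_const _).mul mreg_self).mul (mreg_const _))
    (fun w => by
      rcases h w with h | h
      · exact ⟨true, by simpa using h⟩
      · exact ⟨false, by simpa using h⟩)
  rcases si_zero hSI hΔ hi with h | h
  · exact Or.inl h
  · cases i
    · exact Or.inr (Or.inr (by simpa using h))
    · exact Or.inr (Or.inl (by simpa using h))

lemma exists_common_eig [IsAlgClosed L] (hd : 0 < d) (S : Set (Matrix (Fin d) (Fin d) L))
    (hS : ∀ s ∈ S, ∀ t ∈ S, s * t = t * s) : ∃ v : Fin d → L, v ≠ 0 ∧
      ∀ s ∈ S, ∃ μ : L, s.mulVec v = μ • v := by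
  haveI : Nonempty (Fin d) := ⟨⟨0, hd⟩⟩
  let P : Set (Submodule L (Fin d → L)) := {U | U ≠ ⊥ ∧ ∀ s ∈ S, ∀ u ∈ U, s.mulVec u ∈ U}
  have hP : P.Nonempty := ⟨⊤, by
    refine ⟨top_ne_bot, fun _ _ _ _ => trivial⟩⟩
  obtain ⟨U, hU, hmin⟩ := WellFounded.has_min (r := ((· < ·) : Submodule L (Fin d → L) → _ → Prop))
    wellFounded_lt P hP
  obtain ⟨v, hv, hv0⟩ := Submodule.exists_mem_ne_zero_of_ne_bot hU.1
  refine ⟨v, hv0, ?_⟩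
  intro s hs
  haveI : Nontrivial U := Submodule.nontrivial_iff_ne_bot.2 hU.1
  let f : Module.End L U := (Matrix.toLin' s).restrict (fun u hu => by simpa using hU.2 s hs u hu)
  obtain ⟨μ, hμ⟩ := Module.End.exists_eigenvalue f
  obtain ⟨u, hu⟩ := hμ.exists_hasEigenvector
  have hu1 : s.mulVec u.1 = μ • u.1 := by
    have := congrArg Subtype.val hu.apply_eq_smul
    simpa [f] using this
  let W : Submodule L (Fin d → L) := U ⊓ LinearMap.ker (Matrix.toLin' s - μ • LinearMap.id)
  have hW : W ∈ P := by
    refine ⟨?_, ?_⟩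
    · intro h
      have : (u : Fin d → L) ∈ W := ⟨u.2, by simp [hu1]⟩
      rw [h] at this
      exact hu.2 (by simpa using this)
    · rintro t ht w ⟨hw1, hw2⟩
      refine ⟨hU.2 t ht w hw1, ?_⟩
      simp only [SetLike.mem_coe, LinearMap.mem_ker, LinearMap.sub_apply, Matrix.toLin'_apply, LinearMap.smul_apply,
        LinearMap.id_apply, sub_eq_zero] at hw2 ⊢
      rw [Matrix.mulVec_mulVec, hS s hs t ht, ← Matrix.mulVec_mulVec, hw2, Matrix.mulVec_smul]
  have hWU : W = U := by
    by_contra hne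
    exact hmin W hW (lt_of_le_of_ne inf_le_left hne)
  rw [← hWU] at hv
  refine ⟨μ, ?_⟩
  have := hv.2
  simpa [sub_eq_zero] using this

lemma Ab [IsAlgClosed L] (hSI : SI Φ) (S : Set G) (hconj : ∀ s ∈ S, ∀ g, g * s * g⁻¹ ∈ S)
    (hS : ∀ s ∈ S, ∀ t ∈ S, Φ s * Φ t = Φ t * Φ s) : ∀ s ∈ S, Scal L (Φ s) := by
  intro x hx
  rcases Nat.eq_zero_or_pos d with rfl | hd
  · exact ⟨1, Subsingleton.elim _ _⟩
  obtain ⟨v, hv0, hv⟩ := exists_common_eig hd (Φ '' S) (by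
    rintro _ ⟨s, hs, rfl⟩ _ ⟨t, ht, rfl⟩; exact hS s hs t ht)
  obtain ⟨Δ, hΔ, hT⟩ := lemmaT Φ
  let X : Matrix (Fin d) (Fin d) L := Matrix.of fun i _ => v i
  have hXm : ∀ m : Matrix (Fin d) (Fin d) L, m.mulVec v = 0 → m * X = 0 := by
    intro m hm
    ext i j
    have := congrFun hm i
    simpa [X, Matrix.mul_apply, Matrix.mulVec, dotProduct] using this
  have hX : X ≠ 0 := by
    intro h
    apply hv0
    ext i
    have := congrFun (congrFun h i) ⟨0, hd⟩
    simpa [X] using this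
  let ι := {μ : L // Module.End.HasEigenvalue (Matrix.toLin' (Φ x)) μ}
  haveI : Finite ι := (Module.End.finite_hasEigenvalue (Matrix.toLin' (Φ x))).to_subtype
  obtain ⟨i, hi⟩ := hT (ι := ι) (fun μ z => (Φ x - μ.1 • 1) * Φ z * X)
    (fun i => ((mreg_const _).mul mreg_self).mul (mreg_const _))
    (fun z => by
      obtain ⟨μ, hμ⟩ := hv (Φ (z⁻¹ * x * z)) ⟨_, by simpa using hconj x hx z⁻¹, rfl⟩
      have h1 : (Φ x).mulVec ((Φ z).mulVec v) = μ • (Φ z).mulVec v := by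
        have := congrArg (Φ z).mulVec hμ
        rw [Matrix.mulVec_mulVec, ← map_mul, Matrix.mulVec_smul] at this
        rw [Matrix.mulVec_mulVec, ← map_mul, ← this]; congr 2; group
      have h2 : (Φ z).mulVec v ≠ 0 := by
        intro h
        have := congrArg (Φ z⁻¹).mulVec h
        rw [Matrix.mulVec_mulVec, phi_inv_mul] at this
        simp at this; exact hv0 this
      refine ⟨⟨μ, Module.End.hasEigenvalue_of_hasEigenvector (x := (Φ z).mulVec v) ?_⟩, ?_⟩
      · exact Module.End.hasEigenvector_iff.2 ⟨by simp [Module.End.mem_eigenspace_iff, h1], h2⟩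
      · apply hXm
        rw [← Matrix.mulVec_mulVec, Matrix.sub_mulVec, h1]; simp [Matrix.smul_mulVec])
  rcases si_zero hSI hΔ hi with h | h
  · exact absurd h hX
  · exact ⟨i.1, sub_eq_zero.1 h⟩
end
end CG

namespace CG
open scoped commutatorElement

section
variable {G : Type} [Group G] {d : ℕ} {L : Type} [Field L]
  {Φ : G →* Matrix (Fin d) (Fin d) L}

lemma finite_roots (hd : 0 < d) : Finite {c : L // c ^ d = 1} := by
  classical
  have : {c : L | c ^ d = 1} ⊆ ((Polynomial.nthRoots d (1 : L)).toFinset : Set L) := by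
    intro c hc
    simpa [Polynomial.mem_nthRoots hd] using hc
  exact ((Finset.finite_toSet _).subset this).to_subtype

lemma scal_root (hd : 0 < d) (hdet : ∀ w, (Φ w).det = 1) {w : G} {c : L} (h : Φ w = c • 1) :
    c ^ d = 1 := by
  have := hdet w
  rw [h] at this
  simpa using this

lemma scal_ne (hd : 0 < d) {c : L} (h : c ^ d = 1) : c ≠ 0 := by
  rintro rfl
  rw [zero_pow hd.ne'] at h; exact zero_ne_one h

variable (Φ) in
/-- elements acting by scalars -/
def Zs : Subgroup G where
  carrier := {w | Scal L (Φ w)}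
  one_mem' := ⟨1, by simp⟩
  mul_mem' := by
    rintro a b ⟨c, hc⟩ ⟨c', hc'⟩
    exact ⟨c * c', by rw [map_mul, hc, hc']; simp [smul_smul, mul_comm]⟩
  inv_mem' := by
    rintro a ⟨c, hc⟩
    have h1 : c • Φ a⁻¹ = 1 := by
      have := phi_mul_inv (Φ := Φ) a
      rw [hc] at this; simpa using this
    by_cases h0 : c = 0
    · subst h0
      rw [zero_smul] at h1
      exact ⟨0, by rw [← mul_one (Φ a⁻¹), ← h1]; simp⟩
    · exact ⟨c⁻¹, by rw [← h1, smul_smul, inv_mul_cancel₀ h0, one_smul]⟩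

lemma mem_Zs {w : G} : w ∈ Zs Φ ↔ Scal L (Φ w) := Iff.rfl

instance Zs_normal : (Zs Φ).Normal := ⟨by
  rintro n ⟨c, hc⟩ g
  refine ⟨c, ?_⟩
  rw [map_mul, map_mul, hc]
  simp [phi_mul_inv]⟩

lemma phi_conj_mreg (x : G) : MReg Φ (fun z => Φ (z * x * z⁻¹)) := by
  have := ((mreg_self (Φ := Φ)).mul (mreg_const (Φ x))).mul mreg_inv
  simpa using this

lemma const_scal (hSI : SI Φ) {Δ : Subgroup G} (hΔ : Δ.FiniteIndex) {x : G}
    {A : Matrix (Fin d) (Fin d) L} (h : ∀ z ∈ Δ, Φ (z * x * z⁻¹) = A) : Scal L (Φ x) := by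
  refine si_comm hSI hΔ fun z hz => ?_
  have h1 := h 1 (Subgroup.one_mem _)
  have h2 := h z hz
  rw [← h1] at h2
  have : Φ (z * x * z⁻¹ * z) = Φ (1 * x * 1⁻¹ * z) := by rw [map_mul, h2, ← map_mul]
  rw [← map_mul, ← map_mul]
  simpa using this.symm

lemma Ab' [IsAlgClosed L] (hSI : SI Φ) (hd : 0 < d) (hdet : ∀ w, (Φ w).det = 1)
    (N : Subgroup G) [hN : N.Normal] (h : ∀ x ∈ N, ∀ y ∈ N, Scal L (Φ ⁅x, y⁆)) :
    ∀ x ∈ N, Scal L (Φ x) := by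
  haveI := finite_roots (L := L) hd
  have hcom : ∀ x ∈ N, ∀ y ∈ N, ∃ ζ : {c : L // c ^ d = 1}, Φ x * Φ y = ζ.1 • (Φ y * Φ x) := by
    intro x hx y hy
    obtain ⟨c, hc⟩ := h x hx y hy
    refine ⟨⟨c, scal_root hd hdet hc⟩, ?_⟩
    have : x * y = ⁅x, y⁆ * (y * x) := by rw [commutatorElement_def]; group
    rw [← map_mul, this, map_mul, hc]; simp
  obtain ⟨Δ, hΔ, hT⟩ := lemmaT Φ
  have key : ∀ x ∈ N, ∀ z ∈ Δ, ∃ s : {c : L // c ^ d = 1}, Φ (z * x * z⁻¹) = s.1 • Φ x := by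
    intro x hx z hz
    have h1 : ∀ y ∈ N, Φ y * Φ (x⁻¹ * (z * x * z⁻¹)) = Φ (x⁻¹ * (z * x * z⁻¹)) * Φ y := by
      intro y hy
      obtain ⟨ζ, hζ⟩ := hT (ι := {c : L // c ^ d = 1})
        (fun ζ z => Φ y * Φ (z * x * z⁻¹) - (ζ.1 • 1) * (Φ (z * x * z⁻¹) * Φ y))
        (fun ζ => ((mreg_const _).mul (phi_conj_mreg x)).sub
          ((mreg_const _).mul ((phi_conj_mreg x).mul (mreg_const _))))
        (fun z => by
          obtain ⟨ζ, hζ⟩ := hcom y hy (z * x * z⁻¹) (hN.conj_mem x hx z)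
          exact ⟨ζ, by simp only [hζ, smul_mul_assoc, one_mul, sub_self]⟩)
      have e1 := hζ 1 (Subgroup.one_mem _)
      have e2 := hζ z hz
      simp only [one_mul, inv_one, mul_one, sub_eq_zero, smul_mul_assoc] at e1 e2
      have e3 : Φ (z * x * z⁻¹) = Φ x * Φ (x⁻¹ * (z * x * z⁻¹)) := by rw [← map_mul]; congr 1; group
      rw [e3, ← mul_assoc, e1, smul_mul_assoc, mul_assoc, mul_assoc] at e2
      have e4 := smul_right_injective _ (scal_ne hd ζ.2) e2
      have e5 := congrArg (fun m => Φ x⁻¹ * m) e4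
      simpa only [← mul_assoc, phi_inv_mul, one_mul] using e5
    have h2 : Scal L (Φ (x⁻¹ * (z * x * z⁻¹))) := by
      refine Ab hSI {t | t ∈ N ∧ ∀ y ∈ N, Φ y * Φ t = Φ t * Φ y} ?_ ?_ _
        ⟨N.mul_mem (N.inv_mem hx) (hN.conj_mem x hx z), h1⟩
      · rintro s ⟨hs, hs'⟩ g
        refine ⟨hN.conj_mem s hs g, fun y hy => ?_⟩
        have := hs' (g⁻¹ * y * g) (by simpa using hN.conj_mem y hy g⁻¹)
        have := congrArg (fun m => Φ g * m * Φ g⁻¹) this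
        simp only [← map_mul] at this ⊢
        convert this using 2 <;> group
      · rintro s ⟨hs, hs'⟩ t ⟨ht, ht'⟩
        exact ht' s hs
    obtain ⟨c, hc⟩ := h2
    refine ⟨⟨c, scal_root hd hdet hc⟩, ?_⟩
    have : Φ (z * x * z⁻¹) = Φ x * Φ (x⁻¹ * (z * x * z⁻¹)) := by rw [← map_mul]; congr 1; group
    rw [hc] at this
    simpa using this
  intro x hx
  haveI : Finite (G ⧸ Δ) := Subgroup.finite_quotient_of_finiteIndex
  obtain ⟨i, hi⟩ := hT (ι := (G ⧸ Δ) × {c : L // c ^ d = 1})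
    (fun i z => Φ (z * x * z⁻¹) - i.2.1 • Φ (i.1.out * x * i.1.out⁻¹))
    (fun i => (phi_conj_mreg x).sub (mreg_const _))
    (fun z => by
      have hm : (QuotientGroup.mk z : G ⧸ Δ).out⁻¹ * z ∈ Δ := by
        rw [← QuotientGroup.eq]; simp
      obtain ⟨s, hs⟩ := key x hx _ hm
      refine ⟨(QuotientGroup.mk z, s), ?_⟩
      set t := (QuotientGroup.mk z : G ⧸ Δ).out
      have : z * x * z⁻¹ = t * (t⁻¹ * z * x * (t⁻¹ * z)⁻¹) * t⁻¹ := by group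
      simp only []
      rw [this, map_mul, map_mul, hs]; simp)
  exact const_scal hSI hΔ fun z hz => sub_eq_zero.1 (hi z hz)

lemma exists_nonscal (hSI : SI Φ) (hd : 2 ≤ d) : ∃ x, ¬ Scal L (Φ x) := by
  by_contra hc
  push Not at hc
  have h1 : Scal L (Matrix.single (⟨0, by omega⟩ : Fin d) (⟨1, by omega⟩ : Fin d) (1 : L)) :=
    si_comm hSI (Δ := ⊤) inferInstance fun z _ => (scal_commute (hc z) _).symm
  obtain ⟨c, hc⟩ := h1
  have := congrFun (congrFun hc ⟨0, by omega⟩) ⟨1, by omega⟩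
  simp at this

variable (Φ) in
def Cen (N : Subgroup G) : Submodule L (Matrix (Fin d) (Fin d) L) where
  carrier := {m | ∀ x ∈ N, m * Φ x = Φ x * m}
  zero_mem' := by simp
  add_mem' := by intro a b ha hb x hx; rw [add_mul, mul_add, ha x hx, hb x hx]
  smul_mem' := by intro c a ha x hx; simp [ha x hx]

lemma Prime [IsAlgClosed L] (hSI : SI Φ) (hd : 2 ≤ d) (hdet : ∀ w, (Φ w).det = 1) :
    ∃ N : Subgroup G, N.Normal ∧ (∃ x ∈ N, ¬ Scal L (Φ x)) ∧
      ∀ u ∈ N, ∀ v ∈ N, ¬ Scal L (Φ u) → ¬ Scal L (Φ v) → ∃ z, ¬ Scal L (Φ ⁅u, z * v * z⁻¹⁆) := by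
  have hd0 : 0 < d := by omega
  let P : Set (Submodule L (Matrix (Fin d) (Fin d) L)) :=
    {C | ∃ N : Subgroup G, N.Normal ∧ (∃ x ∈ N, ¬ Scal L (Φ x)) ∧ C = Cen Φ N}
  obtain ⟨C, ⟨N, hN, hNs, rfl⟩, hmax⟩ := WellFounded.has_min
    (r := ((· > ·) : Submodule L (Matrix (Fin d) (Fin d) L) → _ → Prop)) wellFounded_gt P (by
      obtain ⟨x, hx⟩ := exists_nonscal hSI hd
      exact ⟨_, ⊤, inferInstance, ⟨x, trivial, hx⟩, rfl⟩)
  refine ⟨N, hN, hNs, ?_⟩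
  intro u hu v hv hus hvs
  by_contra hc
  push Not at hc
  apply hus
  have hcom_mul : ∀ {x y : G} {c c' : L}, Φ u * Φ x = c • (Φ x * Φ u) → Φ u * Φ y = c' • (Φ y * Φ u) →
      Φ u * Φ (x * y) = (c * c') • (Φ (x * y) * Φ u) := by
    intro x y c c' h1 h2
    rw [map_mul, ← mul_assoc, h1, smul_mul_assoc, mul_assoc, h2, mul_smul_comm, smul_smul, mul_assoc]
  have hcom_inv : ∀ {x : G} {c : L}, c ≠ 0 → Φ u * Φ x = c • (Φ x * Φ u) →
      Φ u * Φ x⁻¹ = c⁻¹ • (Φ x⁻¹ * Φ u) := by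
    intro x c hc h
    have e := congrArg (fun m => c⁻¹ • (Φ x⁻¹ * m * Φ x⁻¹)) h
    simp only [mul_smul_comm, smul_mul_assoc, smul_smul, inv_mul_cancel₀ hc, one_smul] at e
    rw [← mul_assoc, ← mul_assoc, phi_inv_mul, one_mul, mul_assoc, mul_assoc, phi_mul_inv, mul_one] at e
    exact e.symm
  let Q : Subgroup G :=
    { carrier := {x | ∃ c : L, c ≠ 0 ∧ Φ u * Φ x = c • (Φ x * Φ u)}
      one_mem' := ⟨1, one_ne_zero, by simp⟩
      mul_mem' := by
        rintro a b ⟨c, hc, h⟩ ⟨c', hc', h'⟩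
        exact ⟨c * c', mul_ne_zero hc hc', hcom_mul h h'⟩
      inv_mem' := by
        rintro a ⟨c, hc, h⟩
        exact ⟨c⁻¹, inv_ne_zero hc, hcom_inv hc h⟩ }
  let Nv := Subgroup.normalClosure ({v} : Set G)
  have hNvQ : Nv ≤ Q := by
    refine (Subgroup.closure_le _).2 ?_
    intro y hy
    simp only [Group.conjugatesOfSet, Set.mem_singleton_iff, Set.iUnion_iUnion_eq_left] at hy
    obtain ⟨z, hz⟩ := isConj_iff.1 (show IsConj v y from hy)
    obtain ⟨c, h⟩ := hc z
    rw [hz] at h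
    refine ⟨c, scal_ne hd0 (scal_root hd0 hdet h), ?_⟩
    have : u * y = ⁅u, y⁆ * (y * u) := by rw [commutatorElement_def]; group
    rw [← map_mul, this, map_mul, h]; simp
  have hNvN : Nv ≤ N := Subgroup.normalClosure_le_normal (by simpa using hv)
  let N' := ⁅Nv, Nv⁆
  haveI : N'.Normal := Subgroup.commutator_normal _ _
  have hN'N : N' ≤ N := (Subgroup.commutator_le_right _ _).trans hNvN
  have huN' : Φ u ∈ Cen Φ N' := by
    let R : Subgroup G :=
      { carrier := {x | Φ u * Φ x = Φ x * Φ u}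
        one_mem' := by simp
        mul_mem' := by
          intro a b ha hb
          have := hcom_mul (c := 1) (c' := 1) (x := a) (y := b) (by simpa using ha) (by simpa using hb)
          simpa using this
        inv_mem' := by
          intro a ha
          have := hcom_inv (c := 1) (x := a) one_ne_zero (by simpa using ha)
          simpa using this }
    have : N' ≤ R := by
      refine Subgroup.commutator_le.2 ?_
      intro x hx y hy
      obtain ⟨c, hc, h⟩ := hNvQ hx
      obtain ⟨c', hc', h'⟩ := hNvQ hy
      have := hcom_mul (hcom_mul (hcom_mul h h') (hcom_inv hc h)) (hcom_inv hc' h')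
      have e : c * c' * c⁻¹ * c'⁻¹ = 1 := by field_simp
      rw [e, one_smul] at this
      exact this
    intro x hx
    exact this hx
  have hN's : ∃ x ∈ N', ¬ Scal L (Φ x) := by
    by_contra hcc
    push Not at hcc
    refine hvs (Ab' hSI hd0 hdet Nv (fun x hx y hy => hcc _ (Subgroup.commutator_mem_commutator hx hy)) v
      (Subgroup.subset_normalClosure rfl))
  have hle : Cen Φ N ≤ Cen Φ N' := fun m hm x hx => hm x (hN'N hx)
  have heq : Cen Φ N = Cen Φ N' := by
    by_contra hne
    exact hmax _ ⟨N', inferInstance, hN's, rfl⟩ (lt_of_le_of_ne hle hne)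
  have huN : Φ u ∈ Cen Φ N := by rw [heq]; exact huN'
  refine Ab hSI {x | x ∈ N ∧ Φ x ∈ Cen Φ N} ?_ ?_ u ⟨hu, huN⟩
  · rintro s ⟨hs, hs'⟩ g
    refine ⟨hN.conj_mem s hs g, fun y hy => ?_⟩
    have := hs' (g⁻¹ * y * g) (by simpa using hN.conj_mem y hy g⁻¹)
    have := congrArg (fun m => Φ g * m * Φ g⁻¹) this
    simp only [← map_mul] at this ⊢
    convert this using 2 <;> group
  · rintro s ⟨hs, hs'⟩ t ⟨ht, ht'⟩
    exact hs' t ht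

lemma Infin (hSI : SI Φ) (hd : 0 < d) (hdet : ∀ w, (Φ w).det = 1) (N : Subgroup G) [hN : N.Normal]
    (hNs : ∃ x ∈ N, ¬ Scal L (Φ x)) (n : ℕ) :
    ∃ g : Fin n → G, (∀ i, g i ∈ N) ∧ ∀ i j, i ≠ j → ¬ Scal L (Φ ((g i)⁻¹ * g j)) := by
  have hinf : Infinite (N.map (QuotientGroup.mk' (Zs Φ))) := by
    by_contra hfin
    rw [not_infinite_iff_finite] at hfin
    obtain ⟨x, hx, hxs⟩ := hNs
    apply hxs
    obtain ⟨Δ, hΔ, hT⟩ := lemmaT Φ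
    haveI := finite_roots (L := L) hd
    obtain ⟨i, hi⟩ := hT (ι := (N.map (QuotientGroup.mk' (Zs Φ))) × {c : L // c ^ d = 1})
      (fun i z => Φ (z * x * z⁻¹) - i.2.1 • Φ (i.1.1.out))
      (fun i => (phi_conj_mreg x).sub (mreg_const _))
      (fun z => by
        set y := z * x * z⁻¹ with hy
        have hm : (QuotientGroup.mk y : G ⧸ Zs Φ).out⁻¹ * y ∈ Zs Φ := by
          rw [← QuotientGroup.eq]; simp
        obtain ⟨c, hc⟩ := hm
        refine ⟨(⟨QuotientGroup.mk y, ⟨y, hN.conj_mem x hx z, rfl⟩⟩, ⟨c, scal_root hd hdet hc⟩), ?_⟩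
        have : Φ y = Φ ((QuotientGroup.mk y : G ⧸ Zs Φ).out) * Φ ((QuotientGroup.mk y : G ⧸ Zs Φ).out⁻¹ * y) := by
          rw [← map_mul]; congr 1; group
        rw [hc] at this
        simp only []
        rw [this]; simp)
    exact const_scal hSI hΔ fun z hz => sub_eq_zero.1 (hi z hz)
  let em := Infinite.natEmbedding (N.map (QuotientGroup.mk' (Zs Φ)))
  have : ∀ m : ℕ, ∃ g ∈ N, QuotientGroup.mk' (Zs Φ) g = (em m).1 := fun m => (em m).2
  choose g hgN hg using this
  refine ⟨fun i => g i, fun i => hgN i, ?_⟩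
  intro i j hij hs
  have h1 : (g i)⁻¹ * g j ∈ Zs Φ := hs
  rw [← QuotientGroup.eq] at h1
  apply hij
  apply Fin.ext
  apply em.injective
  apply Subtype.ext
  rw [← hg, ← hg]; exact h1

lemma exists_e (h : Submodule.span L (Set.range Φ) = ⊤) : ∃ e : Fin d × Fin d → G,
    LinearIndependent L (fun i => Φ (e i)) ∧ Submodule.span L (Set.range fun i => Φ (e i)) = ⊤ := by
  obtain ⟨b, hb, hspan, hli⟩ := exists_linearIndependent L (Set.range Φ)
  rw [h] at hspan
  let B : Module.Basis b L (Matrix (Fin d) (Fin d) L) := Module.Basis.mk hli (by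
    rw [Subtype.range_coe, hspan])
  let E := (Matrix.stdBasis L (Fin d) (Fin d)).indexEquiv B
  have : ∀ i : Fin d × Fin d, ∃ g, Φ g = (E i).1 := fun i => hb (E i).2
  choose e he using this
  have hB : (fun i => Φ (e i)) = B ∘ E := by
    funext i; rw [he]; simp [B]
  refine ⟨e, ?_, ?_⟩
  · rw [hB]; exact B.linearIndependent.comp _ E.injective
  · rw [hB, E.surjective.range_comp]; exact B.span_eq

lemma gram_ne {e : Fin d × Fin d → Matrix (Fin d) (Fin d) L} (hli : LinearIndependent L e)
    (hsp : Submodule.span L (Set.range e) = ⊤) :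
    (Matrix.of fun i j => (e i * e j).trace).det ≠ 0 := by
  intro h0
  obtain ⟨c, hc0, hc⟩ := Matrix.exists_mulVec_eq_zero_iff.2 h0
  apply hc0
  have h1 : ∀ m, (m * ∑ j, c j • e j).trace = 0 := by
    intro m
    have hm : m ∈ Submodule.span L (Set.range e) := by rw [hsp]; trivial
    refine Submodule.span_induction (p := fun m _ => (m * ∑ j, c j • e j).trace = 0) ?_ ?_ ?_ ?_ hm
    · rintro _ ⟨i, rfl⟩
      have := congrFun hc i
      simp only [Matrix.mulVec, dotProduct, Matrix.of_apply, Pi.zero_apply] at this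
      rw [Finset.mul_sum, Matrix.trace_sum, ← this]
      refine Finset.sum_congr rfl fun j _ => ?_
      simp [mul_comm]
    · simp
    · intro a b _ _ ha hb; rw [add_mul, Matrix.trace_add, ha, hb, add_zero]
    · intro a b _ hb; simp [hb]
  have h2 : ∑ j, c j • e j = 0 := by
    apply Matrix.ext_iff_trace_mul_left.2
    intro x; rw [h1]; simp
  funext j
  exact Fintype.linearIndependent_iff.1 hli c h2 j

lemma G1 (hSI : SI Φ) : ∃ e : Fin d × Fin d → G,
    (Matrix.of fun i j => (Φ (e i * e j)).trace).det ≠ 0 := by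
  have := hSI ⊤ inferInstance
  rw [Subgroup.coe_top, Set.image_univ] at this
  obtain ⟨e, h1, h2⟩ := exists_e this
  refine ⟨e, ?_⟩
  simpa using gram_ne h1 h2
end
end CG

namespace CG

section
variable {K : Type} [Field K] {Γ : Type} [LinearOrderedCommGroupWithZero Γ]

/-- quasi-absolute values: `c = 1` nonarchimedean, `c = 2` the complex absolute value -/
structure QA (v : K →*₀ Γ) (c : Γ) : Prop where
  one_le : 1 ≤ c
  add : ∀ x y, v (x + y) ≤ c * max (v x) (v y)

lemma v_neg_one (v : K →*₀ Γ) : v (-1) = 1 := by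
  have h : v (-1) ^ 2 = 1 := by rw [← map_pow]; simp
  exact (pow_eq_one_iff_of_nonneg zero_le two_ne_zero).1 h

lemma v_neg (v : K →*₀ Γ) (x : K) : v (-x) = v x := by
  rw [← neg_one_mul, map_mul, v_neg_one, one_mul]

lemma QA.sum {v : K →*₀ Γ} {c : Γ} (h : QA v c) {ι : Type*} (s : Finset ι) (f : ι → K) {M : Γ}
    (hM : ∀ i ∈ s, v (f i) ≤ M) : v (∑ i ∈ s, f i) ≤ c ^ s.card * M := by
  classical
  induction s using Finset.induction_on with
  | empty => simp
  | insert a s ha ih =>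
    rw [Finset.sum_insert ha, Finset.card_insert_of_notMem ha, pow_succ', mul_assoc]
    refine (h.add _ _).trans ?_
    gcongr
    refine max_le ((hM a (Finset.mem_insert_self _ _)).trans ?_)
      (ih fun i hi => hM i (Finset.mem_insert_of_mem hi))
    exact le_mul_of_one_le_left' (one_le_pow₀ h.one_le)

lemma QA.multiset_sum {v : K →*₀ Γ} {c : Γ} (h : QA v c) (s : Multiset K) {M : Γ}
    (hM : ∀ i ∈ s, v i ≤ M) : v s.sum ≤ c ^ s.card * M := by
  induction s using Multiset.induction_on with
  | empty => simp
  | cons a s ih =>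
    rw [Multiset.sum_cons, Multiset.card_cons, pow_succ', mul_assoc]
    refine (h.add _ _).trans ?_
    gcongr
    refine max_le ((hM a (Multiset.mem_cons_self _ _)).trans ?_)
      (ih fun i hi => hM i (Multiset.mem_cons_of_mem hi))
    exact le_mul_of_one_le_left' (one_le_pow₀ h.one_le)

lemma QA.int {v : K →*₀ Γ} {c : Γ} (h : QA v c) (n : ℤ) : v (n : K) ≤ c ^ n.natAbs := by
  have key : ∀ m : ℕ, v (m : K) ≤ c ^ m := by
    intro m
    have := h.sum (Finset.range m) (fun _ => (1 : K)) (M := 1) (by simp)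
    simpa using this
  rcases Int.natAbs_eq n with hn | hn
  · conv_lhs => rw [hn]
    simpa using key n.natAbs
  · conv_lhs => rw [hn]
    rw [Int.cast_neg, v_neg]
    simpa using key n.natAbs

/-! ### growth -/
variable {V : Type} [AddCommGroup V] [Module K V]

def Kill (f : V →ₗ[K] V) : List K → V → Prop
  | [], Z => Z = 0
  | b :: l, Z => Kill f l (f Z - b • Z)

lemma Kill.map {f g : V →ₗ[K] V} (hfg : ∀ x, f (g x) = g (f x)) :
    ∀ {l : List K} {Z : V}, Kill f l Z → Kill f l (g Z)
  | [], Z, h => by simp only [Kill] at h ⊢; rw [h, map_zero]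
  | b :: l, Z, h => by
    simp only [Kill] at h ⊢
    have := Kill.map hfg h
    rwa [map_sub, map_smul, ← hfg] at this

lemma Kill.inv {f g : V →ₗ[K] V} (hfg : ∀ x, f (g x) = x) (hgf : ∀ x, g (f x) = x) :
    ∀ {l : List K} {Z : V}, (∀ b ∈ l, b ≠ 0) → Kill f l Z → Kill g (l.map (·⁻¹)) Z
  | [], Z, _, h => h
  | b :: l, Z, hb, h => by
    simp only [Kill, List.map] at h ⊢
    have h1 := Kill.inv hfg hgf (fun b hb' => hb b (List.mem_cons_of_mem _ hb')) h
    have h2 := Kill.map (f := g) (g := (-b⁻¹) • g) (fun x => by simp) h1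
    have hb0 : b ≠ 0 := hb b (by simp)
    convert h2 using 1
    simp only [LinearMap.smul_apply, map_sub, map_smul, hgf, smul_sub, smul_smul]
    simp [hb0]
    abel

lemma growth {v : K →*₀ Γ} {c : Γ} (hc : 1 ≤ c) (n : V → Γ) (h0 : n 0 = 0)
    (hadd : ∀ x y, n (x + y) ≤ c * max (n x) (n y)) (hsm : ∀ (a : K) x, n (a • x) = v a * n x)
    (f : V →ₗ[K] V) {R b E : Γ} (hR : ∀ x, n (f x) ≤ R * n x) (hcE : c ≤ E) (hE : c * R ≤ E * b) :
    ∀ (l : List K) (Z : V), (∀ β ∈ l, v β ≤ b) → Kill f l Z →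
      ∀ j, n ((f ^ j) Z) ≤ c ^ (j * l.length) * E ^ l.length * b ^ j * n Z := by
  intro l
  have hE1 : 1 ≤ E := hc.trans hcE
  induction l with
  | nil =>
    intro Z _ h j
    simp only [Kill] at h
    subst h
    simp [h0]
  | cons β l ih =>
    intro Z hβ hK j
    simp only [Kill] at hK
    have hβb : v β ≤ b := hβ β (by simp)
    have hZ' : c * n (f Z - β • Z) ≤ c * (E * b) * n Z := by
      rw [mul_assoc]
      gcongr
      have : f Z - β • Z = f Z + (-β) • Z := by rw [neg_smul, sub_eq_add_neg]
      rw [this]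
      refine (hadd _ _).trans ?_
      rw [hsm, v_neg, mul_max]
      refine max_le ?_ ?_
      · calc c * n (f Z) ≤ c * (R * n Z) := by gcongr; exact hR _
          _ = (c * R) * n Z := by rw [mul_assoc]
          _ ≤ _ := by gcongr
      · rw [← mul_assoc]; gcongr
    induction j with
    | zero =>
      simp only [pow_zero, Module.End.one_apply, Nat.zero_mul, one_mul, mul_one]
      exact le_mul_of_one_le_left' (one_le_pow₀ hE1)
    | succ j ihj =>
      have e : (f ^ (j + 1)) Z = β • (f ^ j) Z + (f ^ j) (f Z - β • Z) := by
        rw [pow_succ, Module.End.mul_apply, map_sub, map_smul]; abel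
      rw [e]
      refine (hadd _ _).trans ?_
      rw [mul_max, hsm]
      simp only [List.length_cons]
      refine max_le ?_ ?_
      · calc c * (v β * n ((f ^ j) Z))
            ≤ c ^ (l.length + 1) * (b * (c ^ (j * (l.length + 1)) * E ^ (l.length + 1) * b ^ j * n Z)) := by
              gcongr
              · exact le_self_pow₀ hc (by omega)
              · exact ihj
          _ = _ := by rw [add_mul, one_mul, pow_add c (j * (l.length + 1)), pow_succ b]; ac_rfl
      · have h1 := ih (f Z - β • Z) (fun b hb => hβ b (List.mem_cons_of_mem _ hb)) hK j
        calc c * n ((f ^ j) (f Z - β • Z))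
            ≤ c * (c ^ (j * l.length) * E ^ l.length * b ^ j * n (f Z - β • Z)) := by gcongr
          _ = (c ^ (j * l.length) * E ^ l.length * b ^ j) * (c * n (f Z - β • Z)) := by ac_rfl
          _ ≤ (c ^ (j * l.length) * E ^ l.length * b ^ j) * (c * (E * b) * n Z) := by gcongr
          _ = c ^ (j * l.length + 1) * E ^ (l.length + 1) * b ^ (j + 1) * n Z := by
              rw [pow_succ, pow_succ, pow_succ]; ac_rfl
          _ ≤ _ := by
              gcongr
              · nlinarith

/-! ### splitting the spectrum -/
lemma split_list {T : Γ} (hT : 1 < T) (l : List Γ) (hprod : l.prod = 1)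
    (hbig : ∃ x ∈ l, T ≤ x ^ 2) : ∃ a b : Γ, b ≠ 0 ∧ (∃ x ∈ l, x = a) ∧ (∃ x ∈ l, x = b) ∧
      b ^ (2 * l.length) * T ≤ a ^ (2 * l.length) ∧ ∀ x ∈ l, a ≤ x ∨ x ≤ b := by
  classical
  set d := l.length with hd
  obtain ⟨x0, hx0, hx0T⟩ := hbig
  have hdpos : 0 < d := List.length_pos_of_mem hx0
  have hne : ∀ x ∈ l, x ≠ 0 := by
    rintro x hx rfl
    exact zero_ne_one ((List.prod_eq_zero hx).symm.trans hprod)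
  have hx0big : T ^ d ≤ x0 ^ (2 * d) := by rw [pow_mul]; gcongr
  have hx01 : 1 < x0 := by
    by_contra h
    push Not at h
    have : x0 ^ 2 ≤ 1 := pow_le_one₀ zero_le h
    exact absurd (hT.trans_le hx0T) (not_lt.2 this)
  -- some element is < 1
  obtain ⟨y0, hy0, hy01⟩ : ∃ y ∈ l, y < 1 := by
    by_contra hc
    push Not at hc
    have : x0 ≤ l.prod := by
      obtain ⟨l1, l2, rfl⟩ := List.append_of_mem hx0
      rw [List.prod_append, List.prod_cons]
      have h1 : 1 ≤ l1.prod := List.one_le_prod_of_one_le (fun x hx => hc x (by simp [hx]))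
      have h2 : 1 ≤ l2.prod := List.one_le_prod_of_one_le (fun x hx => hc x (by simp [hx]))
      calc x0 = 1 * (x0 * 1) := by simp
        _ ≤ _ := by gcongr
    rw [hprod] at this
    exact absurd hx01 (not_lt.2 this)
  have hy0pow : y0 ^ (2 * d) < 1 := pow_lt_one₀ zero_le hy01 (by omega)
  -- missing level
  obtain ⟨i, hi, hmiss⟩ : ∃ i, i < d ∧ ∀ x ∈ l, ¬ (T ^ i ≤ x ^ (2 * d) ∧ x ^ (2 * d) < T ^ (i + 1)) := by
    by_contra hc
    push Not at hc
    have : ∀ i : Fin d, ∃ m : Fin d, T ^ (i : ℕ) ≤ l[m] ^ (2 * d) ∧ l[m] ^ (2 * d) < T ^ ((i : ℕ) + 1) := by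
      intro i
      obtain ⟨x, hx, h⟩ := hc i i.2
      obtain ⟨m, hm, rfl⟩ := List.getElem_of_mem hx
      exact ⟨⟨m, hm⟩, h⟩
    choose F hF using this
    have hinj : Function.Injective F := by
      intro i j hij
      by_contra hne
      rcases lt_or_gt_of_ne hne with h | h
      · have h1 := (hF i).2
        have h2 := (hF j).1
        rw [hij] at h1
        have : T ^ ((i : ℕ) + 1) ≤ T ^ (j : ℕ) := pow_le_pow_right₀ hT.le h
        exact absurd (h2.trans_lt h1) (not_lt.2 this)
      · have h1 := (hF j).2
        have h2 := (hF i).1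
        rw [hij] at h2
        have : T ^ ((j : ℕ) + 1) ≤ T ^ (i : ℕ) := pow_le_pow_right₀ hT.le h
        exact absurd (h2.trans_lt h1) (not_lt.2 this)
    have hsurj := Finite.surjective_of_injective hinj
    obtain ⟨m, hm, hm'⟩ := List.getElem_of_mem hy0
    obtain ⟨i, hi⟩ := hsurj ⟨m, hm⟩
    have h1 := (hF i).1
    rw [hi] at h1
    have h2 : T ^ (i : ℕ) ≤ y0 ^ (2 * d) := by rw [← hm']; exact h1
    exact absurd (h2.trans_lt hy0pow) (not_lt.2 (one_le_pow₀ hT.le))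
  let A := l.toFinset.filter (fun x => T ^ (i + 1) ≤ x ^ (2 * d))
  let B := l.toFinset.filter (fun x => x ^ (2 * d) < T ^ i)
  have hA : A.Nonempty := ⟨x0, by
    simp only [A, Finset.mem_filter, List.mem_toFinset]
    exact ⟨hx0, (pow_le_pow_right₀ hT.le hi).trans hx0big⟩⟩
  have hB : B.Nonempty := ⟨y0, by
    simp only [B, Finset.mem_filter, List.mem_toFinset]
    exact ⟨hy0, hy0pow.trans_le (one_le_pow₀ hT.le)⟩⟩
  have ha := A.min'_mem hA
  have hb := B.max'_mem hB
  simp only [A, Finset.mem_filter, List.mem_toFinset] at ha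
  simp only [B, Finset.mem_filter, List.mem_toFinset] at hb
  refine ⟨A.min' hA, B.max' hB, hne _ hb.1, ⟨_, ha.1, rfl⟩, ⟨_, hb.1, rfl⟩, ?_, ?_⟩
  · refine le_trans ?_ ha.2
    rw [pow_succ]
    exact mul_le_mul_left hb.2.le _
  · intro x hx
    by_cases h : T ^ i ≤ x ^ (2 * d)
    · left
      apply Finset.min'_le
      simp only [A, Finset.mem_filter, List.mem_toFinset]
      refine ⟨hx, ?_⟩
      by_contra h2
      exact hmiss x hx ⟨h, not_le.1 h2⟩
    · right
      apply Finset.le_max'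
      simp only [B, Finset.mem_filter, List.mem_toFinset]
      exact ⟨hx, not_le.1 h⟩
end
end CG

namespace CG

/-- trace polynomials -/
abbrev TP (k : ℕ) := MvPolynomial (FreeGroup (Fin k)) ℤ

noncomputable def ev {k d : ℕ} {R : Type*} [CommRing R] (φ : FreeGroup (Fin k) →* Matrix (Fin d) (Fin d) R) :
    TP k →+* R := MvPolynomial.eval₂Hom (Int.castRingHom R) (fun w => (φ w).trace)

def mapφ {k d : ℕ} {R S : Type*} [CommRing R] [CommRing S] (ψ : R →+* S)
    (φ : FreeGroup (Fin k) →* Matrix (Fin d) (Fin d) R) : FreeGroup (Fin k) →* Matrix (Fin d) (Fin d) S :=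
  (ψ.mapMatrix : Matrix (Fin d) (Fin d) R →+* Matrix (Fin d) (Fin d) S).toMonoidHom.comp φ

section
variable {k d : ℕ} {R S : Type*} [CommRing R] [CommRing S]
lemma ev_X (φ : FreeGroup (Fin k) →* Matrix (Fin d) (Fin d) R) (w) :
    ev φ (MvPolynomial.X w) = (φ w).trace := by simp [ev]

lemma mapφ_apply (ψ : R →+* S) (φ : FreeGroup (Fin k) →* Matrix (Fin d) (Fin d) R) (w) :
    mapφ ψ φ w = (φ w).map ψ := rfl

lemma trace_mapφ (ψ : R →+* S) (φ : FreeGroup (Fin k) →* Matrix (Fin d) (Fin d) R) (w) :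
    (mapφ ψ φ w).trace = ψ (φ w).trace := by
  simp [mapφ_apply, Matrix.trace]

lemma ev_map (ψ : R →+* S) (φ : FreeGroup (Fin k) →* Matrix (Fin d) (Fin d) R) (q) :
    ev (mapφ ψ φ) q = ψ (ev φ q) := by
  have : ev (mapφ ψ φ) = ψ.comp (ev φ) := by
    apply MvPolynomial.ringHom_ext
    · intro r; simp
    · intro w; rw [RingHom.comp_apply, ev_X, ev_X, trace_mapφ]
  rw [this]; rfl
end

section
variable {k d : ℕ} {K : Type} [Field K] {Γ : Type} [LinearOrderedCommGroupWithZero Γ]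

/-- places -/
structure PL (φ : FreeGroup (Fin k) →* Matrix (Fin d) (Fin d) K) (v : K →*₀ Γ) (c T : Γ)
    (W : Finset (FreeGroup (Fin k))) : Prop where
  qa : QA v c
  hT : 1 < T
  cT : c ≤ T
  hc : c ^ (8 * d ^ 2) ≤ T
  tr : ∀ w ∈ W, v (φ w).trace ≤ T

variable {φ : FreeGroup (Fin k) →* Matrix (Fin d) (Fin d) K} {v : K →*₀ Γ} {c T : Γ}
    {W W' : Finset (FreeGroup (Fin k))}

lemma PL.mono (h : PL φ v c T W) (hW : W' ⊆ W) : PL φ v c T W' :=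
  ⟨h.qa, h.hT, h.cT, h.hc, fun w hw => h.tr w (hW hw)⟩

lemma PL.sum (h : PL φ v c T W) {ι : Type*} (s : Finset ι) (f : ι → K) {M : Γ}
    (hM : ∀ i ∈ s, v (f i) ≤ M) : v (∑ i ∈ s, f i) ≤ T ^ s.card * M := by
  refine (h.qa.sum s f hM).trans ?_
  gcongr
  exact h.cT

lemma PL.pow_le (h : PL φ v c T W) {m n : ℕ} (hmn : m ≤ n) : T ^ m ≤ T ^ n :=
  pow_le_pow_right₀ h.hT.le hmn
end

lemma tp_bound {k : ℕ} (d : ℕ) (q : TP k) : ∃ C : ℕ, ∃ W : Finset (FreeGroup (Fin k)),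
    ∀ (K : Type) [Field K] (Γ : Type) [LinearOrderedCommGroupWithZero Γ]
      (φ : FreeGroup (Fin k) →* Matrix (Fin d) (Fin d) K) (v : K →*₀ Γ) (c T : Γ),
      PL φ v c T W → v (ev φ q) ≤ T ^ C := by
  classical
  induction q using MvPolynomial.induction_on with
  | C a =>
    refine ⟨a.natAbs, ∅, ?_⟩
    intro K _ Γ _ φ v c T h
    have := h.qa.int a
    refine le_trans ?_ (this.trans ?_)
    · simp [ev]
    · gcongr; exact h.cT
  | add p q hp hq =>
    obtain ⟨C, W, h⟩ := hp
    obtain ⟨C', W', h'⟩ := hq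
    refine ⟨1 + (C + C'), W ∪ W', ?_⟩
    intro K _ Γ _ φ v c T hP
    rw [map_add, pow_add, pow_one]
    refine (hP.qa.add _ _).trans ?_
    gcongr
    · exact hP.cT
    · refine max_le ((h K Γ φ v c T (hP.mono Finset.subset_union_left)).trans (hP.pow_le (by omega)))
        ((h' K Γ φ v c T (hP.mono Finset.subset_union_right)).trans (hP.pow_le (by omega)))
  | mul_X p w hp =>
    obtain ⟨C, W, h⟩ := hp
    refine ⟨C + 1, insert w W, ?_⟩
    intro K _ Γ _ φ v c T hP
    rw [map_mul, map_mul, ev_X, pow_succ]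
    gcongr
    · exact h K Γ φ v c T (hP.mono (Finset.subset_insert _ _))
    · exact hP.tr w (Finset.mem_insert_self _ _)

lemma tp_bound_fam {k : ℕ} (d : ℕ) {α : Type*} [Finite α] (q : α → TP k) : ∃ C : ℕ, ∃ W : Finset (FreeGroup (Fin k)),
    ∀ (K : Type) [Field K] (Γ : Type) [LinearOrderedCommGroupWithZero Γ]
      (φ : FreeGroup (Fin k) →* Matrix (Fin d) (Fin d) K) (v : K →*₀ Γ) (c T : Γ),
      PL φ v c T W → ∀ i, v (ev φ (q i)) ≤ T ^ C := by
  classical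
  haveI := Fintype.ofFinite α
  choose C W h using fun i => tp_bound d (q i)
  refine ⟨Finset.univ.sup C, Finset.univ.sup W, ?_⟩
  intro K _ Γ _ φ v c T hP i
  refine (h i K Γ φ v c T (hP.mono ?_)).trans (hP.pow_le ?_)
  · exact Finset.le_sup (f := W) (Finset.mem_univ i)
  · exact Finset.le_sup (f := C) (Finset.mem_univ i)

section
variable {k d : ℕ} {K : Type} [Field K] {Γ : Type} [LinearOrderedCommGroupWithZero Γ]
variable (φ : FreeGroup (Fin k) →* Matrix (Fin d) (Fin d) K) (e : Fin d × Fin d → FreeGroup (Fin k))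
  (v : K →*₀ Γ)

noncomputable def nm (X : Matrix (Fin d) (Fin d) K) : Γ :=
  Finset.univ.sup fun i => v (X * φ (e i)).trace

variable {φ e v}
lemma nm_le {X : Matrix (Fin d) (Fin d) K} {B : Γ} : nm φ e v X ≤ B ↔ ∀ i, v (X * φ (e i)).trace ≤ B := by
  simp [nm, Finset.sup_le_iff]

lemma le_nm (X : Matrix (Fin d) (Fin d) K) (i) : v (X * φ (e i)).trace ≤ nm φ e v X :=
  nm_le.1 le_rfl i

lemma nm_zero : nm φ e v 0 = 0 := le_antisymm (nm_le.2 (by simp)) zero_le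

lemma nm_smul (a : K) (X : Matrix (Fin d) (Fin d) K) : nm φ e v (a • X) = v a * nm φ e v X := by
  by_cases ha : a = 0
  · subst ha; simp [nm_zero]
  have h1 : ∀ (a : K) (X : Matrix (Fin d) (Fin d) K), nm φ e v (a • X) ≤ v a * nm φ e v X := by
    intro a X
    rw [nm_le]
    intro i
    rw [smul_mul_assoc, Matrix.trace_smul, smul_eq_mul, map_mul]
    gcongr
    exact le_nm X i
  refine le_antisymm (h1 a X) ?_
  have h2 := h1 a⁻¹ (a • X)
  rw [smul_smul, inv_mul_cancel₀ ha, one_smul, map_inv₀] at h2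
  have hv : v a ≠ 0 := by simpa using ha
  calc v a * nm φ e v X ≤ v a * ((v a)⁻¹ * nm φ e v (a • X)) := by gcongr
    _ = _ := by rw [← mul_assoc, mul_inv_cancel₀ hv, one_mul]

lemma nm_add {c : Γ} (h : QA v c) (X Y : Matrix (Fin d) (Fin d) K) :
    nm φ e v (X + Y) ≤ c * max (nm φ e v X) (nm φ e v Y) := by
  rw [nm_le]
  intro i
  rw [add_mul, Matrix.trace_add]
  refine (h.add _ _).trans ?_
  gcongr
  · exact le_nm X i
  · exact le_nm Y i

variable (e) in
noncomputable def gramP : Matrix (Fin d × Fin d) (Fin d × Fin d) (TP k) :=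
  Matrix.of fun i j => MvPolynomial.X (e i * e j)

variable (e) in
noncomputable def Dp : TP k := (gramP e).det

variable (φ e) in
noncomputable def gram {R : Type*} [CommRing R] (φ : FreeGroup (Fin k) →* Matrix (Fin d) (Fin d) R) : Matrix (Fin d × Fin d) (Fin d × Fin d) R :=
  Matrix.of fun i j => (φ (e i * e j)).trace

lemma gramP_map {R : Type*} [CommRing R] (φ : FreeGroup (Fin k) →* Matrix (Fin d) (Fin d) R) :
    (ev φ).mapMatrix (gramP e) = gram e φ := by
  ext i j
  simp [gramP, gram, ev_X]

lemma ev_Dp {R : Type*} [CommRing R] (φ : FreeGroup (Fin k) →* Matrix (Fin d) (Fin d) R) : ev φ (Dp e) = (gram e φ).det := by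
  rw [Dp, RingHom.map_det, gramP_map]

lemma ev_adj {R : Type*} [CommRing R] (φ : FreeGroup (Fin k) →* Matrix (Fin d) (Fin d) R) (i j) :
    ev φ ((gramP e).adjugate i j) = (gram e φ).adjugate i j := by
  rw [← gramP_map, ← RingHom.map_adjugate]; rfl

variable (φ e) in
noncomputable def co (j : Fin d × Fin d) (M : Matrix (Fin d) (Fin d) K) : K :=
  (ev φ (Dp e))⁻¹ * ∑ l, (M * φ (e l)).trace * ev φ ((gramP e).adjugate l j)

lemma co_sum (hD : ev φ (Dp e) ≠ 0) (x : Fin d × Fin d → K) (j) :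
    co φ e j (∑ i, x i • φ (e i)) = x j := by
  have h1 : ∀ l, ((∑ i, x i • φ (e i)) * φ (e l)).trace = ∑ i, x i * gram e φ i l := by
    intro l
    rw [Finset.sum_mul, Matrix.trace_sum]
    simp [gram]
  have h2 : ∑ l, (∑ i, x i * gram e φ i l) * (gram e φ).adjugate l j =
      ∑ i, x i * ((gram e φ) * (gram e φ).adjugate) i j := by
    simp_rw [Matrix.mul_apply, Finset.sum_mul, Finset.mul_sum]
    rw [Finset.sum_comm]
    simp [mul_assoc]
  unfold co
  simp_rw [h1, ev_adj]
  rw [h2, Matrix.mul_adjugate, ← ev_Dp]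
  simp [Matrix.one_apply]
  field_simp

lemma span_e (hD : ev φ (Dp e) ≠ 0) (M : Matrix (Fin d) (Fin d) K) : ∃ x : Fin d × Fin d → K,
    M = ∑ i, x i • φ (e i) := by
  have hli : LinearIndependent K (fun i => φ (e i)) := by
    rw [Fintype.linearIndependent_iff]
    intro x hx i
    rw [← co_sum hD x i, hx]
    simp [co]
  have hsp := hli.span_eq_top_of_card_eq_finrank' (by
    rw [Module.finrank_matrix]; simp)
  have : M ∈ Submodule.span K (Set.range (fun i => φ (e i))) := by rw [hsp]; trivial
  obtain ⟨x, hx⟩ := (Submodule.mem_span_range_iff_exists_fun K).1 this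
  exact ⟨x, hx.symm⟩

lemma eq_co (hD : ev φ (Dp e) ≠ 0) (M : Matrix (Fin d) (Fin d) K) : M = ∑ i, co φ e i M • φ (e i) := by
  obtain ⟨x, hx⟩ := span_e hD M
  conv_lhs => rw [hx]
  refine Finset.sum_congr rfl fun i _ => ?_
  rw [hx, co_sum hD]

lemma co_smul (a : K) (M : Matrix (Fin d) (Fin d) K) (j) : co φ e j (a • M) = a * co φ e j M := by
  unfold co
  simp only [smul_mul_assoc, Matrix.trace_smul, smul_eq_mul, mul_assoc, ← Finset.mul_sum]
  ring
end

/-- a place where the discriminant is not too small -/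
structure PD {k d : ℕ} {K : Type} [Field K] {Γ : Type} [LinearOrderedCommGroupWithZero Γ]
    (e : Fin d × Fin d → FreeGroup (Fin k)) (C0 : ℕ)
    (φ : FreeGroup (Fin k) →* Matrix (Fin d) (Fin d) K) (v : K →*₀ Γ) (c T : Γ)
    (W : Finset (FreeGroup (Fin k))) : Prop extends PL φ v c T W where
  hD : 1 ≤ T ^ C0 * v (ev φ (Dp e))

section
variable {k d : ℕ} (e : Fin d × Fin d → FreeGroup (Fin k)) (C0 : ℕ)

lemma PD.ne {K : Type} [Field K] {Γ : Type} [LinearOrderedCommGroupWithZero Γ]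
    {φ : FreeGroup (Fin k) →* Matrix (Fin d) (Fin d) K} {v : K →*₀ Γ} {c T : Γ} {e C0}
    {W : Finset (FreeGroup (Fin k))} (h : PD e C0 φ v c T W) : ev φ (Dp e) ≠ 0 := by
  intro h0
  have := h.hD
  rw [h0] at this
  simp at this

lemma PD.mono {K : Type} [Field K] {Γ : Type} [LinearOrderedCommGroupWithZero Γ]
    {φ : FreeGroup (Fin k) →* Matrix (Fin d) (Fin d) K} {v : K →*₀ Γ} {c T : Γ} {e C0}
    {W W' : Finset (FreeGroup (Fin k))} (h : PD e C0 φ v c T W) (hW : W' ⊆ W) : PD e C0 φ v c T W' :=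
  ⟨h.toPL.mono hW, h.hD⟩

lemma co_bound : ∃ C : ℕ, ∃ W : Finset (FreeGroup (Fin k)),
    ∀ (K : Type) [Field K] (Γ : Type) [LinearOrderedCommGroupWithZero Γ]
      (φ : FreeGroup (Fin k) →* Matrix (Fin d) (Fin d) K) (v : K →*₀ Γ) (c T : Γ),
      PD e C0 φ v c T W → ∀ M j, v (co φ e j M) ≤ T ^ C * nm φ e v M := by
  obtain ⟨C, W, h⟩ := tp_bound_fam d (fun p : (Fin d × Fin d) × (Fin d × Fin d) => (gramP e).adjugate p.1 p.2)
  refine ⟨C0 + (Fintype.card (Fin d × Fin d) + C), W, ?_⟩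
  intro K _ Γ _ φ v c T hP M j
  unfold co
  rw [map_mul, map_inv₀, pow_add, mul_assoc]
  have hv : v (ev φ (Dp e)) ≠ 0 := by simpa using hP.ne
  gcongr
  · rw [inv_le_iff_one_le_mul₀ (zero_lt_iff.2 hv)]
    exact hP.hD
  · rw [pow_add, mul_assoc]
    refine hP.toPL.sum Finset.univ _ ?_
    intro l _
    rw [map_mul, mul_comm]
    gcongr
    · exact h K Γ φ v c T hP.toPL (l, j)
    · exact le_nm M l

lemma word_bound (h : FreeGroup (Fin k)) : ∃ C : ℕ, ∃ W : Finset (FreeGroup (Fin k)),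
    ∀ (K : Type) [Field K] (Γ : Type) [LinearOrderedCommGroupWithZero Γ]
      (φ : FreeGroup (Fin k) →* Matrix (Fin d) (Fin d) K) (v : K →*₀ Γ) (c T : Γ),
      PD e C0 φ v c T W → ∀ M, nm φ e v (φ h * M) ≤ T ^ C * nm φ e v M := by
  classical
  obtain ⟨C, W, hC⟩ := co_bound e C0
  let W1 : Finset (FreeGroup (Fin k)) := Finset.univ.image (fun p : (Fin d × Fin d) × (Fin d × Fin d) => h * e p.1 * e p.2)
  refine ⟨Fintype.card (Fin d × Fin d) + (1 + C), W ∪ W1, ?_⟩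
  intro K _ Γ _ φ v c T hP M
  rw [nm_le]
  intro i
  have e1 : (φ h * M * φ (e i)).trace = ∑ j, co φ e j M * (φ (h * e j * e i)).trace := by
    conv_lhs => rw [eq_co hP.ne M]
    rw [Finset.mul_sum, Finset.sum_mul, Matrix.trace_sum]
    simp
  rw [e1, pow_add, mul_assoc]
  refine hP.toPL.sum Finset.univ _ ?_
  intro j _
  rw [map_mul, mul_comm, pow_add, pow_one, mul_assoc T]
  gcongr
  · exact hP.tr _ (Finset.mem_union_right _ (Finset.mem_image.2 ⟨(j, i), Finset.mem_univ _, rfl⟩))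
  · exact hC K Γ φ v c T (hP.mono Finset.subset_union_left) M j

lemma word_bound_fin (H : Finset (FreeGroup (Fin k))) : ∃ C : ℕ, ∃ W : Finset (FreeGroup (Fin k)),
    ∀ (K : Type) [Field K] (Γ : Type) [LinearOrderedCommGroupWithZero Γ]
      (φ : FreeGroup (Fin k) →* Matrix (Fin d) (Fin d) K) (v : K →*₀ Γ) (c T : Γ),
      PD e C0 φ v c T W → ∀ h ∈ H, ∀ M, nm φ e v (φ h * M) ≤ T ^ C * nm φ e v M := by
  classical
  choose C W h using word_bound e C0
  refine ⟨H.sup C, H.sup W, ?_⟩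
  intro K _ Γ _ φ v c T hP w hw M
  refine (h w K Γ φ v c T (hP.mono ?_) M).trans ?_
  · exact Finset.le_sup (f := W) hw
  · gcongr
    · exact hP.hT.le
    · exact Finset.le_sup (f := C) hw

/-- with a bound on the letters, every word is bounded with no further traces needed -/
lemma letters_bound (C : ℕ) (w : FreeGroup (Fin k)) : ∃ C' : ℕ,
    ∀ (K : Type) [Field K] (Γ : Type) [LinearOrderedCommGroupWithZero Γ]
      (φ : FreeGroup (Fin k) →* Matrix (Fin d) (Fin d) K) (v : K →*₀ Γ) (T : Γ), 1 ≤ T →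
      (∀ i M, nm φ e v (φ (FreeGroup.of i) * M) ≤ T ^ C * nm φ e v M) →
      (∀ i M, nm φ e v (φ (FreeGroup.of i)⁻¹ * M) ≤ T ^ C * nm φ e v M) →
      ∀ M, nm φ e v (φ w * M) ≤ T ^ C' * nm φ e v M := by
  induction w using FreeGroup.induction_on with
  | C1 => exact ⟨0, by intros; simp⟩
  | of i => exact ⟨C, by intro K _ Γ _ φ v T hT h1 h2 M; exact h1 i M⟩
  | inv_of i _ => exact ⟨C, by intro K _ Γ _ φ v T hT h1 h2 M; exact h2 i M⟩
  | mul x y hx hy =>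
    obtain ⟨a, ha⟩ := hx
    obtain ⟨b, hb⟩ := hy
    refine ⟨a + b, ?_⟩
    intro K _ Γ _ φ v T hT h1 h2 M
    rw [map_mul, mul_assoc, pow_add, mul_assoc]
    refine (ha K Γ φ v T hT h1 h2 _).trans ?_
    gcongr
    exact hb K Γ φ v T hT h1 h2 _
end
end CG

namespace CG

section
variable {k d : ℕ}

abbrev Vr (d : ℕ) := (Fin d × Fin d) ⊕ ((Fin d × Fin d) ⊕ (Fin d × Fin d))

noncomputable def lc {K : Type*} [CommRing K] (φ : FreeGroup (Fin k) →* Matrix (Fin d) (Fin d) K)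
    (e : Fin d × Fin d → FreeGroup (Fin k)) (x : Fin d × Fin d → K) : Matrix (Fin d) (Fin d) K :=
  ∑ i, x i • φ (e i)

/-- the certificate -/
def PIf (e : Fin d × Fin d → FreeGroup (Fin k)) (H : Finset (FreeGroup (Fin k))) (fP : TP k) (m : ℕ)
    (Gc : (Fin d × Fin d) → (Fin d × Fin d) → (Fin d × Fin d) → FreeGroup (Fin k) → (Fin d × Fin d) → (Fin d × Fin d) →
      MvPolynomial (Vr d) (TP k)) {K : Type} [Field K] (φ : FreeGroup (Fin k) →* Matrix (Fin d) (Fin d) K) : Prop :=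
  ∀ i j l, ∀ x y y' : Fin d × Fin d → K, ev φ fP * (x i * y j * y' l) ^ m =
    ∑ h ∈ H, ∑ p : (Fin d × Fin d) × (Fin d × Fin d),
      MvPolynomial.eval₂ (ev φ) (Sum.elim x (Sum.elim y y')) (Gc i j l h p.1 p.2) *
        ((lc φ e y * φ h * lc φ e x * φ (e p.1)).trace * (lc φ e y' * φ h * lc φ e x * φ (e p.2)).trace)

lemma tp2_bound (d : ℕ) {σ : Type*} (G : MvPolynomial σ (TP k)) : ∃ C : ℕ, ∃ W : Finset (FreeGroup (Fin k)),
    ∀ (K : Type) [Field K] (Γ : Type) [LinearOrderedCommGroupWithZero Γ]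
      (φ : FreeGroup (Fin k) →* Matrix (Fin d) (Fin d) K) (v : K →*₀ Γ) (c T : Γ),
      PL φ v c T W → ∀ x : σ → K, (∀ s, v (x s) ≤ 1) → v (MvPolynomial.eval₂ (ev φ) x G) ≤ T ^ C := by
  classical
  induction G using MvPolynomial.induction_on with
  | C a =>
    obtain ⟨C, W, h⟩ := tp_bound d a
    refine ⟨C, W, ?_⟩
    intro K _ Γ _ φ v c T hP x hx
    simpa using h K Γ φ v c T hP
  | add p q hp hq =>
    obtain ⟨C, W, h⟩ := hp
    obtain ⟨C', W', h'⟩ := hq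
    refine ⟨1 + (C + C'), W ∪ W', ?_⟩
    intro K _ Γ _ φ v c T hP x hx
    rw [MvPolynomial.eval₂_add, pow_add, pow_one]
    refine (hP.qa.add _ _).trans ?_
    gcongr
    · exact hP.cT
    · refine max_le ((h K Γ φ v c T (hP.mono Finset.subset_union_left) x hx).trans (hP.pow_le (by omega)))
        ((h' K Γ φ v c T (hP.mono Finset.subset_union_right) x hx).trans (hP.pow_le (by omega)))
  | mul_X p w hp =>
    obtain ⟨C, W, h⟩ := hp
    refine ⟨C, W, ?_⟩
    intro K _ Γ _ φ v c T hP x hx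
    rw [MvPolynomial.eval₂_mul, MvPolynomial.eval₂_X, map_mul]
    calc _ ≤ T ^ C * 1 := by
          gcongr
          · exact h K Γ φ v c T hP x hx
          · exact hx w
      _ = _ := mul_one _

lemma tp2_bound_fin (d : ℕ) {σ α : Type*} (s : Finset α) (G : α → MvPolynomial σ (TP k)) :
    ∃ C : ℕ, ∃ W : Finset (FreeGroup (Fin k)),
    ∀ (K : Type) [Field K] (Γ : Type) [LinearOrderedCommGroupWithZero Γ]
      (φ : FreeGroup (Fin k) →* Matrix (Fin d) (Fin d) K) (v : K →*₀ Γ) (c T : Γ),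
      PL φ v c T W → ∀ x : σ → K, (∀ s, v (x s) ≤ 1) → ∀ a ∈ s,
        v (MvPolynomial.eval₂ (ev φ) x (G a)) ≤ T ^ C := by
  classical
  choose C W h using fun i => tp2_bound d (G i)
  refine ⟨s.sup C, s.sup W, ?_⟩
  intro K _ Γ _ φ v c T hP x hx i hi
  refine (h i K Γ φ v c T (hP.mono ?_) x hx).trans (hP.pow_le ?_)
  · exact Finset.le_sup (f := W) hi
  · exact Finset.le_sup (f := C) hi

lemma nm_sum {K : Type} [Field K] {Γ : Type} [LinearOrderedCommGroupWithZero Γ]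
    {e : Fin d × Fin d → FreeGroup (Fin k)}
    {φ : FreeGroup (Fin k) →* Matrix (Fin d) (Fin d) K} {v : K →*₀ Γ} {c T : Γ} {W}
    (hP : PL φ v c T W) {ι : Type*} (s : Finset ι) (f : ι → Matrix (Fin d) (Fin d) K) {M : Γ}
    (hM : ∀ i ∈ s, nm φ e v (f i) ≤ M) : nm φ e v (∑ i ∈ s, f i) ≤ T ^ s.card * M := by
  rw [nm_le]
  intro i
  rw [Finset.sum_mul, Matrix.trace_sum]
  exact hP.sum _ _ fun j hj => (le_nm _ i).trans (hM j hj)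

variable (e : Fin d × Fin d → FreeGroup (Fin k)) (C0 : ℕ)

/-- upper bound -/
lemma upper_bound (H : Finset (FreeGroup (Fin k))) : ∃ C : ℕ, ∃ W : Finset (FreeGroup (Fin k)),
    ∀ (K : Type) [Field K] (Γ : Type) [LinearOrderedCommGroupWithZero Γ]
      (φ : FreeGroup (Fin k) →* Matrix (Fin d) (Fin d) K) (v : K →*₀ Γ) (c T : Γ),
      PD e C0 φ v c T W → ∀ x y : Fin d × Fin d → K, (∀ i, v (x i) ≤ 1) → (∀ i, v (y i) ≤ 1) →
        ∀ h ∈ H, nm φ e v (lc φ e y * φ h * lc φ e x) ≤ T ^ C := by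
  classical
  obtain ⟨C1, W1, h1⟩ := word_bound_fin e C0 ((Finset.univ ×ˢ H).image fun p => e p.1 * p.2)
  let W2 : Finset (FreeGroup (Fin k)) := Finset.univ.image (fun p : (Fin d × Fin d) × (Fin d × Fin d) => e p.1 * e p.2)
  let N := (Finset.univ : Finset (Fin d × Fin d)).card
  refine ⟨N + (C1 + (N + 1)), W1 ∪ W2, ?_⟩
  intro K _ Γ _ φ v c T hP x y hx hy h hh
  have hX : nm φ e v (lc φ e x) ≤ T ^ (N + 1) := by
    rw [nm_le]
    intro i
    unfold lc
    rw [Finset.sum_mul, Matrix.trace_sum, pow_succ]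
    refine hP.toPL.sum _ _ fun j _ => ?_
    rw [smul_mul_assoc, Matrix.trace_smul, smul_eq_mul, map_mul, ← map_mul φ]
    calc _ ≤ 1 * T := by
          gcongr
          · exact hx j
          · exact hP.tr _ (Finset.mem_union_right _ (Finset.mem_image.2 ⟨(j, i), Finset.mem_univ _, rfl⟩))
      _ = T := one_mul _
  have e1 : lc φ e y * φ h * lc φ e x = ∑ j, y j • (φ (e j * h) * lc φ e x) := by
    conv_lhs => enter [1, 1]; unfold lc
    rw [Finset.sum_mul, Finset.sum_mul]
    simp
  rw [e1, pow_add]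
  refine nm_sum hP.toPL _ _ fun j _ => ?_
  rw [nm_smul, pow_add]
  calc _ ≤ 1 * (T ^ C1 * T ^ (N + 1)) := by
        gcongr
        · exact hy j
        · refine (h1 K Γ φ v c T (hP.mono Finset.subset_union_left) (e j * h)
            (Finset.mem_image.2 ⟨(j, h), by simp [hh], rfl⟩) _).trans ?_
          gcongr
    _ = _ := one_mul _

lemma cover_bound (H : Finset (FreeGroup (Fin k))) (fP : TP k) (m : ℕ)
    (Gc : (Fin d × Fin d) → (Fin d × Fin d) → (Fin d × Fin d) → FreeGroup (Fin k) → (Fin d × Fin d) → (Fin d × Fin d) →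
      MvPolynomial (Vr d) (TP k)) : ∃ C : ℕ, ∃ W : Finset (FreeGroup (Fin k)),
    ∀ (K : Type) [Field K] (Γ : Type) [LinearOrderedCommGroupWithZero Γ]
      (φ : FreeGroup (Fin k) →* Matrix (Fin d) (Fin d) K) (v : K →*₀ Γ) (c T : Γ),
      PD e C0 φ v c T W → PIf e H fP m Gc φ → 1 ≤ T ^ C0 * v (ev φ fP) →
      ∀ x y y' : Fin d × Fin d → K, (∀ i, v (x i) ≤ 1) → (∀ i, v (y i) ≤ 1) → (∀ i, v (y' i) ≤ 1) →
        (∃ i, v (x i) = 1) → (∃ i, v (y i) = 1) → (∃ i, v (y' i) = 1) →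
        ∃ h ∈ H, (1 ≤ T ^ C * nm φ e v (lc φ e y * φ h * lc φ e x) ∧
          1 ≤ T ^ C * nm φ e v (lc φ e y' * φ h * lc φ e x)) ∧
          nm φ e v (lc φ e y * φ h * lc φ e x) ≤ T ^ C ∧ nm φ e v (lc φ e y' * φ h * lc φ e x) ≤ T ^ C := by
  classical
  obtain ⟨CU, WU, hU⟩ := upper_bound e C0 H
  let Iall : Finset ((Fin d × Fin d) × (Fin d × Fin d) × (Fin d × Fin d) × FreeGroup (Fin k) ×
    (Fin d × Fin d) × (Fin d × Fin d)) := Finset.univ ×ˢ Finset.univ ×ˢ Finset.univ ×ˢ H ×ˢ Finset.univ ×ˢ Finset.univ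
  obtain ⟨CG, WG, hG⟩ := tp2_bound_fin d Iall (fun p => Gc p.1 p.2.1 p.2.2.1 p.2.2.2.1 p.2.2.2.2.1 p.2.2.2.2.2)
  let N := H.card
  let N2 := (Finset.univ : Finset ((Fin d × Fin d) × (Fin d × Fin d))).card
  let B := C0 + (N + (N2 + (CG + CU)))
  refine ⟨B + 1, WU ∪ WG, ?_⟩
  intro K _ Γ _ φ v c T hP hI hf x y y' hx hy hy' hx1 hy1 hy'1
  obtain ⟨i, hi⟩ := hx1
  obtain ⟨j, hj⟩ := hy1
  obtain ⟨l, hl⟩ := hy'1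
  have hT0 : T ≠ 0 := (zero_lt_one.trans hP.hT).ne'
  have hU1 := hU K Γ φ v c T (hP.mono Finset.subset_union_left)
  suffices hs : ∃ h ∈ H, (1 ≤ T ^ (B + 1) * nm φ e v (lc φ e y * φ h * lc φ e x) ∧
          1 ≤ T ^ (B + 1) * nm φ e v (lc φ e y' * φ h * lc φ e x)) by
    obtain ⟨h, hh, h12⟩ := hs
    refine ⟨h, hh, h12, (hU1 x y hx hy h hh).trans (hP.pow_le (by omega)),
      (hU1 x y' hx hy' h hh).trans (hP.pow_le (by omega))⟩
  by_contra hcon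
  push Not at hcon
  have hprod : ∀ h ∈ H, ∀ p : (Fin d × Fin d) × (Fin d × Fin d),
      v ((lc φ e y * φ h * lc φ e x * φ (e p.1)).trace * (lc φ e y' * φ h * lc φ e x * φ (e p.2)).trace)
        ≤ T ^ CU * (T ^ (B + 1))⁻¹ := by
    intro h hh p
    rw [map_mul]
    have a1 := (le_nm (φ := φ) (e := e) (v := v) (lc φ e y * φ h * lc φ e x) p.1)
    have a2 := (le_nm (φ := φ) (e := e) (v := v) (lc φ e y' * φ h * lc φ e x) p.2)
    have u1 := hU1 x y hx hy h hh
    have u2 := hU1 x y' hx hy' h hh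
    have hpos : 0 < T ^ (B + 1) := zero_lt_iff.2 (pow_ne_zero _ hT0)
    by_cases hc : 1 ≤ T ^ (B + 1) * nm φ e v (lc φ e y * φ h * lc φ e x)
    · have := (hcon h hh hc).le
      have h3 : nm φ e v (lc φ e y' * φ h * lc φ e x) ≤ (T ^ (B + 1))⁻¹ := by
        rw [← mul_one (T ^ (B + 1))⁻¹, le_inv_mul_iff₀ hpos]; exact this
      gcongr
      · exact a1.trans u1
      · exact a2.trans h3
    · have := (not_le.1 hc).le
      have h3 : nm φ e v (lc φ e y * φ h * lc φ e x) ≤ (T ^ (B + 1))⁻¹ := by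
        rw [← mul_one (T ^ (B + 1))⁻¹, le_inv_mul_iff₀ hpos]; exact this
      rw [mul_comm]
      gcongr
      · exact a2.trans u2
      · exact a1.trans h3
  have key := hI i j l x y y'
  have hv : v (ev φ fP) = v (ev φ fP * (x i * y j * y' l) ^ m) := by
    simp [hi, hj, hl]
  rw [key] at hv
  have hbd : v (ev φ fP) ≤ T ^ N * (T ^ N2 * (T ^ CG * (T ^ CU * (T ^ (B + 1))⁻¹))) := by
    rw [hv]
    refine hP.toPL.sum _ _ fun h hh => ?_
    refine hP.toPL.sum _ _ fun p _ => ?_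
    rw [map_mul]
    gcongr
    · refine hG K Γ φ v c T (hP.toPL.mono Finset.subset_union_right) _ ?_ (i, j, l, h, p.1, p.2) ?_
      · rintro (s | s | s)
        · exact hx s
        · exact hy s
        · exact hy' s
      · simp [Iall, hh]
    · exact hprod h hh p
  have h1 : (1 : Γ) ≤ T ^ B * (T ^ (B + 1))⁻¹ := by
    refine hf.trans ?_
    calc T ^ C0 * v (ev φ fP) ≤ T ^ C0 * (T ^ N * (T ^ N2 * (T ^ CG * (T ^ CU * (T ^ (B + 1))⁻¹)))) := by gcongr
      _ = _ := by simp only [B, pow_add T C0, pow_add T N, pow_add T N2, pow_add T CG]; ac_rfl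
  rw [pow_succ, mul_inv, ← mul_assoc, mul_inv_cancel₀ (pow_ne_zero _ hT0), one_mul] at h1
  exact absurd h1 (not_le.2 (inv_lt_one_of_one_lt₀ hP.hT))
end
end CG

namespace CG

def Dyn {k d : ℕ} {K : Type} [Field K] (φ : FreeGroup (Fin k) →* Matrix (Fin d) (Fin d) K)
    (Q H : Set (FreeGroup (Fin k))) : Prop :=
  ∃ q ∈ Q, ∃ A : Set (Matrix (Fin d) (Fin d) K), (∀ X ∈ A, ∀ c : K, c ≠ 0 → c • X ∈ A) ∧
    (∀ X ∈ A, ∀ i, 1 ≤ i → φ (q ^ i) * X ∉ A) ∧ ∀ w, ∃ h ∈ H, φ h * φ w ∈ A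

lemma gap_of_dyn {k : ℕ} (d : ℕ) (hd : 0 < d) (Q H : Set (FreeGroup (Fin k))) (hQ : Q.Finite) (hH : H.Finite) :
    ∃ ε > 0, ∀ (K : Type) [Field K] (φ : FreeGroup (Fin k) →* Matrix (Fin d) (Fin d) K),
      Dyn φ Q H → ∀ (X : Type) (ρ : FreeGroup (Fin k) →* Equiv.Perm X),
        (∀ w x, ρ w x = x → Scal K (φ w)) → Gap ε ρ := by
  obtain ⟨ε, hε, h⟩ := gap_of_paradox Q H hQ hH
  refine ⟨ε, hε, ?_⟩
  intro K _ φ ⟨q, hq, A, hA1, hA2, hA3⟩ X ρ hρ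
  letI act : MulAction (FreeGroup (Fin k)) X := MulAction.compHom X ρ
  have hact : ∀ w x, w • x = ρ w x := fun _ _ => rfl
  let r : X → X := fun x => (Quotient.mk (MulAction.orbitRel (FreeGroup (Fin k)) X) x).out
  have hr1 : ∀ x, ∃ w, ρ w (r x) = x := by
    intro x
    have : (MulAction.orbitRel (FreeGroup (Fin k)) X) (r x) x := Quotient.mk_out x
    obtain ⟨w, hw⟩ := (MulAction.orbitRel (FreeGroup (Fin k)) X).symm this
    exact ⟨w, hw⟩
  have hr2 : ∀ w x, r (ρ w x) = r x := by
    intro w x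
    have : Quotient.mk (MulAction.orbitRel (FreeGroup (Fin k)) X) (ρ w x) =
      Quotient.mk (MulAction.orbitRel (FreeGroup (Fin k)) X) x := Quotient.sound ⟨w, rfl⟩
    simp only [r, this]
  choose m hm using hr1
  have hsc : ∀ h x, ∃ c : K, c ≠ 0 ∧ φ h * φ (m x) = c • φ (m (ρ h x)) := by
    intro h x
    have h1 : ρ ((m (ρ h x))⁻¹ * (h * m x)) (r x) = r x := by
      have e1 := hm (ρ h x)
      rw [hr2] at e1
      rw [map_mul, map_mul, Equiv.Perm.mul_apply, Equiv.Perm.mul_apply, hm x, map_inv,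
        Equiv.Perm.inv_eq_iff_eq]
      exact e1.symm
    obtain ⟨c, hc⟩ := hρ _ _ h1
    have e2 : φ h * φ (m x) = φ (m (ρ h x)) * φ ((m (ρ h x))⁻¹ * (h * m x)) := by
      rw [← map_mul, ← map_mul]; congr 1; group
    rw [hc] at e2
    refine ⟨c, ?_, by simpa using e2⟩
    rintro rfl
    rw [zero_smul, mul_zero] at e2
    have e3 : φ ((h * m x)⁻¹) * (φ h * φ (m x)) = 1 := by rw [← map_mul φ h, ← map_mul]; simp
    rw [e2, mul_zero] at e3
    have := congrFun (congrFun e3 ⟨0, hd⟩) ⟨0, hd⟩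
    simp at this
  have hback : ∀ (c : K) (Y : Matrix (Fin d) (Fin d) K), c ≠ 0 → c • Y ∈ A → Y ∈ A := by
    intro c Y hc hY
    have := hA1 _ hY c⁻¹ (inv_ne_zero hc)
    rwa [smul_smul, inv_mul_cancel₀ hc, one_smul] at this
  refine h X ρ {x | φ (m x) ∈ A} q hq ?_ ?_
  · intro x hx i hi hxi
    obtain ⟨c, hc, e⟩ := hsc (q ^ i) x
    refine hA2 _ hx i hi ?_
    rw [e]
    exact hA1 _ hxi c hc
  · intro x
    obtain ⟨h, hh, hm'⟩ := hA3 (m x)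
    refine ⟨h, hh, ?_⟩
    obtain ⟨c, hc, e⟩ := hsc h x
    rw [e] at hm'
    exact hback c _ hc hm'

section
variable {K : Type} [Field K]

noncomputable def pl (l : List K) : Polynomial K := (l.map fun b => Polynomial.X - Polynomial.C b).prod

lemma pl_cons (b : K) (l : List K) : pl (b :: l) = (Polynomial.X - Polynomial.C b) * pl l := by simp [pl]

lemma pl_filter (p : K → Prop) [DecidablePred p] (l : List K) :
    pl l = pl (l.filter (fun x => p x)) * pl (l.filter (fun x => ¬ p x)) := by
  induction l with
  | nil => simp [pl]
  | cons b l ih =>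
    by_cases hp : p b
    · rw [List.filter_cons_of_pos (by simpa using hp), List.filter_cons_of_neg (by simpa using hp),
        pl_cons, pl_cons, mul_assoc, ← ih]
    · rw [List.filter_cons_of_neg (by simpa using hp), List.filter_cons_of_pos (by simpa using hp),
        pl_cons, pl_cons, ← mul_assoc, mul_comm (pl _) (Polynomial.X - _), mul_assoc, ← ih]

variable {d : ℕ}
lemma kill_of_aeval (g : Matrix (Fin d) (Fin d) K) : ∀ (l : List K) (Z : Matrix (Fin d) (Fin d) K),
    Polynomial.aeval g (pl l) * Z = 0 → Kill (LinearMap.mulLeft K g) l Z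
  | [], Z, h => by simpa [pl, Kill] using h
  | b :: l, Z, h => by
    simp only [Kill]
    apply kill_of_aeval g l
    rw [pl_cons, mul_comm, map_mul, mul_assoc] at h
    rw [← h]
    congr 1
    simp [sub_mul, Algebra.algebraMap_eq_smul_one]

lemma pl_roots [IsAlgClosed K] (g : Matrix (Fin d) (Fin d) K) : g.charpoly = pl g.charpoly.roots.toList := by
  have h1 := (IsAlgClosed.splits g.charpoly).eq_prod_roots_of_monic g.charpoly_monic
  conv_lhs => rw [h1]
  rw [pl, ← Multiset.prod_coe, ← Multiset.map_coe, Multiset.coe_toList]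

lemma eig_matrix (hd : 0 < d) (g : Matrix (Fin d) (Fin d) K) (β : K) (hβ : β ∈ g.charpoly.roots) :
    ∃ U : Matrix (Fin d) (Fin d) K, U ≠ 0 ∧ g * U = β • U := by
  have h := Polynomial.isRoot_of_mem_roots hβ
  rw [Polynomial.IsRoot.def, Matrix.eval_charpoly] at h
  obtain ⟨u, hu0, hu⟩ := Matrix.exists_mulVec_eq_zero_iff.2 h
  refine ⟨Matrix.of fun i _ => u i, ?_, ?_⟩
  · intro h
    apply hu0
    ext i
    exact congrFun (congrFun h i) ⟨0, hd⟩
  · rw [Matrix.sub_mulVec, sub_eq_zero] at hu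
    ext i j
    have := congrFun hu i
    simp only [Matrix.scalar_apply, Matrix.mulVec_diagonal] at this
    simp only [Matrix.mul_apply, Matrix.of_apply, Matrix.smul_apply, smul_eq_mul]
    rw [this]; rfl

lemma aeval_eig (g U : Matrix (Fin d) (Fin d) K) (β : K) (h : g * U = β • U) (l : List K) :
    Polynomial.aeval g (pl l) * U = (l.map fun b => β - b).prod • U := by
  induction l with
  | nil => simp [pl]
  | cons b l ih =>
    rw [pl_cons, map_mul, mul_assoc, ih, List.map_cons, List.prod_cons, mul_smul_comm]
    simp only [map_sub, Polynomial.aeval_X, Polynomial.aeval_C, sub_mul, h, Algebra.algebraMap_eq_smul_one,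
      smul_mul_assoc, one_mul]
    simp only [smul_sub, smul_smul, sub_smul]
    rw [mul_comm _ β, mul_comm _ b]
end

section
variable {k d : ℕ} {K : Type} [Field K] {Γ : Type} [LinearOrderedCommGroupWithZero Γ]
variable {φ : FreeGroup (Fin k) →* Matrix (Fin d) (Fin d) K} {e : Fin d × Fin d → FreeGroup (Fin k)}
  {v : K →*₀ Γ}

lemma nm_ne (hD : ev φ (Dp e) ≠ 0) {X : Matrix (Fin d) (Fin d) K} (hX : X ≠ 0) : nm φ e v X ≠ 0 := by
  intro h
  apply hX
  rw [eq_co hD X]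
  refine Finset.sum_eq_zero fun i _ => ?_
  have : co φ e i X = 0 := by
    unfold co
    rw [Finset.sum_eq_zero, mul_zero]
    intro l _
    have := le_nm (φ := φ) (e := e) (v := v) X l
    rw [h, le_zero_iff, map_eq_zero] at this
    rw [this, zero_mul]
  rw [this, zero_smul]

lemma normalize (hD : ev φ (Dp e) ≠ 0) {X : Matrix (Fin d) (Fin d) K} (hX : X ≠ 0) :
    ∃ a : K, a ≠ 0 ∧ ∃ x : Fin d × Fin d → K, a • X = lc φ e x ∧ (∀ i, v (x i) ≤ 1) ∧ ∃ i, v (x i) = 1 := by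
  have hne : ∃ i, co φ e i X ≠ 0 := by
    by_contra hc
    push Not at hc
    apply hX
    rw [eq_co hD X]
    exact Finset.sum_eq_zero fun i _ => by rw [hc, zero_smul]
  obtain ⟨i0, hi0⟩ := hne
  obtain ⟨i, -, hi⟩ := Finset.exists_max_image Finset.univ (fun i => v (co φ e i X)) ⟨i0, Finset.mem_univ _⟩
  have hv : v (co φ e i X) ≠ 0 := by
    intro h
    have := hi i0 (Finset.mem_univ _)
    rw [h, le_zero_iff, map_eq_zero] at this
    exact hi0 this
  have hc : co φ e i X ≠ 0 := by simpa using hv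
  refine ⟨(co φ e i X)⁻¹, inv_ne_zero hc, fun j => (co φ e i X)⁻¹ * co φ e j X, ?_, ?_, i, ?_⟩
  · unfold lc
    have := congrArg (fun M => (co φ e i X)⁻¹ • M) (eq_co hD X)
    rw [this, Finset.smul_sum]
    simp [smul_smul]
  · intro j
    rw [map_mul, map_inv₀, inv_mul_le_iff₀ (zero_lt_iff.2 hv), mul_one]
    exact hi j (Finset.mem_univ _)
  · show v ((co φ e i X)⁻¹ * co φ e i X) = 1
    rw [inv_mul_cancel₀ hc, map_one]
end
end CG

namespace CG

section
variable {Γ : Type} [LinearOrderedCommGroupWithZero Γ]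
lemma pingpong {V : Type} (f : V → V) (den num : V → Γ) {κ T : Γ} (hκ : κ ≠ 0) (hT : 1 < T) (M1 : ℕ)
    (h1 : ∀ X, den (f X) ≤ κ * den X) (h2 : ∀ X, κ * T ^ (2 * M1 + 1) * num X ≤ num (f X)) (X : V)
    (hX : den X ≠ 0 ∧ den X ≤ T ^ M1 * num X ∧ num X ≤ T ^ M1 * den X) (i : ℕ) (hi : 1 ≤ i) :
    ¬ (den (f^[i] X) ≠ 0 ∧ den (f^[i] X) ≤ T ^ M1 * num (f^[i] X) ∧ num (f^[i] X) ≤ T ^ M1 * den (f^[i] X)) := by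
  have key : ∀ i, 1 ≤ i → den (f^[i] X) ≤ κ ^ i * den X ∧ κ ^ i * T ^ (2 * M1 + 1) * num X ≤ num (f^[i] X) := by
    intro i hi
    induction i, hi using Nat.le_induction with
    | base => simpa using ⟨h1 X, h2 X⟩
    | succ n hn ih =>
      rw [Function.iterate_succ_apply']
      constructor
      · refine (h1 _).trans ?_
        rw [pow_succ', mul_assoc]
        gcongr
        exact ih.1
      · refine le_trans ?_ (h2 _)
        calc κ ^ (n + 1) * T ^ (2 * M1 + 1) * num X = κ * 1 * (κ ^ n * T ^ (2 * M1 + 1) * num X) := by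
              rw [pow_succ', mul_one]; simp only [mul_assoc]
          _ ≤ _ := by
            gcongr
            · exact one_le_pow₀ hT.le
            · exact ih.2
  rintro ⟨-, -, h3⟩
  obtain ⟨k1, k2⟩ := key i hi
  have hn : num X ≠ 0 := by
    intro h
    rw [h, mul_zero, le_zero_iff] at hX
    exact hX.1 hX.2.1
  have h4 : κ ^ i * T ^ (2 * M1 + 1) * num X ≤ κ ^ i * T ^ (2 * M1) * num X := by
    calc _ ≤ _ := k2
      _ ≤ _ := h3
      _ ≤ T ^ M1 * (κ ^ i * (T ^ M1 * num X)) := by gcongr; exact k1.trans (by gcongr; exact hX.2.1)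
      _ = _ := by
        rw [two_mul, pow_add, mul_left_comm]; simp only [mul_assoc]
  have hpos : 0 < κ ^ i := zero_lt_iff.2 (pow_ne_zero _ hκ)
  have h5 : κ ^ i * T ^ (2 * M1) * num X < κ ^ i * T ^ (2 * M1 + 1) * num X := by
    apply mul_lt_mul_of_pos_right _ (zero_lt_iff.2 hn)
    apply mul_lt_mul_of_pos_left _ hpos
    exact pow_lt_pow_right₀ hT (by omega)
  exact absurd h4 (not_le.2 h5)
end

section
variable {k d : ℕ} {K : Type} [Field K] [IsAlgClosed K] {Γ : Type} [LinearOrderedCommGroupWithZero Γ]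
variable {φ : FreeGroup (Fin k) →* Matrix (Fin d) (Fin d) K} {e : Fin d × Fin d → FreeGroup (Fin k)}
  {v : K →*₀ Γ} {c T : Γ} {W : Finset (FreeGroup (Fin k))}

lemma eig_bound (hd : 0 < d) (hD : ev φ (Dp e) ≠ 0) (g : Matrix (Fin d) (Fin d) K) {R : Γ}
    (hR : ∀ M, nm φ e v (g * M) ≤ R * nm φ e v M) (β : K) (hβ : β ∈ g.charpoly.roots) : v β ≤ R := by
  obtain ⟨U, hU, h⟩ := eig_matrix hd g β hβ
  have := hR U
  rw [h, nm_smul] at this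
  exact le_of_mul_le_mul_right this (zero_lt_iff.2 (nm_ne hD hU))

lemma eig_bound_inv (hd : 0 < d) (hD : ev φ (Dp e) ≠ 0) (g g' : Matrix (Fin d) (Fin d) K) (hgg : g' * g = 1) {R : Γ}
    (hR : ∀ M, nm φ e v (g' * M) ≤ R * nm φ e v M) (β : K) (hβ : β ∈ g.charpoly.roots) : 1 ≤ R * v β := by
  obtain ⟨U, hU, h⟩ := eig_matrix hd g β hβ
  have := hR (g * U)
  rw [← mul_assoc, hgg, one_mul, h, nm_smul] at this
  have hp := zero_lt_iff.2 (nm_ne (v := v) hD hU)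
  apply le_of_mul_le_mul_right _ hp
  rwa [one_mul, mul_assoc]

lemma dyn_core {C0 : ℕ} (hd : 0 < d) (hP : PD e C0 φ v c T W) (g : FreeGroup (Fin k)) (hdet : (φ g).det = 1)
    (hbig : T ≤ v (φ g).trace) (Cg M : ℕ) (hg : ∀ X, nm φ e v (φ g * X) ≤ T ^ Cg * nm φ e v X)
    (hg' : ∀ X, nm φ e v (φ g⁻¹ * X) ≤ T ^ Cg * nm φ e v X) :
    ∃ Y Y' : Matrix (Fin d) (Fin d) K, Y ≠ 0 ∧ Y' ≠ 0 ∧ ∃ κ : Γ, κ ≠ 0 ∧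
      (∀ X, nm φ e v (Y * (φ (g ^ (2 * d * (2 * (2 * d * (2 * Cg + 1) + M)))) * X)) ≤ κ * nm φ e v (Y * X)) ∧
      ∀ X, κ * T ^ M * nm φ e v (Y' * X) ≤
        nm φ e v (Y' * (φ (g ^ (2 * d * (2 * (2 * d * (2 * Cg + 1) + M)))) * X)) := by
  classical
  set G := φ g with hG
  have hgi : φ g⁻¹ * G = 1 := by rw [hG, ← map_mul]; simp
  have hgi' : G * φ g⁻¹ = 1 := by rw [hG, ← map_mul]; simp
  have hD := hP.ne
  have hT0 : (0:Γ) < T := zero_lt_one.trans hP.hT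
  set l := G.charpoly.roots.toList with hl
  have hlen : l.length = d := by
    rw [hl, Multiset.length_toList, ← (IsAlgClosed.splits G.charpoly).natDegree_eq_card_roots,
      Matrix.charpoly_natDegree_eq_dim, Fintype.card_fin]
  have hprod : (l.map v).prod = 1 := by
    have h1 := Matrix.det_eq_prod_roots_charpoly G
    rw [hdet] at h1
    have h2 : l.prod = 1 := by rw [h1, hl, Multiset.prod_toList]
    have h3 := map_list_prod v l
    rw [← h3, h2, map_one]
  have hmem : ∀ {β}, β ∈ l ↔ β ∈ G.charpoly.roots := by intro β; rw [hl, Multiset.mem_toList]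
  have hexbig : ∃ x ∈ l.map v, T ≤ x ^ 2 := by
    by_contra hcon
    push Not at hcon
    have h1 := Matrix.trace_eq_sum_roots_charpoly G
    have hne : l ≠ [] := by intro h; rw [h] at hlen; simp at hlen; omega
    obtain ⟨x, hx, hmax⟩ : ∃ x ∈ l, ∀ y ∈ l, v y ≤ v x := by
      obtain ⟨x, hx, h⟩ := Finset.exists_max_image l.toFinset v (by simpa using hne)
      exact ⟨x, by simpa using hx, fun y hy => h y (by simpa using hy)⟩
    have h2 := hP.qa.multiset_sum G.charpoly.roots (M := v x) (fun i hi => hmax i (hmem.2 hi))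
    rw [← h1, ← Multiset.length_toList, ← hl, hlen] at h2
    have h3 := hcon (v x) (List.mem_map_of_mem hx)
    have h4 : T ^ 2 ≤ c ^ (2 * d) * v x ^ 2 := by
      calc T ^ 2 ≤ (c ^ d * v x) ^ 2 := by gcongr; exact hbig.trans h2
        _ = _ := by rw [mul_pow, ← pow_mul, mul_comm d]
    have h5 : c ^ (2 * d) ≤ T := (pow_le_pow_right₀ hP.qa.one_le (by nlinarith)).trans hP.hc
    have h6 : c ^ (2 * d) * v x ^ 2 ≤ T * v x ^ 2 := by gcongr
    have h7 : T * v x ^ 2 < T * T := mul_lt_mul_of_pos_left h3 hT0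
    rw [pow_two] at h4
    exact absurd (h4.trans h6) (not_le.2 h7)
  obtain ⟨a, b, hb0, ⟨_, ha, rfl⟩, ⟨_, hb, rfl⟩, hab, hsplit⟩ := split_list hP.hT (l.map v) hprod hexbig
  rename_i a b
  rw [List.length_map, hlen] at hab
  rw [List.mem_map] at ha hb
  obtain ⟨α, hα, rfl⟩ := ha
  obtain ⟨β, hβ, rfl⟩ := hb
  have hlt : v β < v α := by
    by_contra h
    push Not at h
    have h1 : v α ^ (2 * d) ≤ v β ^ (2 * d) := by gcongr
    have h2 : v β ^ (2 * d) < v β ^ (2 * d) * T := by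
      conv_lhs => rw [← mul_one (v β ^ (2 * d))]
      exact mul_lt_mul_of_pos_left hP.hT (zero_lt_iff.2 (pow_ne_zero _ hb0))
    exact absurd (hab.trans h1) (not_le.2 h2)
  have ha0 : v α ≠ 0 := ne_of_gt (zero_le.trans_lt hlt)
  set A := l.filter (fun x => v α ≤ v x) with hA
  set B := l.filter (fun x => ¬ v α ≤ v x) with hB
  have hBle : ∀ x ∈ B, v x ≤ v β := by
    intro x hx
    rw [hB, List.mem_filter] at hx
    rcases hsplit (v x) (List.mem_map_of_mem hx.1) with h | h
    · exact absurd h (by simpa using hx.2)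
    · exact h
  have hAle : ∀ x ∈ A, v α ≤ v x := by
    intro x hx
    rw [hA, List.mem_filter] at hx
    simpa using hx.2
  have hne : ∀ (l' : List K) (γ : K), γ ∈ l → γ ∉ l' → Polynomial.aeval G (pl l') ≠ 0 := by
    intro l' γ hγ hγ' h0
    obtain ⟨U, hU, h⟩ := eig_matrix hd G γ (hmem.1 hγ)
    have := aeval_eig G U γ h l'
    rw [h0, zero_mul] at this
    rcases smul_eq_zero.1 this.symm with h | h
    · rw [List.prod_eq_zero_iff, List.mem_map] at h
      obtain ⟨x, hx, hx0⟩ := h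
      rw [sub_eq_zero] at hx0
      exact hγ' (hx0 ▸ hx)
    · exact hU h
  have hAB : Polynomial.aeval G (pl A) * Polynomial.aeval G (pl B) = 0 := by
    rw [← map_mul, hA, hB, ← pl_filter, hl, ← pl_roots, Matrix.aeval_self_charpoly]
  have hBA : Polynomial.aeval G (pl B) * Polynomial.aeval G (pl A) = 0 := by
    rw [← map_mul, mul_comm, map_mul, hAB]
  have hcomm : ∀ (l' : List K) (n : ℕ), Polynomial.aeval G (pl l') * G ^ n = G ^ n * Polynomial.aeval G (pl l') := by
    intro l' n
    have : Polynomial.aeval G (pl l' * Polynomial.X ^ n) = Polynomial.aeval G (Polynomial.X ^ n * pl l') := by rw [mul_comm]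
    simpa using this
  set J := 2 * d * (2 * Cg + 1) + M with hJ
  set j := 2 * d * (2 * J) with hj
  set E := T ^ (2 * Cg + 1) with hE
  have hE1 : 1 ≤ E := one_le_pow₀ hP.hT.le
  have hlenA : A.length ≤ d := hlen ▸ List.length_filter_le _ _
  have hlenB : B.length ≤ d := hlen ▸ List.length_filter_le _ _
  have hcE : c ≤ E := hP.cT.trans (le_self_pow₀ hP.hT.le (by omega))
  have hpow : ∀ (f : Matrix (Fin d) (Fin d) K) (n : ℕ) X, ((LinearMap.mulLeft K f) ^ n) X = f ^ n * X := by
    intro f n X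
    rw [LinearMap.pow_mulLeft, LinearMap.mulLeft_apply]
  have hmon : ∀ n m, m ≤ d → c ^ (n * m) * E ^ m ≤ c ^ (n * d) * E ^ d := by
    intro n m hm
    gcongr
    · exact hP.qa.one_le
  have hκ : c ^ (j * d) * E ^ d ≠ 0 := mul_ne_zero (pow_ne_zero _ (ne_of_gt (zero_lt_one.trans_le hP.qa.one_le)))
    (pow_ne_zero _ (ne_of_gt (zero_lt_one.trans_le hE1)))
  refine ⟨Polynomial.aeval G (pl A), Polynomial.aeval G (pl B), hne A β hβ ?_, hne B α hα ?_,
    c ^ (j * d) * E ^ d * v β ^ j, mul_ne_zero hκ (pow_ne_zero _ hb0), ?_, ?_⟩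
  · intro h
    exact absurd (hAle β h) (not_le.2 hlt)
  · intro h
    exact absurd (hBle α h) (not_le.2 hlt)
  · intro X
    have hk : Kill (LinearMap.mulLeft K G) B (Polynomial.aeval G (pl A) * X) :=
      kill_of_aeval G B _ (by rw [← mul_assoc, hBA, zero_mul])
    have := growth hP.qa.one_le (nm φ e v) nm_zero (nm_add hP.qa) nm_smul (LinearMap.mulLeft K G) (R := T ^ Cg)
      (b := v β) (E := E) hg hcE (by
        have h1 := eig_bound_inv hd hD G (φ g⁻¹) hgi hg' β (hmem.1 hβ)
        calc c * T ^ Cg ≤ T * T ^ Cg * 1 := by rw [mul_one]; gcongr; exact hP.cT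
          _ ≤ T * T ^ Cg * (T ^ Cg * v β) := by gcongr
          _ = _ := by rw [hE, two_mul, pow_succ, pow_add]; simp only [mul_assoc, mul_comm, mul_left_comm]) B _ hBle hk j
    rw [hpow, ← mul_assoc, ← hcomm, mul_assoc] at this
    rw [map_pow]
    refine this.trans ?_
    gcongr ?_ * _ * _
    exact hmon _ _ hlenB
  · intro X
    have hk : Kill (LinearMap.mulLeft K G) A (Polynomial.aeval G (pl B) * (G ^ j * X)) :=
      kill_of_aeval G A _ (by rw [← mul_assoc, hAB, zero_mul])
    have hk' : Kill (LinearMap.mulLeft K (φ g⁻¹)) (A.map (·⁻¹)) (Polynomial.aeval G (pl B) * (G ^ j * X)) := by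
      refine Kill.inv (f := LinearMap.mulLeft K G) ?_ ?_ ?_ hk
      · intro x; simp [← mul_assoc, hgi']
      · intro x; simp only [LinearMap.mulLeft_apply, ← mul_assoc, hgi, one_mul]
      · rintro x hx rfl
        have := hAle 0 hx
        rw [map_zero, le_zero_iff] at this
        exact ha0 this
    have hle : ∀ x ∈ A.map (·⁻¹), v x ≤ (v α)⁻¹ := by
      intro x hx
      rw [List.mem_map] at hx
      obtain ⟨y, hy, rfl⟩ := hx
      rw [map_inv₀]
      exact inv_anti₀ (zero_lt_iff.2 ha0) (hAle y hy)
    have := growth hP.qa.one_le (nm φ e v) nm_zero (nm_add hP.qa) nm_smul (LinearMap.mulLeft K (φ g⁻¹)) (R := T ^ Cg)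
      (b := (v α)⁻¹) (E := E) hg' hcE (by
        have h1 := eig_bound hd hD G hg α (hmem.1 hα)
        rw [le_mul_inv_iff₀ (zero_lt_iff.2 ha0)]
        calc c * T ^ Cg * v α ≤ T * T ^ Cg * T ^ Cg := by gcongr; exact hP.cT
          _ = _ := by rw [hE, two_mul, pow_succ, pow_add]; simp only [mul_assoc, mul_comm, mul_left_comm]) _ _ hle hk' j
    have hinv : φ g⁻¹ ^ j * G ^ j = 1 := by
      rw [hG, ← map_pow, ← map_pow, ← map_mul, inv_pow, inv_mul_cancel, map_one]
    have heq : φ g⁻¹ ^ j * (Polynomial.aeval G (pl B) * (G ^ j * X)) = Polynomial.aeval G (pl B) * X := by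
      rw [← mul_assoc (Polynomial.aeval G (pl B)), hcomm, ← mul_assoc, ← mul_assoc, hinv, one_mul]
    rw [hpow, heq, List.length_map] at this
    rw [map_pow, ← hG]
    set nB := nm φ e v (Polynomial.aeval G (pl B) * X)
    set nQ := nm φ e v (Polynomial.aeval G (pl B) * (G ^ j * X))
    set κ := c ^ (j * d) * E ^ d with hκd
    have h1 : nB ≤ κ * (v α)⁻¹ ^ j * nQ := by
      refine this.trans ?_
      gcongr ?_ * _ * _
      exact hmon _ _ hlenA
    have h2 : κ * κ * T ^ M * v β ^ j ≤ v α ^ j := by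
      have e1 : κ * κ * T ^ M ≤ T ^ (2 * J) := by
        have e2 : c ^ (j * d) * c ^ (j * d) ≤ T ^ J := by
          calc c ^ (j * d) * c ^ (j * d) = (c ^ (8 * d ^ 2)) ^ J := by
                rw [← pow_add, ← pow_mul]; congr 1; rw [hj]; ring
            _ ≤ T ^ J := by gcongr; exact hP.hc
        calc κ * κ * T ^ M = (c ^ (j * d) * c ^ (j * d)) * ((E ^ d) ^ 2 * T ^ M) := by
              rw [hκd, pow_two]; simp only [mul_assoc, mul_left_comm]
          _ ≤ T ^ J * ((E ^ d) ^ 2 * T ^ M) := by gcongr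
          _ = T ^ (2 * J) := by
            rw [hE, ← pow_mul, ← pow_mul, ← pow_add, ← pow_add]; congr 1; rw [hJ]; ring
      calc κ * κ * T ^ M * v β ^ j ≤ T ^ (2 * J) * v β ^ j := by gcongr
        _ = (v β ^ (2 * d) * T) ^ (2 * J) := by rw [mul_pow, ← pow_mul, mul_comm]
        _ ≤ (v α ^ (2 * d)) ^ (2 * J) := by gcongr
        _ = _ := by rw [← pow_mul]
    calc κ * v β ^ j * T ^ M * nB ≤ κ * v β ^ j * T ^ M * (κ * (v α)⁻¹ ^ j * nQ) := by gcongr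
      _ = (κ * κ * T ^ M * v β ^ j) * ((v α)⁻¹ ^ j * nQ) := by simp only [mul_assoc, mul_left_comm, mul_comm]
      _ ≤ v α ^ j * ((v α)⁻¹ ^ j * nQ) := by gcongr
      _ = nQ := by rw [← mul_assoc, ← mul_pow, mul_inv_cancel₀ ha0, one_pow, one_mul]
end

lemma local_thm {k d : ℕ} (hd : 0 < d) (e : Fin d × Fin d → FreeGroup (Fin k)) (C0 : ℕ)
    (H : Finset (FreeGroup (Fin k))) (fP : TP k) (m : ℕ)
    (Gc : (Fin d × Fin d) → (Fin d × Fin d) → (Fin d × Fin d) → FreeGroup (Fin k) → (Fin d × Fin d) → (Fin d × Fin d) →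
      MvPolynomial (Vr d) (TP k)) : ∃ W0 : Finset (FreeGroup (Fin k)), ∀ W, W0 ⊆ W →
    ∃ Q : Set (FreeGroup (Fin k)), Q.Finite ∧
    ∀ (K : Type) [Field K] [IsAlgClosed K] (Γ : Type) [LinearOrderedCommGroupWithZero Γ]
      (φ : FreeGroup (Fin k) →* Matrix (Fin d) (Fin d) K) (v : K →*₀ Γ) (c T : Γ),
      (∀ w, (φ w).det = 1) → PD e C0 φ v c T W → PIf e H fP m Gc φ → 1 ≤ T ^ C0 * v (ev φ fP) →
      (∃ g ∈ W, T ≤ v (φ g).trace) → Dyn φ Q H := by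
  classical
  obtain ⟨C, Wc, hC⟩ := cover_bound e C0 H fP m Gc
  obtain ⟨CL, WL, hL⟩ := word_bound_fin e C0
    ((Finset.univ.image fun i : Fin k => FreeGroup.of i) ∪ (Finset.univ.image fun i : Fin k => (FreeGroup.of i)⁻¹))
  choose CC hCC using letters_bound (k := k) e CL
  refine ⟨Wc ∪ WL, ?_⟩
  intro W hW
  let Cg := W.sup CC + W.sup (fun w => CC w⁻¹)
  let M := 2 * (2 * C) + 1
  let j := 2 * d * (2 * (2 * d * (2 * Cg + 1) + M))
  refine ⟨(W.image fun g => g ^ j : Finset _), Finset.finite_toSet _, ?_⟩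
  intro K _ _ Γ _ φ v c T hdet hP hPI hf ⟨g, hgW, hg⟩
  have hlet := hL K Γ φ v c T (hP.mono (Finset.union_subset_right hW))
  have hw : ∀ w, CC w ≤ Cg → ∀ X, nm φ e v (φ w * X) ≤ T ^ Cg * nm φ e v X := by
    intro w hw X
    refine (hCC w K Γ φ v T hP.hT.le (fun i M => hlet _ (by simp) M) (fun i M => ?_) X).trans ?_
    · exact hlet _ (by simp) M
    · gcongr
      · exact hP.hT.le
  have h1 : CC g ≤ Cg := (Finset.le_sup (f := CC) hgW).trans (Nat.le_add_right _ _)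
  have h2 : CC g⁻¹ ≤ Cg := (Finset.le_sup (f := fun w => CC w⁻¹) hgW).trans (Nat.le_add_left _ _)
  obtain ⟨Y, Y', hY, hY', κ, hκ, hden, hnum⟩ := dyn_core hd hP g (hdet g) hg Cg M (hw _ h1) (hw _ h2)
  obtain ⟨a, ha, y, hay, hy1, hy2⟩ := normalize (v := v) hP.ne hY
  obtain ⟨a', ha', y', hay', hy1', hy2'⟩ := normalize (v := v) hP.ne hY'
  let den : Matrix (Fin d) (Fin d) K → Γ := fun X => nm φ e v (lc φ e y * X)
  let num : Matrix (Fin d) (Fin d) K → Γ := fun X => nm φ e v (lc φ e y' * X)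
  have eden : ∀ X, den X = v a * nm φ e v (Y * X) := by
    intro X; simp only [den]; rw [← hay, smul_mul_assoc, nm_smul]
  have enum : ∀ X, num X = v a' * nm φ e v (Y' * X) := by
    intro X; simp only [num]; rw [← hay', smul_mul_assoc, nm_smul]
  have sden : ∀ X (b : K), den (b • X) = v b * den X := by
    intro X b; simp only [den]; rw [mul_smul_comm, nm_smul]
  have snum : ∀ X (b : K), num (b • X) = v b * num X := by
    intro X b; simp only [num]; rw [mul_smul_comm, nm_smul]
  have hden' : ∀ X, den (φ (g ^ j) * X) ≤ κ * den X := by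
    intro X
    rw [eden, eden, mul_left_comm]
    gcongr
    exact hden X
  have hnum' : ∀ X, κ * T ^ (2 * (2 * C) + 1) * num X ≤ num (φ (g ^ j) * X) := by
    intro X
    rw [enum, enum, mul_left_comm]
    gcongr
    exact hnum X
  let A : Set (Matrix (Fin d) (Fin d) K) := {X | den X ≠ 0 ∧ den X ≤ T ^ (2 * C) * num X ∧ num X ≤ T ^ (2 * C) * den X}
  have hAs : ∀ X ∈ A, ∀ c : K, c ≠ 0 → c • X ∈ A := by
    rintro X ⟨h1, h2, h3⟩ b hb
    have hvb : v b ≠ 0 := by simpa using hb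
    refine ⟨?_, ?_, ?_⟩
    · rw [sden]; exact mul_ne_zero hvb h1
    · rw [sden, snum, mul_left_comm]; gcongr
    · rw [sden, snum, mul_left_comm]; gcongr
  refine ⟨g ^ j, by simpa using ⟨g, hgW, rfl⟩, A, hAs, ?_, ?_⟩
  · intro X hX i hi hXi
    have := pingpong (fun X => φ (g ^ j) * X) den num hκ hP.hT (2 * C) hden' hnum' X hX i hi
    have e1 : (fun X => φ (g ^ j) * X)^[i] X = φ ((g ^ j) ^ i) * X := by
      rw [map_pow φ (g ^ j), mul_left_iterate]
    rw [e1] at this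
    exact this hXi
  · intro w
    have hφw : φ w ≠ 0 := by
      intro h
      haveI : Nonempty (Fin d) := ⟨⟨0, hd⟩⟩
      have := hdet w
      rw [h, Matrix.det_zero] at this
      exact zero_ne_one this
    obtain ⟨b, hb, x, hbx, hx1, hx2⟩ := normalize (v := v) hP.ne hφw
    obtain ⟨h, hh, ⟨k1, k2⟩, k3, k4⟩ := hC K Γ φ v c T (hP.mono (Finset.union_subset_left hW)) hPI hf x y y' hx1 hy1 hy1' hx2 hy2 hy2'
    refine ⟨h, hh, ?_⟩
    have hmem : φ h * lc φ e x ∈ A := by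
      rw [mul_assoc] at k1 k2 k3 k4
      change 1 ≤ T ^ C * den (φ h * lc φ e x) at k1
      change 1 ≤ T ^ C * num (φ h * lc φ e x) at k2
      change den (φ h * lc φ e x) ≤ T ^ C at k3
      change num (φ h * lc φ e x) ≤ T ^ C at k4
      refine ⟨?_, ?_, ?_⟩
      · intro h0
        rw [h0, mul_zero] at k1
        exact absurd k1 (not_le.2 zero_lt_one)
      · calc _ ≤ T ^ C * 1 := by rw [mul_one]; exact k3
          _ ≤ T ^ C * (T ^ C * num (φ h * lc φ e x)) := by gcongr
          _ = _ := by rw [two_mul, pow_add, mul_assoc]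
      · calc _ ≤ T ^ C * 1 := by rw [mul_one]; exact k4
          _ ≤ T ^ C * (T ^ C * den (φ h * lc φ e x)) := by gcongr
          _ = _ := by rw [two_mul, pow_add, mul_assoc]
    have e2 := hAs _ hmem b⁻¹ (inv_ne_zero hb)
    rwa [← hbx, mul_smul_comm, smul_smul, inv_mul_cancel₀ hb, one_smul] at e2
end CG

namespace CG
section
variable {k d : ℕ} (e : Fin d × Fin d → FreeGroup (Fin k))

noncomputable def tY (s : (Fin d × Fin d) → Vr d) (h : FreeGroup (Fin k)) (μ : Fin d × Fin d) : MvPolynomial (Vr d) (TP k) :=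
  ∑ j, ∑ i, MvPolynomial.C (MvPolynomial.X (e j * h * e i * e μ)) * (MvPolynomial.X (s j) * MvPolynomial.X (Sum.inl i))

lemma eval_tY {K : Type*} [CommRing K] (φ : FreeGroup (Fin k) →* Matrix (Fin d) (Fin d) K) (s : (Fin d × Fin d) → Vr d)
    (h : FreeGroup (Fin k)) (μ : Fin d × Fin d) (z : Vr d → K) :
    MvPolynomial.eval₂ (ev φ) z (tY e s h μ) =
      (lc φ e (fun j => z (s j)) * φ h * lc φ e (fun i => z (Sum.inl i)) * φ (e μ)).trace := by
  simp only [tY, MvPolynomial.eval₂_sum, MvPolynomial.eval₂_mul, MvPolynomial.eval₂_C, MvPolynomial.eval₂_X, ev_X, lc,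
    Finset.sum_mul, Finset.mul_sum, Matrix.trace_sum]
  rw [Finset.sum_comm]
  refine Finset.sum_congr rfl fun i _ => Finset.sum_congr rfl fun j _ => ?_
  simp only [smul_mul_assoc, mul_smul_comm, Matrix.trace_smul, smul_eq_mul, map_mul]
  ring

noncomputable def FP (t : FreeGroup (Fin k) × ((Fin d × Fin d) × (Fin d × Fin d))) : MvPolynomial (Vr d) (TP k) :=
  tY e (fun j => Sum.inr (Sum.inl j)) t.1 t.2.1 * tY e (fun j => Sum.inr (Sum.inr j)) t.1 t.2.2

noncomputable def qm (t : (Fin d × Fin d) × (Fin d × Fin d) × (Fin d × Fin d)) : MvPolynomial (Vr d) (TP k) :=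
  MvPolynomial.X (Sum.inl t.1) * MvPolynomial.X (Sum.inr (Sum.inl t.2.1)) * MvPolynomial.X (Sum.inr (Sum.inr t.2.2))

lemma den_clear {L : Type} [Field L] (r : TP k →+* L) {σ : Type} (G : MvPolynomial σ (Subfield.closure (r.range : Set L))) :
    ∃ f : TP k, r f ≠ 0 ∧ ∃ G' : MvPolynomial σ (TP k),
      MvPolynomial.map r G' = MvPolynomial.C (r f) * MvPolynomial.map (Subfield.subtype _) G := by
  induction G using MvPolynomial.induction_on with
  | C a =>
    obtain ⟨a, ha⟩ := a
    have ha' := ha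
    rw [Subfield.mem_closure_iff] at ha'
    obtain ⟨y, hy, z, hz, rfl⟩ := ha'
    rw [Subring.closure_eq] at hy hz
    obtain ⟨y, rfl⟩ := hy
    obtain ⟨z, rfl⟩ := hz
    by_cases h0 : r z = 0
    · refine ⟨1, by simp, 0, ?_⟩
      rw [MvPolynomial.map_C, Subfield.coe_subtype]
      simp only [h0, div_zero, map_zero, mul_zero]
    · refine ⟨z, h0, MvPolynomial.C y, ?_⟩
      rw [MvPolynomial.map_C, MvPolynomial.map_C, ← MvPolynomial.C_mul]
      congr 1
      simp only [Subfield.coe_subtype]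
      field_simp
  | add p q hp hq =>
    obtain ⟨f, hf, p', hp'⟩ := hp
    obtain ⟨g, hg, q', hq'⟩ := hq
    refine ⟨f * g, by rw [map_mul]; exact mul_ne_zero hf hg, MvPolynomial.C g * p' + MvPolynomial.C f * q', ?_⟩
    simp only [map_add, map_mul, hp', hq', MvPolynomial.map_C]
    ring
  | mul_X p i hp =>
    obtain ⟨f, hf, p', hp'⟩ := hp
    refine ⟨f, hf, p' * MvPolynomial.X i, ?_⟩
    simp only [map_mul, hp', MvPolynomial.map_X]
    ring

lemma clear_ideal {L : Type} [Field L] [IsAlgClosed L] (r : TP k →+* L) {σ ι : Type} [Finite σ] (F : ι → MvPolynomial σ (TP k))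
    (q : MvPolynomial σ (TP k)) (hq : ∀ x : σ → L, (∀ i, MvPolynomial.eval₂ r x (F i) = 0) → MvPolynomial.eval₂ r x q = 0) :
    ∃ f : TP k, r f ≠ 0 ∧ ∃ m : ℕ, MvPolynomial.C f * q ^ m ∈ Ideal.span (Set.range F) ⊔ RingHom.ker (MvPolynomial.map (σ := σ) r) := by
  let k0 := Subfield.closure (r.range : Set L)
  let r0 : TP k →+* k0 := r.codRestrict k0 (fun x => Subfield.subset_closure ⟨x, rfl⟩)
  have hr0 : (Subfield.subtype k0).comp r0 = r := by ext <;> rfl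
  let I : Ideal (MvPolynomial σ k0) := Ideal.span (Set.range fun i => MvPolynomial.map r0 (F i))
  have hrad : MvPolynomial.map r0 q ∈ I.radical := by
    rw [← MvPolynomial.vanishingIdeal_zeroLocus_eq_radical (K := L), MvPolynomial.mem_vanishingIdeal_iff]
    intro x hx
    have key : ∀ p : MvPolynomial σ (TP k), MvPolynomial.aeval x (MvPolynomial.map r0 p) = MvPolynomial.eval₂ r x p := by
      intro p
      rw [MvPolynomial.aeval_def, MvPolynomial.eval₂_map]
      congr 1
    rw [key]
    apply hq
    intro i
    rw [← key]
    exact hx _ (Ideal.subset_span ⟨i, rfl⟩)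
  obtain ⟨m, hm⟩ := hrad
  have hspan : ∀ P ∈ I, ∃ f : TP k, r f ≠ 0 ∧ ∃ P' ∈ Ideal.span (Set.range F),
      MvPolynomial.map r P' = MvPolynomial.C (r f) * MvPolynomial.map (Subfield.subtype _) P := by
    intro P hP
    induction hP using Submodule.span_induction with
    | mem x hx =>
      obtain ⟨i, rfl⟩ := hx
      refine ⟨1, by simp, F i, Ideal.subset_span ⟨i, rfl⟩, ?_⟩
      simp only [MvPolynomial.map_map, hr0]; simp
    | zero => exact ⟨1, by simp, 0, zero_mem _, by simp⟩
    | add p q _ _ hp hq =>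
      obtain ⟨f, hf, p', hp1, hp'⟩ := hp
      obtain ⟨g, hg, q', hq1, hq'⟩ := hq
      refine ⟨f * g, by rw [map_mul]; exact mul_ne_zero hf hg, MvPolynomial.C g * p' + MvPolynomial.C f * q',
        add_mem (Ideal.mul_mem_left _ _ hp1) (Ideal.mul_mem_left _ _ hq1), ?_⟩
      simp only [map_add, map_mul, hp', hq', MvPolynomial.map_C]
      ring
    | smul a p _ hp =>
      obtain ⟨f, hf, p', hp1, hp'⟩ := hp
      obtain ⟨g, hg, a', ha'⟩ := den_clear r a
      refine ⟨g * f, by rw [map_mul]; exact mul_ne_zero hg hf, a' * p', Ideal.mul_mem_left _ _ hp1, ?_⟩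
      simp only [smul_eq_mul, map_mul, hp', ha']
      ring
  obtain ⟨f, hf, P', hP', e⟩ := hspan _ hm
  refine ⟨f, hf, m, ?_⟩
  rw [show MvPolynomial.C f * q ^ m = P' + (MvPolynomial.C f * q ^ m - P') by ring]
  refine add_mem (Ideal.mem_sup_left hP') (Ideal.mem_sup_right ?_)
  rw [RingHom.mem_ker, map_sub, e, map_mul, map_pow, MvPolynomial.map_C, map_pow, MvPolynomial.map_map, hr0, sub_self]

lemma clear_fam {L : Type} [Field L] [IsAlgClosed L] (r : TP k →+* L) {σ ι τ : Type} [Finite σ] [Fintype τ] (F : ι → MvPolynomial σ (TP k))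
    (q : τ → MvPolynomial σ (TP k)) (hq : ∀ t, ∀ x : σ → L, (∀ i, MvPolynomial.eval₂ r x (F i) = 0) → MvPolynomial.eval₂ r x (q t) = 0) :
    ∃ f : TP k, r f ≠ 0 ∧ ∃ m : ℕ, ∀ t, MvPolynomial.C f * q t ^ m ∈ Ideal.span (Set.range F) ⊔ RingHom.ker (MvPolynomial.map (σ := σ) r) := by
  classical
  choose f hf m hm using fun t => clear_ideal r F (q t) (hq t)
  refine ⟨∏ t, f t, by rw [map_prod]; exact Finset.prod_ne_zero_iff.2 fun t _ => hf t, ∑ t, m t, fun t => ?_⟩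
  refine Ideal.mem_of_dvd _ (mul_dvd_mul ?_ ?_) (hm t)
  · exact map_dvd _ (Finset.dvd_prod_of_mem _ (Finset.mem_univ t))
  · exact pow_dvd_pow _ (Finset.single_le_sum (f := m) (fun _ _ => Nat.zero_le _) (Finset.mem_univ t))

lemma exists_PIf {A : Type} [CommRing A] (Φ : FreeGroup (Fin k) →* Matrix (Fin d) (Fin d) A)
    {L : Type} [Field L] [IsAlgClosed L] (ι : A →+* L) (hι : Function.Injective ι) (hSI : SI (mapφ ι Φ))
    (he : ev Φ (Dp e) ≠ 0) : ∃ H fP m Gc, ev Φ fP ≠ 0 ∧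
      ∀ (K : Type) [Field K] (ψ : A →+* K), PIf e H fP m Gc (mapφ ψ Φ) := by
  classical
  have hev : ∀ q, ev (mapφ ι Φ) q = ι (ev Φ q) := ev_map ι Φ
  have hD : ev (mapφ ι Φ) (Dp e) ≠ 0 := by rw [hev]; simpa using (map_ne_zero_iff ι hι).2 he
  have hzero : ∀ x : Fin d × Fin d → L, lc (mapφ ι Φ) e x = 0 → ∀ i, x i = 0 := by
    intro x hx i
    rw [← co_sum hD x i]
    unfold lc at hx
    rw [hx]; simp [co]
  have hnd : ∀ M : Matrix (Fin d) (Fin d) L, (∀ i, (M * mapφ ι Φ (e i)).trace = 0) → M = 0 := by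
    intro M hM
    rw [eq_co hD M]
    refine Finset.sum_eq_zero fun i _ => ?_
    simp [co, hM]
  obtain ⟨fP, hfP, m, hm⟩ := clear_fam (ev (mapφ ι Φ)) (FP e) (qm (d := d) (k := k)) (by
    intro t z hz
    have hall := G2 hSI (X := lc (mapφ ι Φ) e (fun i => z (Sum.inl i))) (Y := lc (mapφ ι Φ) e (fun i => z (Sum.inr (Sum.inl i))))
      (Y' := lc (mapφ ι Φ) e (fun i => z (Sum.inr (Sum.inr i)))) (by
        intro h
        by_contra hcon
        push Not at hcon
        have hnd' : ∀ M : Matrix (Fin d) (Fin d) L, M ≠ 0 → ∃ i, (M * mapφ ι Φ (e i)).trace ≠ 0 := by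
          intro M hM
          by_contra hc
          push Not at hc
          exact hM (hnd _ hc)
        obtain ⟨μ, hμ⟩ := hnd' _ hcon.1
        obtain ⟨ν, hν⟩ := hnd' _ hcon.2
        have := hz (h, μ, ν)
        rw [FP, MvPolynomial.eval₂_mul, eval_tY, eval_tY] at this
        rcases mul_eq_zero.1 this with h | h
        · exact hμ h
        · exact hν h)
    simp only [qm, MvPolynomial.eval₂_mul, MvPolynomial.eval₂_X]
    rcases hall with h | h | h
    · rw [hzero _ h t.1]; simp
    · rw [hzero _ h t.2.1]; simp
    · rw [hzero _ h t.2.2]; simp)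
  have h2 : ∀ t, ∃ c : (FreeGroup (Fin k) × ((Fin d × Fin d) × (Fin d × Fin d))) →₀ MvPolynomial (Vr d) (TP k),
      MvPolynomial.map (ev (mapφ ι Φ)) (MvPolynomial.C fP * qm t ^ m) =
      MvPolynomial.map (ev (mapφ ι Φ)) (c.sum fun i a => a * FP e i) := by
    intro t
    obtain ⟨P, hP, Z, hZ, e1⟩ := Submodule.mem_sup.1 (hm t)
    obtain ⟨c, hc⟩ := Finsupp.mem_ideal_span_range_iff_exists_finsupp.1 hP
    refine ⟨c, ?_⟩
    rw [← e1, map_add, (RingHom.mem_ker).1 hZ, add_zero, hc]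
  choose c hc using h2
  refine ⟨(Finset.univ.sup fun t => (c t).support).image Prod.fst, fP, m, fun i j l h μ ν => c (i, j, l) (h, μ, ν), ?_, ?_⟩
  · intro h0
    rw [hev, h0, map_zero] at hfP
    exact hfP rfl
  · intro K _ ψ i j l x y y'
    set H := (Finset.univ.sup fun t => (c t).support).image Prod.fst with hH
    have e1 : MvPolynomial.map (ev Φ) (MvPolynomial.C fP * qm (i, j, l) ^ m) =
      MvPolynomial.map (ev Φ) ((c (i, j, l)).sum fun i a => a * FP e i) := by
      apply MvPolynomial.map_injective ι hι
      rw [MvPolynomial.map_map, MvPolynomial.map_map]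
      have : ι.comp (ev Φ) = ev (mapφ ι Φ) := by ext q; simp [hev]; simp [hev]
      rw [this]
      exact hc (i, j, l)
    have e2 := congrArg (MvPolynomial.eval₂ ψ (Sum.elim x (Sum.elim y y'))) e1
    rw [MvPolynomial.eval₂_map, MvPolynomial.eval₂_map] at e2
    have : ψ.comp (ev Φ) = ev (mapφ ψ Φ) := by
      apply RingHom.ext; intro q; rw [RingHom.comp_apply, ev_map]
    rw [this] at e2
    have e3 : (c (i, j, l)).sum (fun i a => a * FP e i) =
      ∑ s ∈ H ×ˢ Finset.univ, c (i, j, l) s * FP e s := by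
      rw [Finsupp.sum]
      apply Finset.sum_subset
      · intro s hs
        rw [Finset.mem_product]
        refine ⟨?_, Finset.mem_univ _⟩
        rw [hH, Finset.mem_image]
        exact ⟨s, Finset.le_sup (f := fun t => (c t).support) (Finset.mem_univ (i, j, l)) hs, rfl⟩
      · intro s _ hs
        rw [Finsupp.notMem_support_iff.1 hs, zero_mul]
    rw [e3, Finset.sum_product, MvPolynomial.eval₂_sum] at e2
    simp only [MvPolynomial.eval₂_sum, MvPolynomial.eval₂_mul, MvPolynomial.eval₂_pow, MvPolynomial.eval₂_C, qm,
      MvPolynomial.eval₂_X, FP, eval_tY, Sum.elim_inl, Sum.elim_inr] at e2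
    exact e2
end
end CG

namespace CG
open scoped commutatorElement

section
variable {G : Type} [Group G] {Γ : Type} [LinearOrderedCommGroupWithZero Γ]

def Hmu (T : Γ) (C : ℕ) (μ : G → Γ) (W : Finset G) : Prop :=
  (∀ x ∈ W, ∀ y ∈ W, ∀ z ∈ W, μ ⁅x, z * y * z⁻¹⁆ ≤ T ^ C * (μ x * μ y)) ∧ ∀ x ∈ W, μ x ≤ T ^ C

lemma Hmu.mono {T : Γ} {C : ℕ} {μ : G → Γ} {W W' : Finset G} (h : Hmu T C μ W) (hW : W' ⊆ W) : Hmu T C μ W' :=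
  ⟨fun x hx y hy z hz => h.1 x (hW hx) y (hW hy) z (hW hz), fun x hx => h.2 x (hW hx)⟩

lemma comm_mem (S : G → Prop) (N : Subgroup G) (hN : N.Normal)
    (hpr : ∀ u ∈ N, ∀ v ∈ N, ¬ S u → ¬ S v → ∃ z, ¬ S ⁅u, z * v * z⁻¹⁆)
    {u v z : G} (hu : u ∈ N) (hv : v ∈ N) : ⁅u, z * v * z⁻¹⁆ ∈ N := by
  rw [commutatorElement_def]
  have h := hN.conj_mem v hv z
  exact N.mul_mem (N.mul_mem (N.mul_mem hu h) (N.inv_mem hu)) (N.inv_mem h)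

lemma iter_word (S : G → Prop) (N : Subgroup G) (hN : N.Normal)
    (hpr : ∀ u ∈ N, ∀ v ∈ N, ¬ S u → ¬ S v → ∃ z, ¬ S ⁅u, z * v * z⁻¹⁆)
    (T : Γ) (hT : 1 ≤ T) (C : ℕ) (u : G) (hu : u ∈ N) (hS : ¬ S u) (s : ℕ) :
    ∃ w ∈ N, ¬ S w ∧ ∃ W : Finset G, ∀ μ : G → Γ, Hmu T C μ W → T ^ (C + 1) * μ u ≤ 1 → T ^ (C + 1 + s) * μ w ≤ 1 := by
  classical
  induction s with
  | zero => exact ⟨u, hu, hS, ∅, fun μ _ h => h⟩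
  | succ s ih =>
    obtain ⟨w, hw, hSw, W, h⟩ := ih
    obtain ⟨z, hz⟩ := hpr w hw w hw hSw hSw
    refine ⟨_, comm_mem S N hN hpr hw hw, hz, W ∪ {w, z}, ?_⟩
    intro μ hμ hu
    have h1 := h μ (hμ.mono Finset.subset_union_left) hu
    have h2 := hμ.1 w (by simp) w (by simp) z (by simp)
    calc T ^ (C + 1 + (s + 1)) * μ ⁅w, z * w * z⁻¹⁆ ≤ T ^ (C + 1 + (s + 1)) * (T ^ C * (μ w * μ w)) := by gcongr
      _ = T ^ (C + 1 + (s + 1) + C) * (μ w * μ w) := by rw [pow_add _ (C + 1 + (s + 1)) C, mul_assoc]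
      _ ≤ T ^ (C + 1 + s + (C + 1 + s)) * (μ w * μ w) := mul_le_mul_left (pow_le_pow_right₀ hT (by omega)) _
      _ = (T ^ (C + 1 + s) * μ w) * (T ^ (C + 1 + s) * μ w) := by rw [pow_add]; simp only [mul_assoc, mul_left_comm]
      _ ≤ 1 * 1 := by gcongr
      _ = 1 := mul_one 1

lemma list_word (S : G → Prop) (N : Subgroup G) (hN : N.Normal)
    (hpr : ∀ u ∈ N, ∀ v ∈ N, ¬ S u → ¬ S v → ∃ z, ¬ S ⁅u, z * v * z⁻¹⁆)
    (T : Γ) (hT : 1 ≤ T) (C : ℕ) (l : List G) (hl : ∀ u ∈ l, u ∈ N ∧ ¬ S u) (hne : l ≠ []) : ∀ s : ℕ,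
    ∃ w ∈ N, ¬ S w ∧ ∃ W : Finset G, ∀ μ : G → Γ, Hmu T C μ W → (∃ u ∈ l, T ^ (C + 1) * μ u ≤ 1) → T ^ s * μ w ≤ 1 := by
  classical
  induction l with
  | nil => exact absurd rfl hne
  | cons u l ih =>
    intro s
    have h0 : ∀ s, ∃ w ∈ N, ¬ S w ∧ ∃ W : Finset G, ∀ μ : G → Γ, Hmu T C μ W → T ^ (C + 1) * μ u ≤ 1 → T ^ s * μ w ≤ 1 := by
      intro s
      obtain ⟨w, h1, h2, W, h3⟩ := iter_word S N hN hpr T hT C u (hl u (by simp)).1 (hl u (by simp)).2 s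
      refine ⟨w, h1, h2, W, fun μ hμ hu => (h3 μ hμ hu).trans' ?_⟩
      exact mul_le_mul_left (pow_le_pow_right₀ hT (by omega)) _
    by_cases hl0 : l = []
    · subst hl0
      obtain ⟨w, h1, h2, W, h3⟩ := h0 s
      exact ⟨w, h1, h2, W, fun μ hμ hu => h3 μ hμ (by simpa using hu)⟩
    obtain ⟨w1, a1, a2, W1, a3⟩ := h0 (s + (C + C))
    obtain ⟨w2, b1, b2, W2, b3⟩ := ih (fun u hu => hl u (List.mem_cons_of_mem _ hu)) hl0 (s + (C + C))
    obtain ⟨z, hz⟩ := hpr w1 a1 w2 b1 a2 b2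
    refine ⟨_, comm_mem S N hN hpr a1 b1, hz, (W1 ∪ W2) ∪ {w1, w2, z}, ?_⟩
    intro μ hμ hu
    have c1 := hμ.1 w1 (by simp) w2 (by simp) z (by simp)
    have c2 : μ w1 ≤ T ^ C := hμ.2 w1 (by simp)
    have c3 : μ w2 ≤ T ^ C := hμ.2 w2 (by simp)
    have hor : T ^ (s + (C + C)) * μ w1 ≤ 1 ∨ T ^ (s + (C + C)) * μ w2 ≤ 1 := by
      obtain ⟨u', hu', h⟩ := hu
      rcases List.mem_cons.1 hu' with rfl | hu'
      · exact Or.inl (a3 μ (hμ.mono (by intro x hx; simp [hx])) h)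
      · exact Or.inr (b3 μ (hμ.mono (by intro x hx; simp [hx])) ⟨u', hu', h⟩)
    rcases hor with h | h
    · calc T ^ s * μ ⁅w1, z * w2 * z⁻¹⁆ ≤ T ^ s * (T ^ C * (μ w1 * T ^ C)) := by
            gcongr; exact c1.trans (by gcongr)
        _ = T ^ (s + (C + C)) * μ w1 := by rw [pow_add, pow_add]; simp only [mul_assoc, mul_comm, mul_left_comm]
        _ ≤ 1 := h
    · calc T ^ s * μ ⁅w1, z * w2 * z⁻¹⁆ ≤ T ^ s * (T ^ C * (T ^ C * μ w2)) := by
            gcongr; exact c1.trans (by gcongr)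
        _ = T ^ (s + (C + C)) * μ w2 := by rw [pow_add, pow_add]; simp only [mul_assoc, mul_comm, mul_left_comm]
        _ ≤ 1 := h
end

lemma pigeon (I : Type) [Fintype I] (B r : ℝ) (hr : 0 < r) : ∃ n : ℕ, ∀ p : Fin n → (I → ℂ), (∀ i, ‖p i‖ ≤ B) →
    ∃ i j, i ≠ j ∧ ‖p i - p j‖ ≤ r := by
  classical
  obtain ⟨t, -, ht, hcov⟩ := (isCompact_closedBall (0 : I → ℂ) B).finite_cover_balls (half_pos hr)
  haveI := ht.to_subtype
  haveI := Fintype.ofFinite t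
  refine ⟨Fintype.card t + 1, fun p hp => ?_⟩
  have : ∀ i, ∃ c : t, p i ∈ Metric.ball (c : I → ℂ) (r / 2) := by
    intro i
    have := hcov (show p i ∈ Metric.closedBall 0 B by simpa using hp i)
    simp only [Set.mem_iUnion] at this
    obtain ⟨c, hc, h⟩ := this
    exact ⟨⟨c, hc⟩, h⟩
  choose c hc using this
  obtain ⟨i, j, hij, h⟩ := Fintype.exists_ne_map_eq_of_card_lt c (by simp)
  refine ⟨i, j, hij, ?_⟩
  have h1 := hc i
  have h2 := hc j
  rw [← h] at h2
  rw [Metric.mem_ball] at h1 h2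
  rw [← dist_eq_norm]
  have := dist_triangle_right (p i) (p j) (c i)
  linarith

lemma nm_mul {k d : ℕ} (e : Fin d × Fin d → FreeGroup (Fin k)) (C0 : ℕ) : ∃ C : ℕ, ∃ W : Finset (FreeGroup (Fin k)),
    ∀ (K : Type) [Field K] (Γ : Type) [LinearOrderedCommGroupWithZero Γ]
      (φ : FreeGroup (Fin k) →* Matrix (Fin d) (Fin d) K) (v : K →*₀ Γ) (c T : Γ),
      PD e C0 φ v c T W → ∀ X Y, nm φ e v (X * Y) ≤ T ^ C * (nm φ e v X * nm φ e v Y) := by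
  classical
  obtain ⟨C1, W1, h1⟩ := co_bound e C0
  obtain ⟨C2, W2, h2⟩ := word_bound_fin e C0 (Finset.univ.image e)
  refine ⟨(Finset.univ : Finset (Fin d × Fin d)).card + (C1 + C2), W1 ∪ W2, ?_⟩
  intro K _ Γ _ φ v c T hP X Y
  have k1 := h1 K Γ φ v c T (hP.mono Finset.subset_union_left) X
  have k2 := h2 K Γ φ v c T (hP.mono Finset.subset_union_right)
  rw [nm_le]
  intro i
  have : X * Y * φ (e i) = ∑ j, co φ e j X • (φ (e j) * Y * φ (e i)) := by
    conv_lhs => rw [eq_co hP.ne X, Finset.sum_mul, Finset.sum_mul]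
    simp only [smul_mul_assoc]
  rw [this, Matrix.trace_sum]
  refine (hP.toPL.sum _ _ (M := T ^ C1 * nm φ e v X * (T ^ C2 * nm φ e v Y)) ?_).trans ?_
  · intro j _
    rw [Matrix.trace_smul, smul_eq_mul, map_mul]
    gcongr
    · exact k1 j
    · exact (le_nm _ i).trans (k2 (e j) (by simp) Y)
  · rw [pow_add, pow_add]
    apply le_of_eq
    simp only [mul_assoc, mul_comm, mul_left_comm]
end CG

namespace CG
open scoped commutatorElement NNReal

lemma nm_neg {k d : ℕ} {K : Type} [Field K] {Γ : Type} [LinearOrderedCommGroupWithZero Γ]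
    {φ : FreeGroup (Fin k) →* Matrix (Fin d) (Fin d) K} {e : Fin d × Fin d → FreeGroup (Fin k)} {v : K →*₀ Γ}
    (X : Matrix (Fin d) (Fin d) K) : nm φ e v (-X) = nm φ e v X := by
  rw [← neg_one_smul K X, nm_smul, v_neg_one, one_mul]

lemma nm_sub {k d : ℕ} {K : Type} [Field K] {Γ : Type} [LinearOrderedCommGroupWithZero Γ]
    {φ : FreeGroup (Fin k) →* Matrix (Fin d) (Fin d) K} {e : Fin d × Fin d → FreeGroup (Fin k)} {v : K →*₀ Γ} {c : Γ} (h : QA v c)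
    (X Y : Matrix (Fin d) (Fin d) K) : nm φ e v (X - Y) ≤ c * max (nm φ e v X) (nm φ e v Y) := by
  rw [sub_eq_add_neg, ← nm_neg Y]
  exact nm_add h _ _

section
variable {k d : ℕ} {K : Type} [Field K] {Γ : Type} [LinearOrderedCommGroupWithZero Γ]
    {φ : FreeGroup (Fin k) →* Matrix (Fin d) (Fin d) K} {e : Fin d × Fin d → FreeGroup (Fin k)} {v : K →*₀ Γ} {c T : Γ}

lemma mu_comm (hqa : QA v c) (hcT : c ≤ T) (Cm : ℕ)
    (hm : ∀ X Y, nm φ e v (X * Y) ≤ T ^ Cm * (nm φ e v X * nm φ e v Y)) (x y z : FreeGroup (Fin k))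
    (hx' : nm φ e v (φ x⁻¹) ≤ T) (hy' : nm φ e v (φ y⁻¹) ≤ T)
    (hz : nm φ e v (φ z) ≤ T) (hz' : nm φ e v (φ z⁻¹) ≤ T) :
    nm φ e v (φ ⁅x, z * y * z⁻¹⁆ - 1) ≤ T ^ (7 * Cm + 7) * (nm φ e v (φ x - 1) * nm φ e v (φ y - 1)) := by
  set X := φ x - 1 with hX
  set Y := φ y - 1 with hY
  set N := nm φ e v
  set Y' := φ z * (Y * φ z⁻¹) with hY'
  have hi : ∀ x, φ x * φ x⁻¹ = 1 := fun x => by rw [← map_mul, mul_inv_cancel, map_one]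
  have e1 : φ ⁅x, z * y * z⁻¹⁆ - 1 = (X * Y' - Y' * X) * (φ x⁻¹ * (φ z * (φ y⁻¹ * φ z⁻¹))) := by
    have hz1 : φ (z * y * z⁻¹) = Y' + 1 := by
      rw [hY', hY, map_mul, map_mul, sub_mul, mul_sub, one_mul, hi, mul_assoc]; simp
    have hz2 : φ (z * y * z⁻¹)⁻¹ = φ z * (φ y⁻¹ * φ z⁻¹) := by
      rw [← map_mul, ← map_mul]; congr 1; group
    have hx1 : φ x = X + 1 := by rw [hX]; simp
    have h1 : X * Y' - Y' * X = φ x * φ (z * y * z⁻¹) - φ (z * y * z⁻¹) * φ x := by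
      rw [hz1, hx1]; noncomm_ring
    rw [h1, ← hz2, sub_mul, commutatorElement_def]
    have h2 : φ (z * y * z⁻¹) * φ x * (φ x⁻¹ * φ (z * y * z⁻¹)⁻¹) = 1 := by
      rw [← map_mul, ← map_mul, ← map_mul]; rw [show (z * y * z⁻¹) * x * (x⁻¹ * (z * y * z⁻¹)⁻¹) = 1 by group, map_one]
    rw [h2]
    congr 1
    rw [← map_mul, ← map_mul, ← map_mul]
    congr 1
    simp only [mul_assoc]
  rw [e1]
  have b1 : N Y' ≤ T ^ (2 * Cm + 2) * N Y := by
    calc N Y' ≤ T ^ Cm * (T * (T ^ Cm * (N Y * T))) := by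
          refine (hm _ _).trans ?_
          gcongr
          refine (hm _ _).trans ?_
          gcongr
      _ = _ := by rw [show 2 * Cm + 2 = Cm + Cm + 1 + 1 by ring, pow_succ, pow_succ, pow_add]; simp only [mul_assoc, mul_comm, mul_left_comm]
  have b2 : N (X * Y' - Y' * X) ≤ T * (T ^ Cm * (N X * (T ^ (2 * Cm + 2) * N Y))) := by
    refine (nm_sub hqa _ _).trans ?_
    gcongr
    refine max_le ((hm _ _).trans (by gcongr)) ((hm _ _).trans ?_)
    rw [mul_comm (nm φ e v Y')]
    gcongr
  have b3 : N (φ x⁻¹ * (φ z * (φ y⁻¹ * φ z⁻¹))) ≤ T ^ Cm * (T * (T ^ Cm * (T * (T ^ Cm * (T * T))))) := by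
    refine (hm _ _).trans ?_
    gcongr
    refine (hm _ _).trans ?_
    gcongr
    refine (hm _ _).trans ?_
    gcongr
  refine (hm _ _).trans ?_
  calc T ^ Cm * (N (X * Y' - Y' * X) * N (φ x⁻¹ * (φ z * (φ y⁻¹ * φ z⁻¹)))) ≤
      T ^ Cm * ((T * (T ^ Cm * (N X * (T ^ (2 * Cm + 2) * N Y)))) * (T ^ Cm * (T * (T ^ Cm * (T * (T ^ Cm * (T * T))))))) := by gcongr
    _ = _ := by
      rw [show 7 * Cm + 7 = Cm + (Cm + (Cm + (Cm + (Cm + (2 * Cm + 2 + (1 + (1 + (1 + (1 + 1))))))))) by ring]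
      simp only [pow_add, pow_one]
      simp only [mul_assoc, mul_comm, mul_left_comm]
end

lemma arch_law {k d : ℕ} (hd : 2 ≤ d) {L : Type} [Field L] [IsAlgClosed L] (Φ : FreeGroup (Fin k) →* Matrix (Fin d) (Fin d) L)
    (hSI : SI Φ) (hdet : ∀ w, (Φ w).det = 1) (e : Fin d × Fin d → FreeGroup (Fin k)) (he : ev Φ (Dp e) ≠ 0) (fP : TP k) :
    ∃ f2 : TP k, ev Φ f2 ≠ 0 ∧ ∃ W1 : Finset (FreeGroup (Fin k)), ∀ φ : FreeGroup (Fin k) →* Matrix (Fin d) (Fin d) ℂ,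
      1 ≤ ‖ev φ (Dp e * fP * f2)‖ → ∃ w ∈ W1, 2 ^ (8 * d ^ 2) < ‖(φ w).trace‖ := by
  classical
  obtain ⟨N, hN, hNs, hpr⟩ := Prime hSI hd hdet
  obtain ⟨CD, WD, hCD⟩ := tp_bound d (Dp e)
  obtain ⟨CP, WP, hCP⟩ := tp_bound d fP
  obtain ⟨Cm, Wm, hCm⟩ := nm_mul e (CP + 2)
  let T : ℝ≥0 := 2 ^ (8 * d ^ 2)
  have h8 : 1 ≤ 8 * d ^ 2 := by nlinarith
  have h2T : 2 ≤ T := le_self_pow₀ (by norm_num) (by omega)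
  have hT1 : 1 < T := lt_of_lt_of_le (by norm_num) h2T
  let C := 7 * Cm + 7
  let r0 : ℝ≥0 := (T ^ (C + 1 + (Cm + 1)))⁻¹
  have hr0 : 0 < r0 := by positivity
  obtain ⟨n, hn⟩ := pigeon (Fin d × Fin d) T r0 hr0
  obtain ⟨g, hgN, hg⟩ := Infin hSI (by omega) hdet N hNs n
  let l : List (FreeGroup (Fin k)) := ((Finset.univ : Finset (Fin n × Fin n)).filter (fun p => p.1 ≠ p.2)).toList.map
    (fun p => (g p.1)⁻¹ * g p.2)
  have hl : ∀ i j, i ≠ j → (g i)⁻¹ * g j ∈ l := by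
    intro i j hij
    simp only [l, List.mem_map, Finset.mem_toList, Finset.mem_filter, Finset.mem_univ, true_and]
    exact ⟨(i, j), hij, rfl⟩
  have hl' : ∀ u ∈ l, u ∈ N ∧ ¬ Scal L (Φ u) := by
    intro u hu
    simp only [l, List.mem_map, Finset.mem_toList, Finset.mem_filter, Finset.mem_univ, true_and] at hu
    obtain ⟨p, hp, rfl⟩ := hu
    exact ⟨N.mul_mem (N.inv_mem (hgN _)) (hgN _), hg _ _ hp⟩
  have hlne : l ≠ [] := by
    obtain ⟨i, j, hij, -⟩ := hn (fun _ => 0) (by simp)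
    exact List.ne_nil_of_mem (hl i j hij)
  obtain ⟨w, hwN, hws, W2, hw⟩ := list_word (fun u => Scal L (Φ u)) N hN hpr T hT1.le C l hl' hlne (CP + CD + 1)
  have hw1 : Φ w ≠ 1 := by
    intro h
    exact hws ⟨1, by simp [h]⟩
  obtain ⟨i0, hi0⟩ : ∃ i0, ((Φ w - 1) * Φ (e i0)).trace ≠ 0 := by
    by_contra hc
    push Not at hc
    apply hw1
    rw [← sub_eq_zero, eq_co he (Φ w - 1)]
    refine Finset.sum_eq_zero fun i _ => ?_
    simp [co, hc]
  have hf2 : ∀ {R : Type} [CommRing R] (φ : FreeGroup (Fin k) →* Matrix (Fin d) (Fin d) R),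
      ev φ (MvPolynomial.X (w * e i0) - MvPolynomial.X (e i0)) = ((φ w - 1) * φ (e i0)).trace := by
    intro R _ φ
    rw [map_sub, ev_X, ev_X, sub_mul, one_mul, Matrix.trace_sub, map_mul]
  refine ⟨MvPolynomial.X (w * e i0) - MvPolynomial.X (e i0), by rw [hf2]; exact hi0, ?_⟩
  let S : Finset (FreeGroup (Fin k)) := W2 ∪ (Finset.univ.image g) ∪ {1, w}
  let S' : Finset (FreeGroup (Fin k)) := S ∪ S.image (·⁻¹)
  let S'' : Finset (FreeGroup (Fin k)) := (S' ×ˢ Finset.univ).image fun p => p.1 * e p.2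
  refine ⟨Wm ∪ WD ∪ WP ∪ S'', ?_⟩
  intro φ hφ
  by_contra hcon
  push Not at hcon
  let v : ℂ →*₀ ℝ≥0 := nnnormHom
  have hPL : PL φ v 2 T (Wm ∪ WD ∪ WP ∪ S'') := by
    refine ⟨⟨by norm_num, fun x y => ?_⟩, hT1, h2T, le_rfl, fun w hw => ?_⟩
    · refine (nnnorm_add_le x y).trans ?_
      rw [two_mul]
      exact add_le_add (le_max_left _ _) (le_max_right _ _)
    · show ‖(φ w).trace‖₊ ≤ (2:ℝ≥0) ^ (8 * d ^ 2)
      exact NNReal.coe_le_coe.1 (by push_cast; exact hcon w hw)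
  have hnmS' : ∀ s ∈ S', nm φ e v (φ s) ≤ T := by
    intro s hs
    rw [nm_le]
    intro i
    rw [← map_mul]
    apply hPL.tr
    simp only [Finset.mem_union]
    right
    exact Finset.mem_image.2 ⟨(s, i), by simp [hs], rfl⟩
  have hS1 : ∀ s ∈ S, nm φ e v (φ s) ≤ T := fun s hs => hnmS' s (Finset.mem_union_left _ hs)
  have hS2 : ∀ s ∈ S, nm φ e v (φ s⁻¹) ≤ T := fun s hs => hnmS' _ (Finset.mem_union_right _ (Finset.mem_image_of_mem _ hs))
  have hmu : ∀ s ∈ S, nm φ e v (φ s - 1) ≤ T ^ 2 := by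
    intro s hs
    refine (nm_sub hPL.qa _ _).trans ?_
    rw [pow_two]
    gcongr
    refine max_le (hS1 s hs) ?_
    have := hS1 1 (by simp [S])
    rwa [map_one] at this
  have hwS : w ∈ S := by simp [S]
  have hvf2 : v (ev φ (MvPolynomial.X (w * e i0) - MvPolynomial.X (e i0))) ≤ nm φ e v (φ w - 1) := by
    rw [hf2]
    exact le_nm _ i0
  have hvD : v (ev φ (Dp e)) ≤ T ^ CD := hCD ℂ ℝ≥0 φ v 2 T (hPL.mono (by intro x hx; simp [hx]))
  have hvP : v (ev φ fP) ≤ T ^ CP := hCP ℂ ℝ≥0 φ v 2 T (hPL.mono (by intro x hx; simp [hx]))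
  have hφ' : 1 ≤ v (ev φ (Dp e)) * v (ev φ fP) * v (ev φ (MvPolynomial.X (w * e i0) - MvPolynomial.X (e i0))) := by
    rw [← map_mul, ← map_mul, ← map_mul, ← map_mul]
    exact_mod_cast hφ
  have hPD : PD e (CP + 2) φ v 2 T (Wm ∪ WD ∪ WP ∪ S'') := by
    refine ⟨hPL, hφ'.trans ?_⟩
    rw [mul_assoc, mul_comm, pow_add]
    gcongr
    exact hvf2.trans (hmu w hwS)
  have hm := hCm ℂ ℝ≥0 φ v 2 T (hPD.mono (by intro x hx; simp [hx]))
  have hH : Hmu T C (fun x => nm φ e v (φ x - 1)) W2 := by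
    have hsub : ∀ x ∈ W2, x ∈ S := fun x hx => by simp [S, hx]
    refine ⟨fun x hx y hy z hz => mu_comm hPL.qa h2T Cm hm x y z (hS2 _ (hsub x hx)) (hS2 _ (hsub y hy)) (hS1 _ (hsub z hz)) (hS2 _ (hsub z hz)),
      fun x hx => (hmu x (hsub x hx)).trans (pow_le_pow_right₀ hT1.le (by simp only [C]; omega))⟩
  have hfin := hw _ hH (by
    have hgS : ∀ i, g i ∈ S := fun i => by simp [S]
    obtain ⟨i, j, hij, h⟩ := hn (fun i a => (φ (g i) * φ (e a)).trace) (fun i => by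
      refine (pi_norm_le_iff_of_nonneg (NNReal.coe_nonneg T)).2 ?_
      intro a
      have : v (φ (g i) * φ (e a)).trace ≤ T := (le_nm _ a).trans (hS1 _ (hgS i))
      exact NNReal.coe_le_coe.2 this)
    refine ⟨_, hl i j hij, ?_⟩
    have h1 : nm φ e v (φ (g j) - φ (g i)) ≤ r0 := by
      rw [nm_le]
      intro a
      have h2 := (norm_le_pi_norm _ a).trans h
      simp only [Pi.sub_apply] at h2
      rw [norm_sub_rev, ← Matrix.trace_sub, ← sub_mul] at h2
      exact NNReal.coe_le_coe.1 h2
    have h3 : φ ((g i)⁻¹ * g j) - 1 = φ (g i)⁻¹ * (φ (g j) - φ (g i)) := by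
      rw [mul_sub, ← map_mul, ← map_mul, inv_mul_cancel, map_one]
    have hT0 : T ≠ 0 := (zero_lt_one.trans hT1).ne'
    calc T ^ (C + 1) * nm φ e v (φ ((g i)⁻¹ * g j) - 1) ≤ T ^ (C + 1) * (T ^ Cm * (T * r0)) := by
          rw [h3]
          gcongr
          refine (hm _ _).trans ?_
          gcongr
          exact hS2 _ (hgS i)
      _ = T ^ (C + 1 + (Cm + 1)) * r0 := by rw [pow_add T (C + 1), pow_succ T Cm]; ring
      _ ≤ 1 := by rw [mul_inv_cancel₀ (pow_ne_zero _ hT0)])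
  have : T ≤ 1 := by
    calc T = T * 1 := (mul_one _).symm
      _ ≤ T * (T ^ CD * T ^ CP * nm φ e v (φ w - 1)) := by gcongr; exact hφ'.trans (by gcongr)
      _ = T ^ (CP + CD + 1) * nm φ e v (φ w - 1) := by rw [pow_succ, pow_add]; ring
      _ ≤ 1 := hfin
  exact absurd this (not_le.2 hT1)
end CG

namespace CG

lemma val_int {K : Type} [Field K] (x : K) (h : ∀ V : ValuationSubring K, x ∈ V) : IsIntegral ℤ x := by
  have h2 := (iInf_valuationSubring_superset (K := K) (s := ∅))
  have h3 : x ∈ ⨅ V : {V : ValuationSubring K // (∅ : Set K) ⊆ V.toSubring}, V.1.toSubring := by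
    simp only [Subring.mem_iInf]
    intro V
    exact h V.1
  rw [h2] at h3
  have h4 : IsIntegral (Subring.closure (∅ : Set K)) x := h3
  have h5 : Algebra.IsIntegral ℤ (Subring.closure (∅ : Set K)) := by
    constructor
    rintro ⟨y, hy⟩
    obtain ⟨n, rfl⟩ : ∃ n : ℤ, (n : K) = y := by
      rw [Subring.closure_empty] at hy
      exact Subring.mem_bot.1 hy
    exact isIntegral_algebraMap (R := ℤ) (x := n)
  exact isIntegral_trans x h4

lemma val_dich {K : Type} [Field K] (F0 : K) (S : Set K) (hF : F0 ∈ Subring.closure S)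
    (h : ∀ V : ValuationSubring K, F0⁻¹ ∈ V → ∀ t ∈ S, t ∈ V) : IsIntegral ℤ F0 := by
  apply val_int
  intro V
  rcases V.mem_or_inv_mem F0 with h0 | h0
  · exact h0
  · exact (Subring.closure_le (t := V.toSubring)).2 (fun t ht => h V h0 t ht) hF

lemma exists_numberField (B : Type) [CommRing B] [Nontrivial B] [inst : Algebra ℚ B] [Algebra.FiniteType ℚ B] :
    ∃ (E : Type) (_ : Field E) (_ : NumberField E), Nonempty (B →+* E) := by
  obtain ⟨m, hm⟩ := Ideal.exists_maximal B
  letI hF : Field (B ⧸ m) := Ideal.Quotient.field m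
  haveI h1 : Module.Finite ℚ (B ⧸ m) := finite_of_finite_type_of_isJacobsonRing _ _
  haveI h2 : CharZero (B ⧸ m) := charZero_of_injective_algebraMap (algebraMap ℚ (B ⧸ m)).injective
  have h3 : @NumberField (B ⧸ m) hF := by
    refine @NumberField.mk _ _ h2 ?_
    convert h1
    exact Subsingleton.elim _ _
  exact ⟨B ⧸ m, hF, h3, ⟨Ideal.Quotient.mk m⟩⟩

lemma arch_emb {E : Type} [Field E] [NumberField E] (x : E) (hx : x ≠ 0) (hi : IsIntegral ℤ x) : ∃ σ : E →+* ℂ, 1 ≤ ‖σ x‖ := by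
  obtain ⟨w, hw⟩ : ∃ w : NumberField.InfinitePlace E, 1 ≤ w x := by
    by_contra hc
    push Not at hc
    let w : NumberField.InfinitePlace E := Classical.arbitrary _
    let x : NumberField.RingOfIntegers E := ⟨_, hi⟩
    have := NumberField.InfinitePlace.one_le_of_lt_one (w := w) (a := x) (by
      intro h; exact hx (congrArg Subtype.val h)) (fun z _ => hc z)
    exact absurd this (not_le.2 (hc w))
  rw [← NumberField.InfinitePlace.norm_embedding_eq] at hw
  exact ⟨_, hw⟩

lemma arch_place {A : Type} [CommRing A] [Algebra.FiniteType ℤ A] {K : Type} [Field K] [CharZero K] (ψ : A →+* K) (a : A)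
    (ha : ψ a ≠ 0) (hIntg : IsIntegral ℤ (ψ a)) : ∃ (B : Type) (_ : CommRing B) (ι : B →+* K) (ψB : A →+* B) (σ : B →+* ℂ),
    Function.Injective ι ∧ ι.comp ψB = ψ ∧ 1 ≤ ‖σ (ψB a)‖ := by
  classical
  obtain ⟨S, hS⟩ := (Algebra.FiniteType.out : (⊤ : Subalgebra ℤ A).FG)
  let B := Algebra.adjoin ℚ ((S.image ψ : Finset K) : Set K)
  haveI : Algebra.FiniteType ℚ B := (Subalgebra.fg_iff_finiteType _).1 (Subalgebra.fg_adjoin_finset _)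
  have hB : ∀ x : A, ψ x ∈ B := by
    intro x
    have hx : x ∈ Algebra.adjoin ℤ (S : Set A) := by rw [hS]; trivial
    induction hx using Algebra.adjoin_induction with
    | mem x hx => exact Algebra.subset_adjoin (by simpa using ⟨x, hx, rfl⟩)
    | algebraMap r => simpa using B.intCast_mem r
    | add x y _ _ h1 h2 => rw [map_add]; exact B.add_mem h1 h2
    | mul x y _ _ h1 h2 => rw [map_mul]; exact B.mul_mem h1 h2
  let ψB : A →+* B := ψ.codRestrict B hB
  have hintB : IsIntegral ℤ (ψB a) := by
    refine (isIntegral_algHom_iff (B.val.restrictScalars ℤ) Subtype.val_injective).1 ?_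
    exact hIntg
  have hu : IsUnit (ψB a) := by
    have h1 : IsAlgebraic ℚ ((ψB a : B) : K) := (hIntg.tower_top (A := ℚ)).isAlgebraic
    have := Subalgebra.inv_mem_of_algebraic _ h1
    refine IsUnit.of_mul_eq_one ⟨_, this⟩ (Subtype.ext ?_)
    exact mul_inv_cancel₀ ha
  obtain ⟨E, hE1, hE2, ⟨q⟩⟩ := exists_numberField B
  obtain ⟨σ, hσ⟩ := arch_emb (q (ψB a)) ((hu.map q).ne_zero) (hintB.map q.toIntAlgHom)
  exact ⟨B, inferInstance, B.val.toRingHom, ψB, σ.comp q, Subtype.val_injective, rfl, hσ⟩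
end CG

namespace CG

/-- virtually solvable modulo scalars -/
def VS {G : Type} [Group G] {d : ℕ} {K : Type} [Field K] (φ : G →* Matrix (Fin d) (Fin d) K) : Prop :=
  ∃ Δ : Subgroup G, Δ.FiniteIndex ∧ ∃ n : ℕ, ∀ w ∈ (derivedSeries Δ n).map Δ.subtype, Scal K (φ w)

lemma vs_of_finite {G : Type} [Group G] {d : ℕ} {K : Type} [Field K] (φ : G →* Matrix (Fin d) (Fin d) K)
    (h : (Set.range φ).Finite) : VS φ := by
  have hk : φ.toHomUnits.ker.FiniteIndex := by
    haveI : Finite φ.toHomUnits.range := by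
      have : Set.Finite (φ.toHomUnits.range : Set (Matrix (Fin d) (Fin d) K)ˣ) := by
        refine Set.Finite.of_finite_image (f := Units.val) (h.subset ?_) (Set.injOn_of_injective Units.val_injective)
        rintro _ ⟨_, ⟨x, rfl⟩, rfl⟩
        exact ⟨x, rfl⟩
      exact this
    infer_instance
  refine ⟨φ.toHomUnits.ker, hk, 0, ?_⟩
  rintro _ ⟨⟨w, hw⟩, -, rfl⟩
  refine ⟨1, ?_⟩
  have : φ.toHomUnits w = 1 := hw
  have h2 := congrArg Units.val this
  simpa using h2

lemma ev_mem {k d : ℕ} {K : Type} [Field K] (φ : FreeGroup (Fin k) →* Matrix (Fin d) (Fin d) K) (S : Subring K) (q : TP k)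
    (h : ∀ w ∈ q.vars, (φ w).trace ∈ S) : ev φ q ∈ S := by
  show MvPolynomial.eval₂ _ _ _ ∈ S
  rw [MvPolynomial.eval₂_eq]
  refine S.sum_mem fun a ha => S.mul_mem (by simp) (S.prod_mem fun i hi => S.pow_mem (h i ?_) _)
  exact (MvPolynomial.mem_vars_iff_mem_support _).2 ⟨a, ha, hi⟩

lemma fin_of_charp {k d : ℕ} {K : Type} [Field K] (p : ℕ) [Fact p.Prime] [CharP K p]
    (φ : FreeGroup (Fin k) →* Matrix (Fin d) (Fin d) K) (e : Fin d × Fin d → FreeGroup (Fin k)) (he : ev φ (Dp e) ≠ 0)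
    (W : Finset (FreeGroup (Fin k))) (hW1 : ∀ i, e i ∈ W) (hW2 : ∀ i j, e i * e j ∈ W)
    (hW3 : ∀ s i j, FreeGroup.of s * e i * e j ∈ W) (hW4 : ∀ s i j, (FreeGroup.of s)⁻¹ * e i * e j ∈ W)
    (hIntg : ∀ w ∈ W, IsIntegral ℤ (φ w).trace) : (Set.range φ).Finite := by
  classical
  letI := ZMod.algebra K p
  let S : Set K := (fun w => (φ w).trace) '' (W : Set (FreeGroup (Fin k)))
  let k1 := IntermediateField.adjoin (ZMod p) S
  haveI : Finite S := (W.finite_toSet.image _).to_subtype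
  haveI : FiniteDimensional (ZMod p) k1 := IntermediateField.finiteDimensional_adjoin (by
    rintro _ ⟨w, hw, rfl⟩
    exact (hIntg w hw).tower_top)
  haveI : Finite k1 := Module.finite_of_finite (ZMod p)
  have hmem : ∀ w ∈ W, (φ w).trace ∈ k1.toSubfield.toSubring := fun w hw => IntermediateField.subset_adjoin _ _ ⟨w, hw, rfl⟩
  have hgP : ∀ i j, ev φ (gramP e i j) ∈ k1.toSubfield.toSubring := by
    intro i j
    simp only [gramP, Matrix.of_apply, ev_X]
    exact hmem _ (hW2 i j)
  have hadj : ∀ i j, ev φ ((gramP e).adjugate i j) ∈ k1.toSubfield.toSubring := by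
    intro i j
    let G' : Matrix (Fin d × Fin d) (Fin d × Fin d) k1.toSubfield.toSubring := Matrix.of fun i j => ⟨_, hgP i j⟩
    have h1 : (k1.toSubfield.toSubring.subtype).mapMatrix G' = (ev φ).mapMatrix (gramP e) := by
      ext i j; rfl
    have h2 : ev φ ((gramP e).adjugate i j) = ((ev φ).mapMatrix (gramP e)).adjugate i j := by
      rw [← RingHom.map_adjugate]; rfl
    rw [h2, ← h1, ← RingHom.map_adjugate]
    exact (G'.adjugate i j).2
  have hdet : ev φ (Dp e) ∈ k1.toSubfield.toSubring := by
    let G' : Matrix (Fin d × Fin d) (Fin d × Fin d) k1.toSubfield.toSubring := Matrix.of fun i j => ⟨_, hgP i j⟩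
    have h1 : (k1.toSubfield.toSubring.subtype).mapMatrix G' = (ev φ).mapMatrix (gramP e) := by
      ext i j; rfl
    rw [Dp, RingHom.map_det, ← h1, ← RingHom.map_det]
    exact G'.det.2
  let Z : Set (Matrix (Fin d) (Fin d) K) := Set.range fun x : Fin d × Fin d → k1 => ∑ i, (x i : K) • φ (e i)
  have hZf : Z.Finite := Set.finite_range _
  have hZ : ∀ M, (∀ l, (M * φ (e l)).trace ∈ k1.toSubfield.toSubring) → M ∈ Z := by
    intro M hM
    refine ⟨fun i => ⟨co φ e i M, ?_⟩, (eq_co he M).symm⟩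
    refine k1.mul_mem (k1.inv_mem hdet) (k1.sum_mem fun l _ => k1.mul_mem (hM l) (hadj _ _))
  have h1 : (1 : Matrix (Fin d) (Fin d) K) ∈ Z := hZ 1 fun l => by rw [one_mul]; exact hmem _ (hW1 l)
  have hZ2 : ∀ w, (∀ i, φ w * φ (e i) ∈ Z) → ∀ M ∈ Z, φ w * M ∈ Z := by
    rintro w hw _ ⟨x, rfl⟩
    choose y hy using hw
    refine ⟨fun j => ∑ i, x i * y i j, ?_⟩
    simp only at hy ⊢
    rw [Finset.mul_sum]
    simp_rw [mul_smul_comm, ← hy, Finset.smul_sum, smul_smul]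
    rw [Finset.sum_comm]
    refine Finset.sum_congr rfl fun i _ => ?_
    rw [← Finset.sum_smul]
    congr 1
    push_cast
    rfl
  have key : ∀ w, ∀ M ∈ Z, φ w * M ∈ Z := by
    intro w
    induction w using FreeGroup.induction_on with
    | C1 => intro M hM; simpa using hM
    | of s =>
      refine hZ2 _ fun i => hZ _ fun l => ?_
      rw [← map_mul, ← map_mul]
      exact hmem _ (hW3 _ _ _)
    | inv_of s _ =>
      refine hZ2 _ fun i => hZ _ fun l => ?_
      rw [← map_mul, ← map_mul]
      exact hmem _ (hW4 _ _ _)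
    | mul x y hx hy =>
      intro M hM
      rw [map_mul, mul_assoc]
      exact hx _ (hy _ hM)
  refine hZf.subset ?_
  rintro _ ⟨w, rfl⟩
  have := key w 1 h1
  rwa [mul_one] at this

lemma scal_transfer {d : ℕ} {B K K' : Type} [CommRing B] [Field K] [Field K'] (ι : B →+* K) (hι : Function.Injective ι) (σ : B →+* K')
    (M : Matrix (Fin d) (Fin d) B) (h : Scal K (M.map ι)) : Scal K' (M.map σ) := by
  obtain ⟨c, hc⟩ := h
  have hc' : ∀ i j, ι (M i j) = if i = j then c else 0 := by
    intro i j
    have := congrFun (congrFun hc i) j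
    simpa [Matrix.one_apply] using this
  rcases isEmpty_or_nonempty (Fin d) with h | ⟨⟨i0⟩⟩
  · exact ⟨0, by ext i; exact h.elim i⟩
  refine ⟨σ (M i0 i0), ?_⟩
  ext i j
  simp only [Matrix.map_apply, Matrix.smul_apply, Matrix.one_apply, smul_eq_mul]
  split_ifs with hij
  · subst hij
    rw [mul_one]
    congr 1
    apply hι
    rw [hc', hc', if_pos rfl, if_pos rfl]
  · rw [mul_zero]
    have : M i j = 0 := hι (by rw [hc', if_neg hij, map_zero])
    rw [this, map_zero]
end CG

namespace CG
open scoped NNReal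

lemma key_prop {k d : ℕ} (hd : 2 ≤ d) {A : Type} [CommRing A] [Algebra.FiniteType ℤ A] {L : Type} [Field L] [IsAlgClosed L]
    (ι : A →+* L) (hι : Function.Injective ι) (Φ : FreeGroup (Fin k) →* Matrix (Fin d) (Fin d) A) (hdet : ∀ w, (Φ w).det = 1)
    (hSI : SI (mapφ ι Φ)) : ∃ f : A, f ≠ 0 ∧ ∃ ε > 0, ∀ (K : Type) [Field K] [IsAlgClosed K] (ψ : A →+* K), ψ f ≠ 0 →
      ¬ VS (mapφ ψ Φ) → ∀ (X : Type) (ρ : FreeGroup (Fin k) →* Equiv.Perm X),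
        (∀ w x, ρ w x = x → Scal K (mapφ ψ Φ w)) → Gap ε ρ := by
  classical
  have hdm : ∀ (K : Type) [Field K] (ψ : A →+* K) w, (mapφ ψ Φ w).det = 1 := by
    intro K _ ψ w
    have h := RingHom.map_det ψ (Φ w)
    rw [hdet, map_one] at h
    exact h.symm
  obtain ⟨e, he⟩ := G1 hSI
  have he' : ev (mapφ ι Φ) (Dp e) ≠ 0 := by rw [ev_Dp]; exact he
  have heA : ev Φ (Dp e) ≠ 0 := by
    intro h; rw [ev_map, h, map_zero] at he'; exact he' rfl
  obtain ⟨H, fP, m, Gc, hfP, hPI⟩ := exists_PIf e Φ ι hι hSI heA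
  obtain ⟨f2, hf2, W1, hW1⟩ := arch_law hd (mapφ ι Φ) hSI (hdm L ι) e he' fP
  obtain ⟨CD, WD, hCD⟩ := tp_bound d (Dp e)
  obtain ⟨CP, WP, hCP⟩ := tp_bound d fP
  obtain ⟨C2, W2, hC2⟩ := tp_bound d f2
  obtain ⟨W0, hW0⟩ := local_thm (by omega) e (CD + CP + C2) H fP m Gc
  let ftp := Dp e * fP * f2
  let We : Finset (FreeGroup (Fin k)) := Finset.univ.image e ∪ Finset.univ.image (fun p : (Fin d × Fin d) × (Fin d × Fin d) => e p.1 * e p.2) ∪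
    Finset.univ.image (fun p : Fin k × (Fin d × Fin d) × (Fin d × Fin d) => FreeGroup.of p.1 * e p.2.1 * e p.2.2) ∪
    Finset.univ.image (fun p : Fin k × (Fin d × Fin d) × (Fin d × Fin d) => (FreeGroup.of p.1)⁻¹ * e p.2.1 * e p.2.2)
  let W := W0 ∪ W1 ∪ WD ∪ WP ∪ W2 ∪ ftp.vars ∪ We
  have sW0 : W0 ⊆ W := by intro x hx; simp [W, hx]
  have sW1 : W1 ⊆ W := by intro x hx; simp [W, hx]
  have sWD : WD ⊆ W := by intro x hx; simp [W, hx]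
  have sWP : WP ⊆ W := by intro x hx; simp [W, hx]
  have sW2 : W2 ⊆ W := by intro x hx; simp [W, hx]
  have sWv : ftp.vars ⊆ W := by intro x hx; simp [W, hx]
  have sWe : We ⊆ W := by intro x hx; simp [W, hx]
  clear_value W
  obtain ⟨Q, hQ, hloc⟩ := hW0 W sW0
  obtain ⟨ε, hε, hgap⟩ := gap_of_dyn d (by omega) Q (H : Set _) hQ H.finite_toSet
  have main : ∀ (K : Type) [Field K] [IsAlgClosed K] (Γ : Type) [LinearOrderedCommGroupWithZero Γ]
      (φ : FreeGroup (Fin k) →* Matrix (Fin d) (Fin d) K) (v : K →*₀ Γ) (c : Γ),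
      (∀ w, (φ w).det = 1) → QA v c → PIf e H fP m Gc φ → 1 ≤ v (ev φ ftp) →
      (∃ g ∈ W, c ^ (8 * d ^ 2) < v (φ g).trace) → Dyn φ Q H := by
    intro K _ _ Γ _ φ v c hdet hqa hpi hftp ⟨g0, hg0, hg0'⟩
    obtain ⟨g, hg, hgmax⟩ := Finset.exists_max_image W (fun g => v (φ g).trace) ⟨g0, hg0⟩
    have hT : c ^ (8 * d ^ 2) < v (φ g).trace := hg0'.trans_le (hgmax g0 hg0)
    have h8 : 1 ≤ 8 * d ^ 2 := by nlinarith
    have hcT : c ≤ v (φ g).trace := (le_self_pow₀ hqa.one_le (by omega)).trans hT.le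
    have hPL : PL φ v c (v (φ g).trace) W := ⟨hqa, (one_le_pow₀ hqa.one_le).trans_lt hT, hcT, hT.le, hgmax⟩
    have bD := hCD K Γ φ v c _ (hPL.mono sWD)
    have bP := hCP K Γ φ v c _ (hPL.mono sWP)
    have b2 := hC2 K Γ φ v c _ (hPL.mono sW2)
    simp only [ftp, map_mul] at hftp
    set T := v (φ g).trace
    have hT1 : 1 ≤ T := hPL.hT.le
    refine hloc K Γ φ v c T hdet ⟨hPL, hftp.trans ?_⟩ hpi (hftp.trans ?_) ⟨g, hg, le_rfl⟩
    · calc v (ev φ (Dp e)) * v (ev φ fP) * v (ev φ f2) ≤ v (ev φ (Dp e)) * T ^ CP * T ^ C2 := by gcongr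
        _ = T ^ (CP + C2) * v (ev φ (Dp e)) := by rw [pow_add]; simp only [mul_comm, mul_left_comm, mul_assoc]
        _ ≤ _ := mul_le_mul_left (pow_le_pow_right₀ hT1 (by omega)) _
    · calc v (ev φ (Dp e)) * v (ev φ fP) * v (ev φ f2) ≤ T ^ CD * v (ev φ fP) * T ^ C2 := by gcongr
        _ = T ^ (CD + C2) * v (ev φ fP) := by rw [pow_add]; simp only [mul_comm, mul_left_comm, mul_assoc]
        _ ≤ _ := mul_le_mul_left (pow_le_pow_right₀ hT1 (by omega)) _
  refine ⟨ev Φ ftp, ?_, ε, hε, ?_⟩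
  · intro h
    have h1 : ι (ev Φ ftp) = 0 := by rw [h, map_zero]
    simp only [ftp, map_mul] at h1
    rw [← ev_map, ← ev_map, ← ev_map] at h1
    have h2 : ev (mapφ ι Φ) fP ≠ 0 := by
      rw [ev_map]; exact fun h => hfP (hι (by rw [h, map_zero]))
    exact mul_ne_zero (mul_ne_zero he' h2) hf2 h1
  intro K _ _ ψ hψ hVS X ρ hρ
  have hF0 : ev (mapφ ψ Φ) ftp = ψ (ev Φ ftp) := ev_map _ _ _
  set F0 := ψ (ev Φ ftp) with hF0def
  by_cases hval : ∀ V : ValuationSubring K, F0⁻¹ ∈ V → ∀ w ∈ W, (mapφ ψ Φ w).trace ∈ V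
  swap
  · push Not at hval
    obtain ⟨V, hV, w, hw, hwV⟩ := hval
    refine hgap K (mapφ ψ Φ) (main K V.ValueGroup (mapφ ψ Φ) V.valuation.toMonoidWithZeroHom 1 (hdm K ψ) ⟨le_rfl, fun x y => ?_⟩
      (hPI K ψ) ?_ ⟨w, hw, ?_⟩) X ρ hρ
    · rw [one_mul]; exact V.valuation.map_add x y
    · rw [hF0]
      have h1 := (V.valuation_le_one_iff _).2 hV
      rw [map_inv₀] at h1
      exact (inv_le_one₀ (zero_lt_iff.2 ((Valuation.ne_zero_iff _).2 hψ))).1 h1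
    · rw [one_pow]
      refine lt_of_not_ge fun h => hwV ?_
      exact (V.valuation_le_one_iff _).1 h
  have hFint : IsIntegral ℤ F0 := by
    refine val_dich F0 ((fun w => (mapφ ψ Φ w).trace) '' (W : Set _)) ?_ ?_
    · rw [← hF0]
      exact ev_mem _ _ _ fun w hw => Subring.subset_closure ⟨w, sWv hw, rfl⟩
    · rintro V hV _ ⟨w, hw, rfl⟩
      exact hval V hV w hw
  obtain ⟨p, hp⟩ := CharP.exists K
  rcases CharP.char_is_prime_or_zero K p with hpp | hp0
  · exfalso
    haveI : Fact p.Prime := ⟨hpp⟩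
    refine hVS (vs_of_finite _ (fin_of_charp p (mapφ ψ Φ) e ?_ W ?_ ?_ ?_ ?_ ?_))
    · intro h
      apply hψ
      rw [← hF0]
      simp [ftp, h]
    · intro i; exact sWe (by simp [We])
    · intro i j; exact sWe (by simp only [We, Finset.mem_union]; left; left; right; exact Finset.mem_image.2 ⟨(i, j), by simp, rfl⟩)
    · intro s i j; exact sWe (by simp only [We, Finset.mem_union]; left; right; exact Finset.mem_image.2 ⟨(s, i, j), by simp, rfl⟩)
    · intro s i j; exact sWe (by simp only [We, Finset.mem_union]; right; exact Finset.mem_image.2 ⟨(s, i, j), by simp, rfl⟩)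
    · intro w hw
      apply val_int
      intro V
      refine hval V ?_ w hw
      letI := ZMod.algebra K p
      have h1 : IsIntegral (ZMod p) F0⁻¹ := (hFint.tower_top (A := ZMod p)).inv
      have h2 : IsIntegral V.toSubring F0⁻¹ := by
        haveI : Algebra.IsIntegral ℤ (ZMod p) := ⟨fun x => by
          obtain ⟨n, rfl⟩ := ZMod.intCast_surjective x
          exact isIntegral_algebraMap (R := ℤ) (x := n)⟩
        exact (isIntegral_trans (R := ℤ) _ h1).tower_top
      have h3 : IsIntegral V F0⁻¹ := h2
      obtain ⟨y, hy⟩ := (IsIntegrallyClosed.isIntegral_iff).1 h3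
      rw [← hy]
      exact y.2
  · subst hp0
    haveI : CharZero K := CharP.charP_to_charZero K
    obtain ⟨B, _, iB, ψB, σ, hinj, hcomp, hσ⟩ := arch_place ψ (ev Φ ftp) hψ hFint
    have hev : 1 ≤ ‖ev (mapφ (σ.comp ψB) Φ) ftp‖ := by rw [ev_map]; exact hσ
    obtain ⟨w, hw, hw'⟩ := hW1 (mapφ (σ.comp ψB) Φ) hev
    refine hgap ℂ (mapφ (σ.comp ψB) Φ) (main ℂ ℝ≥0 (mapφ (σ.comp ψB) Φ) nnnormHom 2 (hdm ℂ _) ⟨by norm_num, fun x y => ?_⟩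
      (hPI ℂ _) ?_ ⟨w, sW1 hw, ?_⟩) X ρ ?_
    · refine (nnnorm_add_le x y).trans ?_
      rw [two_mul]
      exact add_le_add (le_max_left _ _) (le_max_right _ _)
    · exact NNReal.coe_le_coe.1 hev
    · exact NNReal.coe_lt_coe.1 (by push_cast; exact hw')
    · intro w x hwx
      have h := hρ w x hwx
      have h1 : mapφ ψ Φ w = ((Φ w).map ψB).map iB := by
        rw [← hcomp]; rfl
      rw [h1] at h
      exact scal_transfer iB hinj σ _ h
end CG

namespace CG

lemma burnside {K V : Type} [Field K] [IsAlgClosed K] [AddCommGroup V] [Module K V] [FiniteDimensional K V] [Nontrivial V]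
    (S : Subalgebra K (Module.End K V)) (h : ∀ W : Submodule K V, (∀ f ∈ S, ∀ x ∈ W, f x ∈ W) → W = ⊥ ∨ W = ⊤) : S = ⊤ := by
  haveI : IsSimpleModule S V := by
    refine @IsSimpleModule.mk _ _ _ _ _ (@IsSimpleOrder.mk _ _ _ inferInstance fun W => ?_)
    have := h (W.restrictScalars K) (fun f hf x hx => W.smul_mem (⟨f, hf⟩ : S) hx)
    simpa using this
  rw [eq_top_iff]
  intro g _
  have hb := IsSimpleModule.algebraMap_end_bijective_of_isAlgClosed (A := S) (V := V) K
  let g' : Module.End (Module.End S V) V :=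
    { toFun := g
      map_add' := map_add g
      map_smul' := by
        intro f x
        obtain ⟨c, rfl⟩ := hb.2 f
        simp }
  let b := Module.finBasis K V
  obtain ⟨r, hr⟩ := jacobson_density (R := S) g' (Finset.univ.map ⟨b, b.injective⟩)
  have : g = (r : Module.End K V) := by
    refine b.ext fun i => ?_
    exact hr (b i) (by simp)
  rw [this]
  exact r.2

def VSr {G : Type} [Group G] (K : Type) {R : Type} [Field K] [Ring R] [Algebra K R] (φ : G →* R) : Prop :=
  ∃ Δ : Subgroup G, Δ.FiniteIndex ∧ ∃ n : ℕ, ∀ w ∈ (derivedSeries Δ n).map Δ.subtype, Scal K (φ w)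

lemma VS_iff {G : Type} [Group G] {d : ℕ} {K : Type} [Field K] (φ : G →* Matrix (Fin d) (Fin d) K) : VS φ ↔ VSr K φ := Iff.rfl

/-- derived series of a subgroup as subgroups of the big group -/
def Ds {G : Type} [Group G] (Δ : Subgroup G) (n : ℕ) : Subgroup G := (derivedSeries Δ n).map Δ.subtype

lemma Ds_zero {G : Type} [Group G] (Δ : Subgroup G) : Ds Δ 0 = Δ := by
  simp [Ds, ← MonoidHom.range_eq_map]

open scoped commutatorElement
lemma Ds_succ {G : Type} [Group G] (Δ : Subgroup G) (n : ℕ) : Ds Δ (n + 1) = ⁅Ds Δ n, Ds Δ n⁆ := by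
  rw [Ds, derivedSeries_succ, Subgroup.map_commutator]; rfl

lemma Ds_mono {G : Type} [Group G] {Δ Δ' : Subgroup G} (h : Δ ≤ Δ') (n : ℕ) : Ds Δ n ≤ Ds Δ' n := by
  induction n with
  | zero => simpa [Ds_zero] using h
  | succ n ih => rw [Ds_succ, Ds_succ]; exact Subgroup.commutator_mono ih ih

lemma Ds_anti {G : Type} [Group G] (Δ : Subgroup G) {m n : ℕ} (h : m ≤ n) : Ds Δ n ≤ Ds Δ m :=
  Subgroup.map_mono (derivedSeries_antitone _ h)

lemma Ds_map {G G' : Type} [Group G] [Group G'] (θ : G →* G') (Δ : Subgroup G) (n : ℕ) : Ds (Δ.map θ) n = (Ds Δ n).map θ := by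
  induction n with
  | zero => simp [Ds_zero]
  | succ n ih => rw [Ds_succ, Ds_succ, ih, Subgroup.map_commutator]

lemma VSr_iff {G : Type} [Group G] {K : Type} {R : Type} [Field K] [Ring R] [Algebra K R] (φ : G →* R) : VSr K φ ↔
   ∃ Δ : Subgroup G, Δ.FiniteIndex ∧ ∃ n : ℕ, ∀ w ∈ Ds Δ n, Scal K (φ w) := Iff.rfl

/-- commutators of commuting elements die -/
lemma comm_ker {G R : Type} [Group G] [Monoid R] (φ : G →* R) (N : Subgroup G) (h : ∀ x ∈ N, ∀ y ∈ N, φ x * φ y = φ y * φ x) :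
    ∀ w ∈ ⁅N, N⁆, φ w = 1 := by
  have : ⁅N, N⁆ ≤ φ.ker := by
    rw [Subgroup.commutator_le]
    intro x hx y hy
    rw [MonoidHom.mem_ker, commutatorElement_def, map_mul, map_mul, map_mul, h x hx y hy, mul_assoc, mul_assoc, ← mul_assoc (φ x),
      ← map_mul φ x, mul_inv_cancel, map_one, one_mul, ← map_mul, mul_inv_cancel, map_one]
  exact fun w hw => this hw

lemma VSr.comp {G G' : Type} [Group G] [Group G'] {K : Type} {R : Type} [Field K] [Ring R] [Algebra K R] (θ : G →* G') (φ : G' →* R)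
    (hθ : θ.range.FiniteIndex) (h : VSr K (φ.comp θ)) : VSr K φ := by
  obtain ⟨Δ, hΔ, n, hn⟩ := (VSr_iff _).1 h
  refine ⟨Δ.map θ, ?_, n, ?_⟩
  · constructor
    rw [Subgroup.index_map]
    have h1 : (Δ ⊔ θ.ker).index ≠ 0 := fun h0 => hΔ.index_ne_zero (Nat.eq_zero_of_zero_dvd (h0 ▸ Subgroup.index_dvd_of_le le_sup_left))
    exact mul_ne_zero h1 hθ.index_ne_zero
  · show ∀ w ∈ Ds (Δ.map θ) n, _
    rw [Ds_map]
    rintro _ ⟨w, hw, rfl⟩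
    exact hn w hw

lemma scal_equiv {K R R' : Type} [Field K] [Ring R] [Algebra K R] [Ring R'] [Algebra K R'] (f : R →ₐ[K] R') {x : R} (h : Scal K x) :
    Scal K (f x) := by
  obtain ⟨c, rfl⟩ := h
  exact ⟨c, by simp⟩

/-- extension: W and V/W virtually solvable mod scalars implies V is -/
lemma VSr.ext {G K V : Type} [Group G] [Field K] [AddCommGroup V] [Module K V] (φ : G →* Module.End K V) (W : Submodule K V)
    (hW : ∀ g, W ≤ W.comap (φ g)) (φ1 : G →* Module.End K W) (φ2 : G →* Module.End K (V ⧸ W))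
    (h1 : ∀ g x, (φ1 g x : V) = φ g x) (h2 : ∀ g x, φ2 g (W.mkQ x) = W.mkQ (φ g x)) (hv1 : VSr K φ1) (hv2 : VSr K φ2) : VSr K φ := by
  obtain ⟨Δ1, hΔ1, n1, hn1⟩ := (VSr_iff _).1 hv1
  obtain ⟨Δ2, hΔ2, n2, hn2⟩ := (VSr_iff _).1 hv2
  refine ⟨Δ1 ⊓ Δ2, inferInstance, max n1 n2 + 1 + 1, ?_⟩
  show ∀ w ∈ Ds (Δ1 ⊓ Δ2) _, _
  set D := Ds (Δ1 ⊓ Δ2) (max n1 n2) with hD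
  have k1 : ∀ w ∈ D, Scal K (φ1 w) := fun w hw => hn1 w (Ds_mono inf_le_left _ (Ds_anti _ (le_max_left _ _) hw))
  have k2 : ∀ w ∈ D, Scal K (φ2 w) := fun w hw => hn2 w (Ds_mono inf_le_right _ (Ds_anti _ (le_max_right _ _) hw))
  have sc : ∀ {R : Type} [Ring R] [Algebra K R] (x y : R), Scal K x → Scal K y → x * y = y * x := by
    rintro R _ _ _ _ ⟨a, rfl⟩ ⟨b, rfl⟩
    simp [smul_smul, mul_comm]
  rw [Ds_succ, Ds_succ, ← hD]
  have l1 : ∀ w ∈ ⁅D, D⁆, φ1 w = 1 := comm_ker φ1 D fun x hx y hy => sc _ _ (k1 x hx) (k1 y hy)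
  have l2 : ∀ w ∈ ⁅D, D⁆, φ2 w = 1 := comm_ker φ2 D fun x hx y hy => sc _ _ (k2 x hx) (k2 y hy)
  have m1 : ∀ w ∈ ⁅D, D⁆, ∀ x ∈ W, φ w x = x := by
    intro w hw x hx
    have := h1 w ⟨x, hx⟩
    rw [l1 w hw] at this
    exact this.symm
  have m2 : ∀ w ∈ ⁅D, D⁆, ∀ x, φ w x - x ∈ W := by
    intro w hw x
    have := h2 w x
    rw [l2 w hw] at this
    simp only [Module.End.one_apply, Submodule.mkQ_apply] at this
    exact (Submodule.Quotient.eq W).1 this.symm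
  have := comm_ker φ ⁅D, D⁆ (by
    intro x hx y hy
    ext z
    have e1 := m1 x hx _ (m2 y hy z)
    have e2 := m1 y hy _ (m2 x hx z)
    rw [map_sub] at e1 e2
    simp only [Module.End.mul_apply]
    have e3 : φ x (φ y z) = φ x z + (φ y z - z) := by rw [← e1]; abel
    have e4 : φ y (φ x z) = φ y z + (φ x z - z) := by rw [← e2]; abel
    rw [e3, e4]; abel)
  intro w hw
  exact ⟨1, by rw [this w hw, one_smul]⟩
end CG

namespace CG

def Main (d : ℕ) : Prop := ∀ k : ℕ, ∃ ε : ℝ, 0 < ε ∧ ∀ (K : Type) [Field K] [IsAlgClosed K]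
    (φ : FreeGroup (Fin k) →* Matrix (Fin d) (Fin d) K), ¬ VS φ → ∀ (X : Type) (ρ : FreeGroup (Fin k) →* Equiv.Perm X),
        (∀ w x, ρ w x = x → Scal K (φ w)) → Gap ε ρ

lemma Gap.mono {k : ℕ} {X : Type} {ε ε' : ℝ} {ρ : FreeGroup (Fin k) →* Equiv.Perm X} (h : Gap ε ρ) (hε : ε' ≤ ε) : Gap ε' ρ := by
  intro f hf
  refine le_trans ?_ (h f hf)
  have : 0 ≤ ∑' x, f x ^ 2 := tsum_nonneg fun x => sq_nonneg _
  gcongr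

lemma pos_min {d : ℕ} (f : Fin d → ℝ) (hf : ∀ i, 0 < f i) : ∃ ε > 0, ∀ i, ε ≤ f i := by
  rcases isEmpty_or_nonempty (Fin d) with h | h
  · exact ⟨1, one_pos, fun i => h.elim i⟩
  · obtain ⟨i, hi⟩ := Finite.exists_min f
    exact ⟨f i, hf i, hi⟩

lemma invariant_of_span {d : ℕ} (hd : 0 < d) {G K : Type} [Group G] [Field K] [IsAlgClosed K] (φ : G →* Matrix (Fin d) (Fin d) K) (Δ : Subgroup G)
    (h : Submodule.span K (φ '' (Δ : Set G)) ≠ ⊤) : ∃ W : Submodule K (Fin d → K), W ≠ ⊥ ∧ W ≠ ⊤ ∧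
      ∀ g ∈ Δ, W ≤ W.comap (Matrix.toLinAlgEquiv' (φ g)) := by
  haveI : NeZero d := ⟨hd.ne'⟩
  by_contra hc
  push Not at hc
  apply h
  let S0 := Algebra.adjoin K (φ '' (Δ : Set G))
  have hS0 : Subalgebra.toSubmodule S0 = Submodule.span K (φ '' (Δ : Set G)) := by
    rw [Algebra.adjoin_eq_span]
    congr 1
    have : φ '' (Δ : Set G) = (Δ.toSubmonoid.map φ : Set _) := rfl
    rw [this, Submonoid.closure_eq]
  let S := S0.map (Matrix.toLinAlgEquiv' (R := K) (n := Fin d)).toAlgHom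
  have hS : S = ⊤ := by
    apply burnside
    intro W hW
    by_contra hW2
    push Not at hW2
    obtain ⟨g, hg, hgW⟩ := hc W hW2.1 hW2.2
    apply hgW
    intro x hx
    exact hW _ ⟨φ g, Algebra.subset_adjoin ⟨g, hg, rfl⟩, rfl⟩ x hx
  rw [← hS0, eq_top_iff]
  intro x _
  have : (Matrix.toLinAlgEquiv' (R := K) (n := Fin d)) x ∈ S := by rw [hS]; trivial
  obtain ⟨y, hy, hyx⟩ := this
  have : y = x := (Matrix.toLinAlgEquiv' (R := K) (n := Fin d)).injective hyx
  rw [← this]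
  exact hy

lemma red {d : ℕ} (hd : 0 < d) (IH : ∀ d' < d, Main d') {k : ℕ} (Δ : Subgroup (FreeGroup (Fin k))) (hΔ : Δ.FiniteIndex) :
    ∃ ε : ℝ, 0 < ε ∧ ∀ (K : Type) [Field K] [IsAlgClosed K]
    (φ : FreeGroup (Fin k) →* Matrix (Fin d) (Fin d) K), Submodule.span K (φ '' (Δ : Set _)) ≠ ⊤ → ¬ VS φ →
      ∀ (X : Type) (ρ : FreeGroup (Fin k) →* Equiv.Perm X), (∀ w x, ρ w x = x → Scal K (φ w)) → Gap ε ρ := by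
  obtain ⟨k', θ, hθ⟩ : ∃ (k' : ℕ) (θ : FreeGroup (Fin k') →* FreeGroup (Fin k)), θ.range = Δ := by
    haveI : Group.FG Δ := Subgroup.fg_of_index_ne_zero _
    obtain ⟨α, hα, f, hf⟩ := Group.fg_iff_exists_freeGroup_hom_surjective_finite.1 ‹Group.FG Δ›
    obtain ⟨n, ⟨e⟩⟩ := Finite.exists_equiv_fin α
    refine ⟨n, Δ.subtype.comp (f.comp (FreeGroup.freeGroupCongr e.symm).toMonoidHom), ?_⟩
    have h2 : Function.Surjective (f.comp (FreeGroup.freeGroupCongr e.symm).toMonoidHom) := by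
      intro y
      obtain ⟨x, rfl⟩ := hf y
      obtain ⟨z, rfl⟩ := (FreeGroup.freeGroupCongr e.symm).surjective x
      exact ⟨z, rfl⟩
    rw [MonoidHom.range_comp, MonoidHom.range_eq_top.2 h2, ← MonoidHom.range_eq_map, Subgroup.range_subtype]
  choose ε0 hε0 hgap0 using fun i : Fin d => IH i.1 i.2 k'
  choose ε1 hε1 hgap1 using fun i : Fin d => gap_transfer θ (ε0 i) (hε0 i)
  obtain ⟨ε, hε, hmin⟩ := pos_min ε1 hε1
  refine ⟨ε, hε, ?_⟩
  intro K _ _ φ hspan hVS X ρ hρ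
  obtain ⟨W, hW0, hW1, hW⟩ := invariant_of_span hd φ Δ hspan
  let TL := (Matrix.toLinAlgEquiv' (R := K) (n := Fin d))
  let φL : FreeGroup (Fin k') →* Module.End K (Fin d → K) := ((TL : Matrix (Fin d) (Fin d) K →* _)).comp (φ.comp θ)
  have hφL : ∀ g, φL g = TL (φ (θ g)) := fun _ => rfl
  have hWL : ∀ g, W ≤ W.comap (φL g) := fun g => hW _ (by rw [← hθ]; exact ⟨g, rfl⟩)
  let φ1 : FreeGroup (Fin k') →* Module.End K W :=
    { toFun := fun g => (φL g).restrict (hWL g)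
      map_one' := by ext x; simp
      map_mul' := fun x y => by ext z; simp }
  let φ2 : FreeGroup (Fin k') →* Module.End K ((Fin d → K) ⧸ W) :=
    { toFun := fun g => W.mapQ W (φL g) (hWL g)
      map_one' := by apply Submodule.linearMap_qext; ext x; simp
      map_mul' := fun x y => by apply Submodule.linearMap_qext; ext z; simp }
  have hs0 : ∀ w x, (ρ.comp θ) w x = x → Scal K (φL w) := fun w x h => scal_equiv TL.toAlgHom (hρ _ _ h)
  have fin : ∀ (U : Type) [AddCommGroup U] [Module K U] [FiniteDimensional K U] (φ' : FreeGroup (Fin k') →* Module.End K U),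
      Module.finrank K U < d → ¬ VSr K φ' → (∀ w, Scal K (φL w) → Scal K (φ' w)) → Gap ε ρ := by
    intro U _ _ _ φ' hU hV hS
    let b := LinearMap.toMatrixAlgEquiv (Module.finBasis K U)
    let ψ : FreeGroup (Fin k') →* Matrix (Fin (Module.finrank K U)) (Fin (Module.finrank K U)) K := (b : Module.End K U →* _).comp φ'
    refine (hgap1 ⟨_, hU⟩ X ρ (hgap0 ⟨_, hU⟩ K ψ ?_ X (ρ.comp θ) ?_)).mono (hmin _)
    · rintro ⟨Δ', h1, n, h2⟩
      refine hV ⟨Δ', h1, n, fun w hw => ?_⟩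
      have := scal_equiv b.symm.toAlgHom (h2 w hw)
      simpa [ψ] using this
    · intro w x hw
      exact scal_equiv b.toAlgHom (hS w (hs0 w x hw))
  by_cases h1 : VSr (G := FreeGroup (Fin k')) (R := Module.End K W) K φ1
  · by_cases h2 : VSr (G := FreeGroup (Fin k')) (R := Module.End K ((Fin d → K) ⧸ W)) K φ2
    · exfalso
      apply hVS
      refine VSr.comp (K := K) θ φ (by rw [hθ]; exact hΔ) ?_
      have hL : VSr K φL := VSr.ext φL W hWL φ1 φ2 (fun _ _ => rfl) (fun _ _ => by simp [φ2]) h1 h2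
      obtain ⟨Δ', h1, n, h2⟩ := hL
      refine ⟨Δ', h1, n, fun w hw => ?_⟩
      have := scal_equiv TL.symm.toAlgHom (h2 w hw)
      simpa [hφL] using this
    · refine fin _ φ2 ?_ h2 ?_
      · have e1 := W.finrank_quotient_add_finrank
        have e2 : Module.finrank K (Fin d → K) = d := by simp
        have e3 : 0 < Module.finrank K W := Nat.pos_of_ne_zero fun h => hW0 (Submodule.finrank_eq_zero.1 h)
        omega
      · rintro w ⟨c, hc⟩
        refine ⟨c, ?_⟩
        apply Submodule.linearMap_qext
        apply LinearMap.ext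
        intro x
        simp [φ2, hc]
  · refine fin _ φ1 ?_ h1 ?_
    · have := Submodule.finrank_lt hW1
      simpa using this
    · rintro w ⟨c, hc⟩
      refine ⟨c, ?_⟩
      apply LinearMap.ext
      intro x
      apply Subtype.ext
      show φL w x = _
      rw [hc]; rfl
end CG

namespace CG

section
variable {d k : ℕ}

abbrev PR (d k : ℕ) := MvPolynomial (Fin k × Fin d × Fin d) ℤ

noncomputable def gen {R : Type} [CommRing R] (φ : FreeGroup (Fin k) →* Matrix (Fin d) (Fin d) R) : PR d k →+* R :=
  MvPolynomial.eval₂Hom (Int.castRingHom R) (fun x => φ (FreeGroup.of x.1) x.2.1 x.2.2)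

noncomputable def gmat (d : ℕ) {k : ℕ} (i : Fin k) : Matrix (Fin d) (Fin d) (PR d k) := Matrix.of fun a b => MvPolynomial.X (i, a, b)

lemma gen_gmat {R : Type} [CommRing R] (φ : FreeGroup (Fin k) →* Matrix (Fin d) (Fin d) R) (i : Fin k) :
    (gmat d i).map (gen φ) = φ (FreeGroup.of i) := by
  ext a b
  simp [gmat, gen]

def PI (d k : ℕ) (I : Ideal (PR d k)) : Prop := ∃ ε : ℝ, 0 < ε ∧ ∀ (K : Type) [Field K] [IsAlgClosed K]
    (φ : FreeGroup (Fin k) →* Matrix (Fin d) (Fin d) K), (∀ w, (φ w).det = 1) → (∀ p ∈ I, gen φ p = 0) → ¬ VS φ →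
      ∀ (X : Type) (ρ : FreeGroup (Fin k) →* Equiv.Perm X), (∀ w x, ρ w x = x → Scal K (φ w)) → Gap ε ρ

lemma mem_sup_span {I : Ideal (PR d k)} {f : PR d k} {K : Type} [Field K] (g : PR d k →+* K) (hI : ∀ p ∈ I, g p = 0) (hf : g f = 0) :
    ∀ p ∈ I ⊔ Ideal.span {f}, g p = 0 := by
  intro p hp
  have : I ⊔ Ideal.span {f} ≤ RingHom.ker g := sup_le hI (by simpa [Ideal.span_le] using hf)
  exact this hp

lemma lt_sup_span {I : Ideal (PR d k)} {f : PR d k} (hf : f ∉ I) : I < I ⊔ Ideal.span {f} := by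
  refine lt_of_le_of_ne le_sup_left fun h => hf ?_
  rw [h]
  exact Ideal.mem_sup_right (Ideal.mem_span_singleton_self f)

lemma span_special {A : Type} [CommRing A] {L : Type} [Field L] (ι : A →+* L) (hι : Function.Injective ι)
    (Φ : FreeGroup (Fin k) →* Matrix (Fin d) (Fin d) A) (Δ : Subgroup (FreeGroup (Fin k)))
    (h : Submodule.span L (mapφ ι Φ '' (Δ : Set _)) ≠ ⊤) (K : Type) [Field K] (ψ : A →+* K) :
    Submodule.span K (mapφ ψ Φ '' (Δ : Set _)) ≠ ⊤ := by
  intro h0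
  apply h
  have h1 : Submodule.span K (Set.range ((mapφ ψ Φ).comp Δ.subtype)) = ⊤ := by
    rw [← h0]
    congr 1
    ext x
    simp
  obtain ⟨e, he1, he2⟩ := exists_e h1
  have h2 := gram_ne he1 he2
  let e' : Fin d × Fin d → FreeGroup (Fin k) := fun i => e i
  have h3 : ev (mapφ ψ Φ) (Dp e') ≠ 0 := by
    rw [ev_Dp]
    simpa [gram, e'] using h2
  have h4 : ev (mapφ ι Φ) (Dp e') ≠ 0 := by
    rw [ev_map] at h3 ⊢
    intro h5
    apply h3
    rw [hι (h5.trans (map_zero ι).symm), map_zero]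
  rw [eq_top_iff]
  intro M _
  rw [eq_co h4 M]
  exact Submodule.sum_mem _ fun i _ => Submodule.smul_mem _ _ (Submodule.subset_span ⟨e' i, (e i).2, rfl⟩)

lemma PI_prime (hd : 2 ≤ d) (IH : ∀ d' < d, Main d') (I : Ideal (PR d k)) (hI : ∀ J > I, PI d k J)
    (A : Type) [CommRing A] [IsDomain A] (q : PR d k →+* A) (hqs : Function.Surjective q) (hqI : ∀ p, q p = 0 ↔ p ∈ I)
    (hdetI : ∀ i : Fin k, (gmat d i).det - 1 ∈ I) : PI d k I := by
  classical
  haveI : Algebra.FiniteType ℤ A := Algebra.FiniteType.of_surjective (R := ℤ) (A := PR d k) q.toIntAlgHom hqs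
  let sl : Matrix.SpecialLinearGroup (Fin d) A →* Matrix (Fin d) (Fin d) A :=
    { toFun := Subtype.val, map_one' := rfl, map_mul' := fun _ _ => rfl }
  let g : Fin k → Matrix.SpecialLinearGroup (Fin d) A := fun i =>
    ⟨(gmat d i).map q, by
      have h1 : q (gmat d i).det = 1 := by
        rw [← map_one q]
        exact sub_eq_zero.1 ((map_sub q _ _).symm.trans ((hqI _).2 (hdetI i)))
      rw [RingHom.map_det] at h1
      exact h1⟩
  let Φ : FreeGroup (Fin k) →* Matrix (Fin d) (Fin d) A := sl.comp (FreeGroup.lift g)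
  have hΦdet : ∀ w, (Φ w).det = 1 := fun w => Matrix.SpecialLinearGroup.det_coe _
  have hΦof : ∀ i, Φ (FreeGroup.of i) = (gmat d i).map q := by
    intro i
    have h1 : FreeGroup.lift g (FreeGroup.of i) = g i := FreeGroup.lift_apply_of
    exact congrArg sl h1
  have hspec : ∀ (K : Type) [Field K] (φ : FreeGroup (Fin k) →* Matrix (Fin d) (Fin d) K) (h : ∀ p ∈ I, gen φ p = 0),
      ∃ ψ : A →+* K, (∀ p, ψ (q p) = gen φ p) ∧ mapφ ψ Φ = φ := by
    intro K _ φ h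
    have hψ : ∀ p, RingHom.liftOfSurjective q hqs ⟨gen φ, fun p hp => h p ((hqI p).1 hp)⟩ (q p) = gen φ p := fun p =>
      RingHom.liftOfRightInverse_comp_apply q _ _ _ p
    refine ⟨_, hψ, ?_⟩
    apply FreeGroup.ext_hom
    intro i
    rw [mapφ_apply, hΦof, ← gen_gmat φ i, Matrix.map_map]
    congr 1
    exact funext hψ
  let L := AlgebraicClosure (FractionRing A)
  let ι : A →+* L := (algebraMap (FractionRing A) L).comp (algebraMap A (FractionRing A))
  have hι : Function.Injective ι := (algebraMap (FractionRing A) L).injective.comp (IsFractionRing.injective A (FractionRing A))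
  by_cases hSI : SI (mapφ ι Φ)
  · obtain ⟨f, hf, ε1, hε1, h1⟩ := key_prop hd ι hι Φ hΦdet hSI
    obtain ⟨f', rfl⟩ := hqs f
    have hf' : f' ∉ I := fun h => hf ((hqI _).2 h)
    obtain ⟨ε2, hε2, h2⟩ := hI _ (lt_sup_span hf')
    refine ⟨min ε1 ε2, lt_min hε1 hε2, ?_⟩
    intro K _ _ φ hdet hker hVS X ρ hρ
    by_cases h0 : gen φ f' = 0
    · exact (h2 K φ hdet (mem_sup_span _ hker h0) hVS X ρ hρ).mono (min_le_right _ _)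
    · obtain ⟨ψ, hψ1, hψ2⟩ := hspec K φ hker
      refine (h1 K ψ (by rwa [hψ1]) ?_ X ρ ?_).mono (min_le_left _ _)
      · rw [hψ2]; exact hVS
      · rw [hψ2]; exact hρ
  · unfold SI at hSI
    push Not at hSI
    obtain ⟨Δ, hΔ, hsp⟩ := hSI
    obtain ⟨ε, hε, h⟩ := red (by omega) IH Δ hΔ
    refine ⟨ε, hε, ?_⟩
    intro K _ _ φ hdet hker hVS X ρ hρ
    refine h K φ ?_ hVS X ρ hρ
    obtain ⟨ψ, hψ1, hψ2⟩ := hspec K φ hker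
    have := span_special ι hι Φ Δ hsp K ψ
    rwa [hψ2] at this

lemma PI_step (hd : 2 ≤ d) (IH : ∀ d' < d, Main d') (I : Ideal (PR d k)) (hI : ∀ J > I, PI d k J) : PI d k I := by
  classical
  by_cases htop : I = ⊤
  · refine ⟨1, one_pos, fun K _ _ φ _ h => ?_⟩
    have := h 1 (by rw [htop]; trivial)
    rw [map_one] at this
    exact absurd this one_ne_zero
  by_cases hprime : I.IsPrime
  swap
  · rw [Ideal.isPrime_iff] at hprime
    push Not at hprime
    obtain ⟨x, y, hxy, hx, hy⟩ := hprime htop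
    obtain ⟨ε1, hε1, h1⟩ := hI _ (lt_sup_span hx)
    obtain ⟨ε2, hε2, h2⟩ := hI _ (lt_sup_span hy)
    refine ⟨min ε1 ε2, lt_min hε1 hε2, ?_⟩
    intro K _ _ φ hdet hker hVS X ρ hρ
    have := hker _ hxy
    rw [map_mul] at this
    rcases mul_eq_zero.1 this with h | h
    · exact (h1 K φ hdet (mem_sup_span _ hker h) hVS X ρ hρ).mono (min_le_left _ _)
    · exact (h2 K φ hdet (mem_sup_span _ hker h) hVS X ρ hρ).mono (min_le_right _ _)
  by_cases hdetI : ∃ i : Fin k, (gmat d i).det - 1 ∉ I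
  · obtain ⟨i, hi⟩ := hdetI
    obtain ⟨ε1, hε1, h1⟩ := hI _ (lt_sup_span hi)
    refine ⟨ε1, hε1, ?_⟩
    intro K _ _ φ hdet hker hVS X ρ hρ
    refine h1 K φ hdet (mem_sup_span _ hker ?_) hVS X ρ hρ
    rw [map_sub, map_one, RingHom.map_det, RingHom.mapMatrix_apply, gen_gmat, hdet, sub_self]
  push Not at hdetI
  haveI := hprime
  exact PI_prime hd IH I hI (PR d k ⧸ I) (Ideal.Quotient.mk I) Ideal.Quotient.mk_surjective (fun p => Ideal.Quotient.eq_zero_iff_mem) hdetI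

lemma twist (hd : 0 < d) {K : Type} [Field K] [IsAlgClosed K] (φ : FreeGroup (Fin k) →* Matrix (Fin d) (Fin d) K) :
    ∃ φ' : FreeGroup (Fin k) →* Matrix (Fin d) (Fin d) K, (∀ w, (φ' w).det = 1) ∧ ∀ w, Scal K (φ' w) ↔ Scal K (φ w) := by
  let δ : FreeGroup (Fin k) →* Kˣ := (Units.map (Matrix.detMonoidHom : Matrix (Fin d) (Fin d) K →* K)).comp φ.toHomUnits
  have hδ : ∀ w, (δ w : K) = (φ w).det := fun w => rfl
  have hc : ∀ i : Fin k, ∃ c : Kˣ, c ^ d * δ (FreeGroup.of i) = 1 := by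
    intro i
    obtain ⟨z, hz⟩ := IsAlgClosed.exists_pow_nat_eq ((δ (FreeGroup.of i))⁻¹ : Kˣ).val hd
    have hz0 : z ≠ 0 := by
      rintro rfl
      rw [zero_pow hd.ne'] at hz
      exact Units.ne_zero _ hz.symm
    refine ⟨Units.mk0 z hz0, Units.ext ?_⟩
    simp only [Units.val_mul, Units.val_pow_eq_pow_val, Units.val_mk0, hz]
    simp
  choose c hc using hc
  let χ : FreeGroup (Fin k) →* Kˣ := FreeGroup.lift c
  let φ' : FreeGroup (Fin k) →* Matrix (Fin d) (Fin d) K :=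
    { toFun := fun w => (χ w : K) • φ w
      map_one' := by simp
      map_mul' := fun x y => by simp [smul_smul, mul_comm] }
  have hφ' : ∀ w, φ' w = (χ w : K) • φ w := fun _ => rfl
  refine ⟨φ', ?_, ?_⟩
  · intro w
    let η : FreeGroup (Fin k) →* Kˣ :=
      { toFun := fun w => χ w ^ d * δ w
        map_one' := by simp
        map_mul' := fun x y => by rw [map_mul, map_mul, mul_pow]; exact mul_mul_mul_comm _ _ _ _ }
    have h1 : η = 1 := by
      apply FreeGroup.ext_hom
      intro i
      show (FreeGroup.lift c (FreeGroup.of i)) ^ d * δ (FreeGroup.of i) = 1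
      rw [FreeGroup.lift_apply_of]
      exact hc i
    have h2 : χ w ^ d * δ w = 1 := DFunLike.congr_fun h1 w
    have h3 := congrArg Units.val h2
    rw [hφ', Matrix.det_smul, Fintype.card_fin, ← hδ]
    simpa using h3
  · intro w
    rw [hφ']
    constructor
    · rintro ⟨a, ha⟩
      refine ⟨((χ w)⁻¹ : Kˣ).val * a, ?_⟩
      rw [mul_smul, ← ha, smul_smul]
      simp
    · rintro ⟨a, ha⟩
      exact ⟨χ w * a, by rw [ha, smul_smul]⟩

lemma main_step (IH : ∀ d' < d, Main d') : Main d := by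
  intro k
  by_cases hd : 2 ≤ d
  · obtain ⟨ε, hε, h⟩ := IsNoetherian.induction (P := PI d k) (PI_step hd IH) ⊥
    refine ⟨ε, hε, ?_⟩
    intro K _ _ φ hVS X ρ hρ
    obtain ⟨φ', h1, h2⟩ := twist (by omega) φ
    refine h K φ' h1 ?_ ?_ X ρ ?_
    · intro p hp
      rw [Submodule.mem_bot] at hp
      rw [hp, map_zero]
    · rintro ⟨Δ, hΔ, n, hn⟩
      exact hVS ⟨Δ, hΔ, n, fun w hw => (h2 w).1 (hn w hw)⟩
    · intro w x hw
      exact (h2 w).2 (hρ w x hw)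
  · refine ⟨1, one_pos, ?_⟩
    intro K _ _ φ hVS
    exfalso
    apply hVS
    refine ⟨⊤, inferInstance, 0, fun w _ => ?_⟩
    interval_cases d
    · exact ⟨0, by ext i; exact i.elim0⟩
    · refine ⟨φ w 0 0, ?_⟩
      ext i j
      rw [Subsingleton.elim i 0, Subsingleton.elim j 0]
      simp

theorem main_thm (d : ℕ) : Main d := Nat.strong_induction_on d fun _ IH => main_step IH
end

lemma fg_one_comm (x y : FreeGroup (Fin 1)) : x * y = y * x := by
  have h1 : ∀ x : FreeGroup (Fin 1), Commute x (FreeGroup.of 0) := by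
    intro x
    induction x using FreeGroup.induction_on with
    | C1 => exact Commute.one_left _
    | of i => rw [Subsingleton.elim i 0]
    | inv_of i h => exact h.inv_left
    | mul x y hx hy => exact hx.mul_left hy
  have h2 : ∀ y : FreeGroup (Fin 1), Commute x y := by
    intro y
    induction y using FreeGroup.induction_on with
    | C1 => exact Commute.one_right _
    | of i => rw [Subsingleton.elim i 0]; exact h1 x
    | inv_of i h => exact h.inv_right
    | mul x y hx hy => exact hx.mul_right hy
  exact h2 y

lemma not_VS {d k : ℕ} {K : Type} [Field K] (a : Fin k → GL (Fin d) K) {K' : Type} [Field K'] (ι : K →+* K')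
    (h : ¬(∃ H : Subgroup ↥(Subgroup.closure (Set.range a)), H.FiniteIndex ∧ IsSolvable ↥H))
    (φ : FreeGroup (Fin k) →* Matrix (Fin d) (Fin d) K') (hφ : ∀ w, φ w = 1 → FreeGroup.lift a w = 1) : ¬ VS φ := by
  rintro ⟨Δ, hΔ, n, hn⟩
  apply h
  have hmem : ∀ w, FreeGroup.lift a w ∈ Subgroup.closure (Set.range a) := by
    intro w
    rw [← FreeGroup.range_lift_eq_closure]
    exact ⟨w, rfl⟩
  let π : FreeGroup (Fin k) →* Subgroup.closure (Set.range a) := (FreeGroup.lift a).codRestrict _ hmem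
  have hπ : Function.Surjective π := by
    rintro ⟨y, hy⟩
    rw [← FreeGroup.range_lift_eq_closure] at hy
    obtain ⟨w, rfl⟩ := hy
    exact ⟨w, rfl⟩
  have hn' : ∀ w ∈ Ds Δ (n + 1), π w = 1 := by
    intro w hw
    rw [Ds_succ] at hw
    have := comm_ker φ (Ds Δ n) (fun x hx y hy => by
      obtain ⟨c, hc⟩ := hn x hx
      rw [hc]; simp) w hw
    exact Subtype.ext (hφ w this)
  refine ⟨Δ.map π, ?_, ?_⟩
  · constructor
    exact fun h0 => hΔ.index_ne_zero (Nat.eq_zero_of_zero_dvd (h0 ▸ Subgroup.index_map_dvd Δ hπ))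
  · refine ⟨n + 1, ?_⟩
    have h1 : Ds (Δ.map π) (n + 1) = ⊥ := by
      rw [Ds_map, eq_bot_iff]
      rintro _ ⟨w, hw, rfl⟩
      exact hn' w hw
    exact (Subgroup.map_eq_bot_iff_of_injective _ (Subgroup.subtype_injective _)).1 h1
theorem cogrowth_gap_final : ∀ d k : ℕ, 1 ≤ d → 1 ≤ k → ∃ ε : ℝ, 0 < ε ∧ ∀ (K : Type) [Field K], ∀ a : Fin k → GL (Fin d) K, ¬(∃ H : Subgroup ↥(Subgroup.closure (Set.range a)), H.FiniteIndex ∧ IsSolvable ↥H) → ∀ n : ℕ, 1 ≤ n → ((Set.ncard {w : FreeGroup (Fin k) | (FreeGroup.toWord w).length ≤ n ∧ FreeGroup.lift a w = 1}) : ℝ) ≤ Real.exp (-ε * n) * (Set.ncard {w : FreeGroup (Fin k) | (FreeGroup.toWord w).length ≤ n} : ℝ) := by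
  intro d k hd hk
  obtain ⟨ε, hε, h⟩ := main_thm d k
  have key : ∀ (K : Type) [Field K] (a : Fin k → GL (Fin d) K),
      ¬(∃ H : Subgroup ↥(Subgroup.closure (Set.range a)), H.FiniteIndex ∧ IsSolvable ↥H) →
      ∃ φ : FreeGroup (Fin k) →* Matrix (Fin d) (Fin d) (AlgebraicClosure K), ¬ VS φ ∧ ∀ w, φ w = 1 ↔ FreeGroup.lift a w = 1 := by
    intro K _ a ha
    let φ : FreeGroup (Fin k) →* Matrix (Fin d) (Fin d) (AlgebraicClosure K) :=
      ((algebraMap K (AlgebraicClosure K)).mapMatrix : Matrix (Fin d) (Fin d) K →+* _).toMonoidHom.comp ((Units.coeHom _).comp (FreeGroup.lift a))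
    have hφ : ∀ w, φ w = 1 ↔ FreeGroup.lift a w = 1 := by
      intro w
      have e : φ w = ((FreeGroup.lift a w : GL (Fin d) K) : Matrix (Fin d) (Fin d) K).map (algebraMap K (AlgebraicClosure K)) := rfl
      constructor
      · intro h1
        apply Units.ext
        apply Matrix.map_injective (algebraMap K (AlgebraicClosure K)).injective
        show Matrix.map _ _ = Matrix.map _ _
        rw [← e, h1]
        simp
      · intro h1
        rw [e, h1]
        simp
    exact ⟨φ, not_VS a (algebraMap K (AlgebraicClosure K)) ha φ fun w => (hφ w).1, hφ⟩
  by_cases hk2 : 2 ≤ k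
  · obtain ⟨ε', hε', h'⟩ := count_of_gap k hk2 ε hε
    refine ⟨ε', hε', ?_⟩
    intro K _ a ha n hn
    obtain ⟨φ, hVS, hφ⟩ := key K a ha
    refine h' (GL (Fin d) K) (FreeGroup.lift a) ?_ ?_ n hn
    · by_contra hc
      push Not at hc
      have h1 : FreeGroup.lift a = 1 := FreeGroup.ext_hom _ _ hc
      apply hVS
      apply vs_of_finite
      refine (Set.finite_singleton 1).subset ?_
      rintro _ ⟨w, rfl⟩
      exact (hφ w).2 (by rw [h1]; rfl)
    · refine h _ φ hVS _ _ ?_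
      intro w x hw
      rw [regRep_apply] at hw
      refine ⟨1, ?_⟩
      rw [one_smul]
      exact (hφ w).2 (by simpa using hw)
  · refine ⟨1, one_pos, ?_⟩
    intro K _ a ha
    exfalso
    obtain ⟨φ, hVS, hφ⟩ := key K a ha
    obtain rfl : k = 1 := by omega
    apply hVS
    refine ⟨⊤, inferInstance, 1, ?_⟩
    show ∀ w ∈ Ds ⊤ 1, _
    rw [Ds_succ]
    intro w hw
    refine ⟨1, ?_⟩
    rw [one_smul]
    exact comm_ker φ _ (fun x _ y _ => by rw [← map_mul, ← map_mul, fg_one_comm]) w hw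

end CG

/-- **Co-growth gap.** For all `d, k ≥ 1` there is `ε > 0` such that whenever `a_1, …, a_k`
generate a non virtually solvable subgroup of `GL_d(K)`, the number of relations of word length
at most `n` among them is at most `exp(-εn)` times the number of elements of the free group `F_k`
of word length at most `n`. -/
theorem cogrowth_gap :
    ∀ d k : ℕ, 1 ≤ d → 1 ≤ k → ∃ ε : ℝ, 0 < ε ∧
      ∀ (K : Type) [Field K], ∀ a : Fin k → GL (Fin d) K,
        ¬(∃ H : Subgroup ↥(Subgroup.closure (Set.range a)),
            H.FiniteIndex ∧ IsSolvable ↥H) →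
        ∀ n : ℕ, 1 ≤ n →
          (({w : FreeGroup (Fin k) |
              (FreeGroup.toWord w).length ≤ n ∧ FreeGroup.lift a w = 1}).ncard : ℝ) ≤
            Real.exp (-ε * n) *
              (({w : FreeGroup (Fin k) | (FreeGroup.toWord w).length ≤ n}).ncard : ℝ) :=
  CG.cogrowth_gap_final
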